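/- There is an absolute constant C > 0 such that the following holds. Let A ⊆ ℝ be a bounded measurable set with |A| > 0, |co(A)| ≥ C|A| and |A+A| < 4|A|. Then there is a least t ∈ ℕ such that A is contained in a union of t closed intervals whose union has measure < 2|A|, and this t satisfies t ≥ 2. Set δ := |A+A|/|A| − (4 − 2/t). Then: δ ≥ 0; there exist a convex set K ⊆ ℝ², a linear map φ : ℝ² → ℝ and x₀ ∈ ℝ such that P := x₀ + φ(K ∩ (ℝ×ℤ)) is (a translate of) a proper convex (1,1)-progression with A ⊆ P and |P \ A| ≤ |A|; and moreover, if δ ≤ (2t)^{−2}, then such a P exists with |P \ A| ≤ 150·δ·|A|, and in addition there exist a, v, b, c ∈ ℝ with b + i·c ≥ 0 for all 0 ≤ i ≤ t−1 such that S := ⋃_{i=0}^{t−1} [a + i·v, a + i·v + b + i·c] satisfies A ⊆ S and |S \ A| ≤ 500·t·δ·|A|. -/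

import Mathlib

open Set Pointwise MeasureTheory ENNReal

/-- `K` and `φ` define a proper convex `(1,1)`-progression `φ(K ∩ (ℝ × ℤ))`:
`K ⊆ ℝ²` is convex, the images of distinct fibres `K ∩ (ℝ × {n})` are disjoint up to
Lebesgue-null sets, and the measure of the progression is the sum of the fibre measures. -/
def IsProperCP11 (K : Set (ℝ × ℝ)) (φ : (ℝ × ℝ) →ₗ[ℝ] ℝ) : Prop :=
  Convex ℝ K ∧
  (∀ m n : ℤ, m ≠ n →
    volume ((φ '' (K ∩ {p | p.2 = (m : ℝ)})) ∩ (φ '' (K ∩ {p | p.2 = (n : ℝ)}))) = 0) ∧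
  volume (φ '' (K ∩ {p | ∃ n : ℤ, p.2 = (n : ℝ)})) =
    ∑' n : ℤ, volume {y : ℝ | (y, (n : ℝ)) ∈ K}

/-- The translate by `x₀` of the convex `(1,1)`-progression determined by `K` and `φ`. -/
def cp11Set (K : Set (ℝ × ℝ)) (φ : (ℝ × ℝ) →ₗ[ℝ] ℝ) (x₀ : ℝ) : Set ℝ :=
  (fun y => x₀ + y) '' (φ '' (K ∩ {p | ∃ n : ℤ, p.2 = (n : ℝ)}))

/-- `A` is covered by `t` closed intervals whose union has measure `< 2|A|`. -/
def CoveredByIntervals (A : Set ℝ) (t : ℕ) : Prop :=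
  ∃ f g : Fin t → ℝ, A ⊆ ⋃ i, Set.Icc (f i) (g i) ∧
    volume (⋃ i, Set.Icc (f i) (g i)) < 2 * volume A

/-- The normalised doubling excess `|A+A|/|A| - (4 - 2/t)`. -/
noncomputable def dblExcess (A : Set ℝ) (t : ℕ) : ℝ :=
  (volume (A + A)).toReal / (volume A).toReal - (4 - 2 / (t : ℝ))

/-- An arithmetic progression of `t` intervals whose lengths are in arithmetic
progression. -/
def apIntervals (a v b c : ℝ) (t : ℕ) : Set ℝ :=
  ⋃ i ∈ Finset.range t, Set.Icc (a + i * v) (a + i * v + b + i * c)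

/-- One-dimensional Brunn–Minkowski for compact sets. -/
lemma volume_add_le_of_isCompact {X Y : Set ℝ} (hX : IsCompact X) (hY : IsCompact Y)
    (hX0 : X.Nonempty) (hY0 : Y.Nonempty) : volume X + volume Y ≤ volume (X + Y) := by
  obtain ⟨x, hxX, hx⟩ := hX.exists_isGreatest hX0
  obtain ⟨y, hyY, hy⟩ := hY.exists_isLeast hY0
  have h1 : volume ((fun z => z + y) '' X) = volume X := by
    rw [image_add_right, measure_preimage_add_right]
  have h2 : volume ((fun z => x + z) '' Y) = volume Y := by
    rw [image_add_left, measure_preimage_add]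
  have hd : AEDisjoint volume ((fun z => z + y) '' X) ((fun z => x + z) '' Y) := by
    refine measure_mono_null (t := {x + y}) ?_ (by simp)
    rintro _ ⟨⟨a, ha, rfl⟩, b, hb, hab⟩
    have := hx ha; have := hy hb
    simp only [mem_singleton_iff] at *
    linarith
  calc volume X + volume Y
      = volume ((fun z => z + y) '' X ∪ (fun z => x + z) '' Y) := by
        rw [measure_union₀ _ hd, h1, h2]
        exact (hY.image (by fun_prop)).measurableSet.nullMeasurableSet
    _ ≤ _ := measure_mono (by
        rintro _ (⟨a, ha, rfl⟩ | ⟨b, hb, rfl⟩)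
        · exact add_mem_add ha hyY
        · exact add_mem_add hxX hb)

/-- One-dimensional Brunn–Minkowski. -/
lemma volume_add_volume_le {X Y : Set ℝ} (hX : MeasurableSet X) (hY : MeasurableSet Y)
    (hX0 : X.Nonempty) (hY0 : Y.Nonempty) : volume X + volume Y ≤ volume (X + Y) := by
  obtain ⟨x, hx⟩ := hX0
  obtain ⟨y, hy⟩ := hY0
  rw [hX.measure_eq_iSup_isCompact, hY.measure_eq_iSup_isCompact]
  refine ENNReal.biSup_add_biSup_le' (p := fun K => K ⊆ X ∧ IsCompact K)
    (q := fun K => K ⊆ Y ∧ IsCompact K) ⟨∅, by simp⟩ ⟨∅, by simp⟩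
    (f := fun K => volume K) (g := fun K => volume K) (a := volume (X + Y)) ?_ |>.trans' ?_
  · rintro K ⟨hK, hKc⟩ K' ⟨hK', hKc'⟩
    calc volume K + volume K' ≤ volume (insert x K) + volume (insert y K') := by
          gcongr <;> exact subset_insert _ _
      _ ≤ volume (insert x K + insert y K') :=
          volume_add_le_of_isCompact (hKc.insert x) (hKc'.insert y) ⟨x, by simp⟩ ⟨y, by simp⟩
      _ ≤ _ := measure_mono (add_subset_add (insert_subset hx hK) (insert_subset hy hK'))
  · simp only [iSup_and]; rfl

section Circle
variable {T : ℝ} [hT : Fact (0 < T)]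

lemma continuous_volume_inter_sub {B C : Set (AddCircle T)} (hB : MeasurableSet B)
    (hC : MeasurableSet C) :
    Continuous fun t : AddCircle T => volume.real (C ∩ (fun x => x + t) ⁻¹' B) := by
  rw [continuous_iff_continuousAt]
  intro t
  have key : Filter.Tendsto (fun s : AddCircle T =>
      volume (symmDiff ((fun x => x + s) ⁻¹' B) ((fun x => x + t) ⁻¹' B))) (nhds t) (nhds 0) := by
    let F : AddCircle T → C(AddCircle T, AddCircle T) := fun s => ⟨fun x => x + s, by fun_prop⟩
    have hF : Continuous F := ContinuousMap.continuous_of_continuous_uncurry _ (by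
      simp only [Function.uncurry_def, F, ContinuousMap.coe_mk]; fun_prop)
    have hF' : ∀ s, MeasurePreserving (F s) volume volume :=
      fun s => measurePreserving_add_right volume s
    exact tendsto_measure_symmDiff_preimage_nhds_zero (f := F) (g := F t) (μ := volume)
      (ν := volume) (hF.tendsto t) (Filter.Eventually.of_forall hF') (hF' t)
      hB.nullMeasurableSet (measure_ne_top _ _)
  have key' : Filter.Tendsto (fun s : AddCircle T =>
      volume.real (symmDiff ((fun x => x + s) ⁻¹' B) ((fun x => x + t) ⁻¹' B))) (nhds t) (nhds 0) := by
    have := (ENNReal.tendsto_toReal (zero_ne_top)).comp key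
    rwa [toReal_zero] at this
  rw [ContinuousAt, tendsto_iff_dist_tendsto_zero]
  refine squeeze_zero (fun _ => dist_nonneg) (fun s => ?_) key'
  rw [Real.dist_eq]
  refine (abs_measureReal_sub_le_measureReal_symmDiff' ?_ ?_ (by simp) (by simp)).trans ?_
  · exact (hC.inter (hB.preimage (by fun_prop))).nullMeasurableSet
  · exact (hC.inter (hB.preimage (by fun_prop))).nullMeasurableSet
  · refine measureReal_mono ?_
    rw [← inter_symmDiff_distrib_left]; exact inter_subset_right

lemma exists_volume_inter_eq {B C : Set (AddCircle T)} (hB : MeasurableSet B)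
    (hC : MeasurableSet C) : ∃ t : AddCircle T,
      T * volume.real (C ∩ (fun x => x + t) ⁻¹' B) = volume.real B * volume.real C := by
  have hcont := continuous_volume_inter_sub hB hC
  have hIint : ∫ t : AddCircle T, volume.real (C ∩ (fun x => x + t) ⁻¹' B)
      = volume.real B * volume.real C := by
    have h1 : ∀ t : AddCircle T, volume.real (C ∩ (fun x => x + t) ⁻¹' B)
        = ∫ x, C.indicator (fun _ => (1:ℝ)) x * B.indicator (fun _ => (1:ℝ)) (x + t) := by
      intro t
      rw [← integral_indicator_one (hC.inter (hB.preimage (by fun_prop)))]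
      congr 1; ext x
      by_cases h : x ∈ C <;> by_cases h' : x + t ∈ B <;> simp [indicator, h, h']
    simp_rw [h1]
    rw [integral_integral_swap]
    · simp_rw [integral_const_mul]
      have h2 : ∀ x : AddCircle T, ∫ t, B.indicator (fun _ => (1:ℝ)) (x + t) = volume.real B := by
        intro x
        rw [integral_add_left_eq_self (fun t => B.indicator (fun _ => (1:ℝ)) t) x]
        exact integral_indicator_one hB
      simp_rw [h2]
      rw [integral_mul_const, mul_comm]
      congr 1
      exact integral_indicator_one hC
    · refine Integrable.mono' (g := fun _ => (1:ℝ)) (integrable_const _) ?_ ?_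
      · refine (Measurable.mul ?_ ?_).aestronglyMeasurable
        · exact (measurable_const.indicator hC).comp measurable_snd
        · exact (measurable_const.indicator hB).comp (by fun_prop)
      · refine Filter.Eventually.of_forall fun p => ?_
        simp only [Function.uncurry, indicator]
        split_ifs <;> simp
  have hTv : volume.real (univ : Set (AddCircle T)) = T := by
    simp [measureReal_def, AddCircle.measure_univ, hT.out.le]
  have hTp := hT.out
  have hi : Integrable (fun t : AddCircle T => volume.real (C ∩ (fun x => x + t) ⁻¹' B)) := by
    refine Integrable.mono' (g := fun _ => volume.real C) (integrable_const _)
      hcont.aestronglyMeasurable (Filter.Eventually.of_forall fun t => ?_)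
    rw [Real.norm_of_nonneg measureReal_nonneg]
    exact measureReal_mono inter_subset_left
  have hav : ⨍ t : AddCircle T, volume.real (C ∩ (fun x => x + t) ⁻¹' B)
      = volume.real B * volume.real C / T := by
    rw [average_eq, hIint, hTv, smul_eq_mul]; field_simp
  obtain ⟨a, ha⟩ := exists_le_average (μ := volume)
    (by intro h; simp [h] at hTv; linarith) hi
  obtain ⟨b, hb⟩ := exists_average_le (μ := volume)
    (by intro h; simp [h] at hTv; linarith) hi
  rw [hav] at ha hb
  obtain ⟨t, ht⟩ := mem_range_of_exists_le_of_exists_ge hcont ⟨a, ha⟩ ⟨b, hb⟩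
  simp only at ht
  exact ⟨t, by rw [ht]; field_simp⟩

/-- Raikov's inequality on the circle. -/
lemma raikov {B C : Set (AddCircle T)} (hB : MeasurableSet B) (hC : MeasurableSet C)
    (hB0 : B.Nonempty) (hC0 : C.Nonempty) :
    min T (volume.real B + volume.real C) ≤ volume.real (B + C) := by
  have hTp := hT.out
  by_contra! hlt
  obtain ⟨hS1, hS2⟩ := lt_min_iff.1 hlt
  set S := volume.real (B + C) with hS
  have hSB : volume.real B ≤ S := by
    obtain ⟨c, hc⟩ := hC0
    have : volume.real ((fun z => z + c) '' B) = volume.real B := by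
      rw [image_add_right, measureReal_def, measure_preimage_add_right, measureReal_def]
    rw [← this]
    exact measureReal_mono (by rintro _ ⟨a, ha, rfl⟩; exact add_mem_add ha hc)
  have hSC : volume.real C ≤ S := by
    obtain ⟨c, hc⟩ := hB0
    have : volume.real ((fun z => c + z) '' C) = volume.real C := by
      rw [image_add_left, measureReal_def, measure_preimage_add, measureReal_def]
    rw [← this]
    exact measureReal_mono (by rintro _ ⟨a, ha, rfl⟩; exact add_mem_add hc ha)
  have hBp : 0 < volume.real B := by linarith
  have hCp : 0 < volume.real C := by linarith
  have step : ∀ n : ℕ, ∃ B' C' : Set (AddCircle T), MeasurableSet B' ∧ MeasurableSet C' ∧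
      0 < volume.real C' ∧ volume.real B ≤ volume.real B' ∧
      volume.real B' + volume.real C' = volume.real B + volume.real C ∧ B' + C' ⊆ B + C ∧
      volume.real C' ≤ volume.real C * (S / T) ^ n := by
    intro n
    induction n with
    | zero => exact ⟨B, C, hB, hC, hCp, le_rfl, rfl, subset_rfl, by simp⟩
    | succ n ih =>
      obtain ⟨B', C', hB', hC', hCp', hBB, hsum, hsub, hle⟩ := ih
      obtain ⟨t, ht⟩ := exists_volume_inter_eq hB' hC'
      have hmt : MeasurableSet ((fun x => x + t) ⁻¹' B') := hB'.preimage (by fun_prop)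
      have himg : (fun x => x + t) '' (C' \ (fun x => x + t) ⁻¹' B')
          = (fun x => x + -t) ⁻¹' (C' \ (fun x => x + t) ⁻¹' B') := by
        rw [image_add_right]
      have hmi : MeasurableSet ((fun x => x + t) '' (C' \ (fun x => x + t) ⁻¹' B')) := by
        rw [himg]; exact (hC'.diff hmt).preimage (by fun_prop)
      have hvi : volume.real ((fun x => x + t) '' (C' \ (fun x => x + t) ⁻¹' B'))
          = volume.real (C' \ (fun x => x + t) ⁻¹' B') := by
        rw [himg, measureReal_def, measure_preimage_add_right, measureReal_def]
      have hB'S : volume.real B' ≤ S := by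
        have hne : C'.Nonempty := by
          by_contra h; rw [not_nonempty_iff_eq_empty] at h; simp [h] at hCp'
        obtain ⟨c, hc⟩ := hne
        have : volume.real ((fun z => z + c) '' B') = volume.real B' := by
          rw [image_add_right, measureReal_def, measure_preimage_add_right, measureReal_def]
        rw [← this]
        exact measureReal_mono (by rintro _ ⟨a, ha, rfl⟩; exact hsub (add_mem_add ha hc))
      refine ⟨B' ∪ (fun x => x + t) '' (C' \ (fun x => x + t) ⁻¹' B'),
        C' ∩ (fun x => x + t) ⁻¹' B', hB'.union hmi, hC'.inter hmt, ?_, ?_, ?_, ?_, ?_⟩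
      · have : 0 < volume.real B' * volume.real C' := by
          apply mul_pos _ hCp'; linarith
        rw [← ht] at this
        exact pos_of_mul_pos_right this hTp.le
      · exact hBB.trans (measureReal_mono subset_union_left)
      · rw [measureReal_union _ hmi, hvi, ← hsum, add_assoc,
          add_comm (volume.real (C' \ _)), measureReal_inter_add_sdiff hmt]
        rw [Set.disjoint_left]
        rintro _ h ⟨a, ⟨-, ha⟩, rfl⟩
        exact ha h
      · rintro _ ⟨a, ha, b, ⟨hb1, hb2⟩, rfl⟩
        rcases ha with ha | ⟨a, ⟨ha, -⟩, rfl⟩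
        · exact hsub (add_mem_add ha hb1)
        · have := hsub (add_mem_add hb2 ha)
          convert this using 1
          simp only; abel
      · have h1 : volume.real (C' ∩ (fun x => x + t) ⁻¹' B') = volume.real C' * (volume.real B' / T) := by
          field_simp; linarith
        rw [h1, pow_succ, ← mul_assoc]
        gcongr
  have hlim : Filter.Tendsto (fun n : ℕ => volume.real C * (S / T) ^ n) Filter.atTop (nhds (volume.real C * 0)) :=
    (_root_.tendsto_pow_atTop_nhds_zero_of_lt_one (by positivity) (by rwa [div_lt_one hTp])).const_mul _
  rw [mul_zero] at hlim
  obtain ⟨n, hn⟩ := (hlim.eventually (gt_mem_nhds (sub_pos.2 hS2))).exists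
  obtain ⟨B', C', hB', hC', hCp', hBB, hsum, hsub, hle⟩ := step n
  have hB'S : volume.real B' ≤ S := by
    have hne : C'.Nonempty := by
      by_contra h; rw [not_nonempty_iff_eq_empty] at h; simp [h] at hCp'
    obtain ⟨c, hc⟩ := hne
    have : volume.real ((fun z => z + c) '' B') = volume.real B' := by
      rw [image_add_right, measureReal_def, measure_preimage_add_right, measureReal_def]
    rw [← this]
    exact measureReal_mono (by rintro _ ⟨a, ha, rfl⟩; exact hsub (add_mem_add ha hc))
  linarith

end Circle

section Circle
variable {T : ℝ} [hT : Fact (0 < T)]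

lemma measurableSet_coe_image {S : Set ℝ} (hS : MeasurableSet S) :
    MeasurableSet ((↑) '' S : Set (AddCircle T)) := by
  have hk : ∀ k : ℤ, MeasurableSet ((↑) '' (S ∩ Ioc (0 + k • T) (0 + (k + 1) • T)) :
      Set (AddCircle T)) := by
    intro k
    have h1 : 0 + (k + 1) • T = k • T + T := by simp [add_mul]
    have h2 : ((↑) '' (S ∩ Ioc (0 + k • T) (0 + (k + 1) • T)) : Set (AddCircle T))
        = (fun x => ((AddCircle.measurableEquivIoc T (k • T) x : Ioc (k • T) (k • T + T)) : ℝ)) ⁻¹' S := by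
      rw [h1, zero_add]
      ext x
      simp only [mem_image, mem_inter_iff, mem_preimage]
      constructor
      · rintro ⟨y, ⟨hy, hyI⟩, rfl⟩
        have : AddCircle.measurableEquivIoc T (k • T) (y : AddCircle T) = ⟨y, hyI⟩ :=
          Subtype.ext (AddCircle.equivIoc_coe_of_mem hyI)
        rw [this]; exact hy
      · intro h
        refine ⟨_, ⟨h, (AddCircle.measurableEquivIoc T (k • T) x).2⟩, ?_⟩
        exact AddCircle.coe_equivIoc
    rw [h2]
    exact hS.preimage (measurable_subtype_coe.comp (MeasurableEquiv.measurable _))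
  have : ((↑) '' S : Set (AddCircle T))
      = ⋃ k : ℤ, ((↑) '' (S ∩ Ioc (0 + k • T) (0 + (k + 1) • T))) := by
    rw [← image_iUnion, ← inter_iUnion, iUnion_Ioc_add_zsmul hT.out, inter_univ]
  rw [this]
  exact MeasurableSet.iUnion hk

lemma volume_coe_image_le (E : Set ℝ) :
    volume ((↑) '' E : Set (AddCircle T)) ≤ volume E := by
  set M := toMeasurable volume E
  have hM : MeasurableSet M := measurableSet_toMeasurable _ _
  calc volume ((↑) '' E : Set (AddCircle T)) ≤ volume ((↑) '' M : Set (AddCircle T)) :=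
        measure_mono (image_mono (subset_toMeasurable _ _))
    _ = volume ((((↑) : ℝ → AddCircle T) ⁻¹' ((↑) '' M)) ∩ Ioc 0 (0 + T)) :=
        AddCircle.add_projection_respects_measure T 0 (measurableSet_coe_image hM)
    _ ≤ volume (⋃ k : ℤ, ((fun x => x + k • T) ⁻¹' (M ∩ Ioc (0 + k • T) (0 + (k + 1) • T)))) := by
        refine measure_mono ?_
        rintro x ⟨⟨y, hy, hyx⟩, hx⟩
        obtain ⟨k, hk⟩ := QuotientAddGroup.eq.1 hyx.symm
        simp only at hk
        have hy' : x + k • T = y := by rw [hk]; ring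
        refine mem_iUnion.2 ⟨k, ?_⟩
        simp only [mem_preimage, hy']
        refine ⟨hy, ?_⟩
        rw [← hy']
        simp only [zsmul_eq_mul, mem_Ioc] at *
        push_cast
        constructor <;> nlinarith [hx.1, hx.2]
    _ ≤ ∑' k : ℤ, volume ((fun x => x + k • T) ⁻¹' (M ∩ Ioc (0 + k • T) (0 + (k + 1) • T))) :=
        measure_iUnion_le _
    _ = ∑' k : ℤ, volume (M ∩ Ioc (0 + k • T) (0 + (k + 1) • T)) := by
        simp_rw [measure_preimage_add_right]
    _ = volume (⋃ k : ℤ, (M ∩ Ioc (0 + k • T) (0 + (k + 1) • T))) := by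
        rw [measure_iUnion]
        · exact (pairwise_disjoint_Ioc_add_zsmul 0 T).mono fun i j h =>
            h.mono inter_subset_right inter_subset_right
        · exact fun k => hM.inter measurableSet_Ioc
    _ = volume E := by
        rw [← inter_iUnion, iUnion_Ioc_add_zsmul hT.out, inter_univ]
        exact measure_toMeasurable _

lemma volume_le_coe_image {S : Set ℝ} {a : ℝ} (hS : S ⊆ Icc a (a + T)) :
    volume S ≤ volume ((↑) '' S : Set (AddCircle T)) := by
  rw [← measure_toMeasurable ((↑) '' S : Set (AddCircle T)),
    AddCircle.add_projection_respects_measure T a (measurableSet_toMeasurable _ _)]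
  calc volume S ≤ volume (S \ {a} ∪ {a}) := measure_mono (by simp [subset_insert])
    _ ≤ volume (S \ {a}) + volume {a} := measure_union_le _ _
    _ = volume (S \ {a}) := by simp
    _ ≤ _ := measure_mono (by
      rintro x ⟨hx, hxa⟩
      refine ⟨subset_toMeasurable _ _ ⟨x, hx, rfl⟩, ?_, (hS hx).2⟩
      exact lt_of_le_of_ne (hS hx).1 (Ne.symm hxa))

lemma volume_coe_image_eq {S : Set ℝ} {a : ℝ} (hS : S ⊆ Icc a (a + T)) :
    volume ((↑) '' S : Set (AddCircle T)) = volume S :=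
  le_antisymm (volume_coe_image_le S) (volume_le_coe_image hS)

/-- Passing to the circle whose length is the diameter of `B`. -/
lemma volume_add_volume_circle_le {B : Set ℝ} (hB : MeasurableSet B) {l r : ℝ} (hl : IsLeast B l)
    (hr : IsGreatest B r) (hlr : r = l + T) :
    volume B + volume ((↑) '' B + (↑) '' B : Set (AddCircle T)) ≤ volume (B + B) := by
  have hm : MeasurableSet ((fun x => x + -r) ⁻¹' B) := hB.preimage (by fun_prop)
  have hsub : (fun x => x + -r) ⁻¹' B ⊆ B + B := fun x hx =>
    ⟨x + -r, hx, r, hr.1, by simp⟩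
  rw [← measure_inter_add_sdiff (B + B) hm, inter_eq_right.2 hsub, measure_preimage_add_right]
  gcongr
  calc volume ((↑) '' B + (↑) '' B : Set (AddCircle T))
      ≤ volume (((↑) '' ((B + B) \ (fun x => x + -r) ⁻¹' B) ∪ (↑) '' {l + r}) : Set (AddCircle T)) := by
        refine measure_mono ?_
        rintro _ ⟨_, ⟨b, hb, rfl⟩, _, ⟨c, hc, rfl⟩, rfl⟩
        by_cases h : b + c + -r ∈ B
        · by_cases h2 : b + c - T + -r ∈ B
          · right
            have h3 := hl.2 h2
            have h4 := hr.2 h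
            have : b + c = l + r + T := by linarith
            refine ⟨l + r, rfl, ?_⟩
            simp only
            rw [← AddCircle.coe_add, this, AddCircle.coe_add_period]
          · left
            refine ⟨b + c - T, ⟨⟨b + c + -r, h, l, hl.1, by simp only; linarith⟩, h2⟩, ?_⟩
            simp only
            rw [← AddCircle.coe_add, AddCircle.coe_sub, AddCircle.coe_period, sub_zero]
        · left
          exact ⟨b + c, ⟨⟨b, hb, c, hc, rfl⟩, h⟩, by simp⟩
    _ ≤ volume ((↑) '' ((B + B) \ (fun x => x + -r) ⁻¹' B) : Set (AddCircle T)) +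
        volume ((↑) '' {l + r} : Set (AddCircle T)) := measure_union_le _ _
    _ = volume ((↑) '' ((B + B) \ (fun x => x + -r) ⁻¹' B) : Set (AddCircle T)) := by
        have : volume ((↑) '' {l + r} : Set (AddCircle T)) = 0 :=
          le_antisymm ((volume_coe_image_le _).trans (by simp)) zero_le
        rw [this, add_zero]
    _ ≤ _ := volume_coe_image_le _

end Circle

/-- The continuous `3 k - 4`-type inequality. -/
lemma volume_add_self_ge {B : Set ℝ} (hB : MeasurableSet B) {l r : ℝ} (hl : IsLeast B l)
    (hr : IsGreatest B r) :
    volume.real B + min (r - l) (2 * volume.real B) ≤ volume.real (B + B) := by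
  have hBs : B ⊆ Icc l r := fun x hx => ⟨hl.2 hx, hr.2 hx⟩
  have hBf : volume B ≠ ∞ := measure_ne_top_of_subset hBs (by simp)
  have hBBf : volume (B + B) ≠ ∞ := by
    refine measure_ne_top_of_subset (s := Icc (l + l) (r + r)) ?_ (by simp)
    rintro _ ⟨a, ha, b, hb, rfl⟩
    exact ⟨add_le_add (hl.2 ha) (hl.2 hb), add_le_add (hr.2 ha) (hr.2 hb)⟩
  rcases (hl.2 hr.1).eq_or_lt with h | h
  · have : volume.real B = 0 := by
      rw [measureReal_eq_zero_iff hBf]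
      exact measure_mono_null hBs (by simp [h])
    simp [this, h]
  · have : Fact (0 < r - l) := ⟨by linarith⟩
    have h1 := volume_add_volume_circle_le (T := r - l) hB hl hr (by ring)
    have h2 := raikov (T := r - l) (measurableSet_coe_image hB) (measurableSet_coe_image hB)
      ⟨_, l, hl.1, rfl⟩ ⟨_, l, hl.1, rfl⟩
    have h3 : volume.real ((↑) '' B : Set (AddCircle (r - l))) = volume.real B := by
      rw [measureReal_def, volume_coe_image_eq (a := l) (by simpa using hBs), measureReal_def]
    rw [h3, ← two_mul] at h2
    have h4 := ENNReal.toReal_mono hBBf h1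
    rw [ENNReal.toReal_add hBf (measure_ne_top _ _)] at h4
    simp only [← measureReal_def] at h4
    linarith

lemma fract_lt_half_or (y : ℝ) : Int.fract y < 1 / 2 ∨ Int.fract (y + 1 / 2) < 1 / 2 := by
  by_contra! h
  obtain ⟨h1, h2⟩ := h
  have : Int.fract (y + 1 / 2) = Int.fract y - 1 / 2 := by
    rw [Int.fract_eq_iff]
    refine ⟨by linarith, by linarith [Int.fract_lt_one y], ⌊y⌋ + 1, ?_⟩
    push_cast; rw [Int.fract]; ring
  linarith [Int.fract_lt_one y]

lemma measurableSet_fract_lt_half : MeasurableSet {y : ℝ | Int.fract y < 1 / 2} :=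
  measurableSet_lt measurable_fract measurable_const

lemma integral_halfArc (y : ℝ) :
    ∫ u in (0 : ℝ)..1, {y : ℝ | Int.fract y < 1 / 2}.indicator (fun _ => (1 : ℝ)) (y + u) *
      Real.sin (2 * Real.pi * u) = Real.cos (2 * Real.pi * y) / Real.pi := by
  set H := {y : ℝ | Int.fract y < 1 / 2}
  let F : ℝ → ℝ := fun v => H.indicator (fun _ => (1 : ℝ)) v * Real.sin (2 * Real.pi * (v - y))
  have hF : Function.Periodic F 1 := by
    intro v
    have h1 : (v + 1 ∈ H) = (v ∈ H) := by simp [H]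
    have h2 : Real.sin (2 * Real.pi * (v + 1 - y)) = Real.sin (2 * Real.pi * (v - y)) := by
      rw [show 2 * Real.pi * (v + 1 - y) = 2 * Real.pi * (v - y) + 2 * Real.pi by ring,
        Real.sin_add_two_pi]
    simp only [F, indicator, h1, h2]
  have hFm : ∀ a b, IntervalIntegrable F volume a b := by
    intro a b
    rw [intervalIntegrable_iff]
    refine Integrable.mono' (g := fun _ => (1:ℝ)) (by rw [uIoc]; exact integrable_const _) ?_ ?_
    · refine Measurable.aestronglyMeasurable (Measurable.mul ?_ (by fun_prop))
      exact measurable_const.indicator measurableSet_fract_lt_half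
    · refine Filter.Eventually.of_forall fun v => ?_
      simp only [F, indicator]
      split_ifs
      · simpa using Real.abs_sin_le_one _
      · simp
  have e1 : (∫ u in (0 : ℝ)..1, H.indicator (fun _ => (1 : ℝ)) (y + u) *
      Real.sin (2 * Real.pi * u)) = ∫ u in (0:ℝ)..1, F (y + u) := by
    congr 1; ext u; simp [F]
  rw [e1, intervalIntegral.integral_comp_add_left F y, add_zero,
    hF.intervalIntegral_add_eq y 0, zero_add,
    ← intervalIntegral.integral_add_adjacent_intervals (hFm 0 (1/2)) (hFm (1/2) 1)]
  have e2 : ∫ u in (1/2 : ℝ)..1, F u = 0 := by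
    rw [intervalIntegral.integral_of_le (by norm_num), integral_Ioc_eq_integral_Ioo]
    refine setIntegral_eq_zero_of_forall_eq_zero fun u hu => ?_
    have : u ∉ H := by
      simp only [H, mem_ofPred_eq, not_lt]
      rw [Int.fract_eq_self.2 ⟨by linarith [hu.1], hu.2⟩]; exact hu.1.le
    simp [F, this]
  have e3 : ∫ u in (0 : ℝ)..(1/2), F u = ∫ u in (0:ℝ)..(1/2), Real.sin (2 * Real.pi * u - 2 * Real.pi * y) := by
    rw [intervalIntegral.integral_of_le (by norm_num), intervalIntegral.integral_of_le (by norm_num),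
      integral_Ioc_eq_integral_Ioo, integral_Ioc_eq_integral_Ioo]
    refine setIntegral_congr_fun measurableSet_Ioo fun u hu => ?_
    have : u ∈ H := by
      simp only [H, mem_ofPred_eq]
      rw [Int.fract_eq_self.2 ⟨hu.1.le, by linarith [hu.2]⟩]; exact hu.2
    simp only [F, this, indicator_of_mem, one_mul]
    congr 1; ring
  rw [e2, e3, add_zero, intervalIntegral.integral_comp_mul_sub (fun v => Real.sin v)
    (by positivity) (2 * Real.pi * y), integral_sin]
  rw [show 2 * Real.pi * (1 / 2) - 2 * Real.pi * y = Real.pi - 2 * Real.pi * y by ring,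
    Real.cos_pi_sub, show 2 * Real.pi * 0 - 2 * Real.pi * y = - (2 * Real.pi * y) by ring,
    Real.cos_neg, smul_eq_mul]
  field_simp; ring

lemma exists_halfArc {A : Set ℝ} (hAf : volume A ≠ ∞) {τ L θ : ℝ} 
    (hcos : τ * volume.real A ≤ ∫ x in A, Real.cos (2 * Real.pi * (x / L + θ))) :
    ∃ ψ : ℝ, (1 + τ) / 2 * volume.real A ≤
      volume.real (A ∩ {x | Int.fract (x / L + ψ) < 1 / 2}) := by
  by_contra! hcon
  set H := {y : ℝ | Int.fract y < 1 / 2} with hH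
  have hHm : MeasurableSet H := measurableSet_fract_lt_half
  have hfin : IsFiniteMeasure (volume.restrict A) := ⟨by simpa using hAf.lt_top⟩
  let ρ : ℝ → ℝ := fun u => ∫ x in A, H.indicator (fun _ => (1 : ℝ)) (x / L + θ + u)
  have hρ : ∀ u, ρ u = volume.real (A ∩ {x | Int.fract (x / L + (θ + u)) < 1 / 2}) := by
    intro u
    have hm : MeasurableSet {x : ℝ | Int.fract (x / L + (θ + u)) < 1 / 2} :=
      hHm.preimage (by fun_prop : Measurable fun x : ℝ => x / L + (θ + u))
    rw [inter_comm, ← measureReal_restrict_apply hm, ← integral_indicator_one hm]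
    simp only [ρ, H, indicator, add_assoc]
    rfl
  have hup : ∀ u, ρ u ≤ (1 + τ) / 2 * volume.real A := fun u => (hρ u).trans_le (hcon _).le
  have hlow : ∀ u, (1 - τ) / 2 * volume.real A ≤ ρ u := by
    intro u
    have h1 := hup (u + 1 / 2)
    have h2 : volume.real A ≤ ρ u + ρ (u + 1 / 2) := by
      rw [hρ, hρ]
      refine (measureReal_mono ?_ ?_).trans (measureReal_union_le _ _)
      · intro x hx
        rcases fract_lt_half_or (x / L + (θ + u)) with h | h
        · exact Or.inl ⟨hx, h⟩
        · exact Or.inr ⟨hx, by simpa only [mem_ofPred_eq, ← add_assoc] using h⟩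
      · exact measure_ne_top_of_subset (union_subset inter_subset_left inter_subset_left) hAf
    linarith
  have hIint2 : Integrable (Function.uncurry fun (u x : ℝ) =>
      H.indicator (fun _ => (1 : ℝ)) (x / L + θ + u) * Real.sin (2 * Real.pi * u))
      ((volume.restrict (Ioc 0 1)).prod (volume.restrict A)) := by
    refine Integrable.mono' (g := fun _ => (1:ℝ)) (integrable_const _) ?_ ?_
    · refine (Measurable.mul ?_ ?_).aestronglyMeasurable
      · exact (measurable_const.indicator hHm).comp (by fun_prop)
      · fun_prop
    · refine Filter.Eventually.of_forall fun v => ?_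
      simp only [Function.uncurry, indicator]
      split_ifs
      · simpa using Real.abs_sin_le_one _
      · simp
  have hfub : ∫ u in (0:ℝ)..1, ρ u * Real.sin (2 * Real.pi * u)
      = (∫ x in A, Real.cos (2 * Real.pi * (x / L + θ))) / Real.pi := by
    simp only [ρ]
    rw [intervalIntegral.integral_of_le zero_le_one]
    simp_rw [← integral_mul_const]
    rw [integral_integral_swap hIint2, integral_congr_ae (Filter.Eventually.of_forall fun x => by
      simpa only [intervalIntegral.integral_of_le zero_le_one] using
        integral_halfArc (x / L + θ)), integral_div]
  have hi : ∀ a b, 0 ≤ a → a ≤ b → b ≤ 1 →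
      IntervalIntegrable (fun u => ρ u * Real.sin (2 * Real.pi * u)) volume a b := by
    intro a b ha hab hb
    rw [intervalIntegrable_iff, uIoc_of_le hab]
    have h := hIint2.integral_prod_left
    simp only [Function.uncurry, integral_mul_const] at h
    exact IntegrableOn.mono_set h (Ioc_subset_Ioc ha hb)
  have hs : ∀ c a b : ℝ, IntervalIntegrable (fun u => c * Real.sin (2 * Real.pi * u)) volume a b :=
    fun c a b => Continuous.intervalIntegrable (by fun_prop) _ _
  have hsin : ∀ c a b : ℝ, ∫ u in a..b, c * Real.sin (2 * Real.pi * u)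
      = c * ((Real.cos (2 * Real.pi * a) - Real.cos (2 * Real.pi * b)) / (2 * Real.pi)) := by
    intro c a b
    rw [intervalIntegral.integral_const_mul,
      intervalIntegral.integral_comp_mul_left (fun v => Real.sin v) (by positivity), integral_sin,
      smul_eq_mul]
    ring
  have hstrict : ∫ u in (0:ℝ)..(1/2), ρ u * Real.sin (2 * Real.pi * u) <
      ∫ u in (0:ℝ)..(1/2), (1 + τ) / 2 * volume.real A * Real.sin (2 * Real.pi * u) := by
    refine intervalIntegral.integral_lt_integral_of_ae_le_of_measure_setOfPred_lt_ne_zero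
      (by norm_num) (hi _ _ le_rfl (by norm_num) (by norm_num)) (hs _ _ _) ?_ ?_
    · refine (ae_restrict_iff' measurableSet_Ioc).2 (Filter.Eventually.of_forall fun u hu => ?_)
      refine mul_le_mul_of_nonneg_right (hup u) (Real.sin_nonneg_of_nonneg_of_le_pi ?_ ?_)
      · have := hu.1; positivity
      · nlinarith [hu.2, Real.pi_pos]
    · refine (lt_of_lt_of_le (b := volume.restrict (Ioc (0:ℝ) (1/2)) (Ioo 0 (1/2))) ?_
        (measure_mono ?_)).ne'
      · rw [Measure.restrict_apply measurableSet_Ioo,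
          inter_eq_left.2 Ioo_subset_Ioc_self]; simp
      · intro u hu
        refine mul_lt_mul_of_pos_right ((hρ u).trans_lt (hcon _)) (Real.sin_pos_of_pos_of_lt_pi ?_ ?_)
        · have := hu.1; positivity
        · nlinarith [hu.2, Real.pi_pos]
  have hle : ∫ u in (1/2:ℝ)..1, ρ u * Real.sin (2 * Real.pi * u) ≤
      ∫ u in (1/2:ℝ)..1, (1 - τ) / 2 * volume.real A * Real.sin (2 * Real.pi * u) := by
    refine intervalIntegral.integral_mono_on (by norm_num) (hi _ _ (by norm_num) (by norm_num) le_rfl)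
      (hs _ _ _) fun u hu => ?_
    refine mul_le_mul_of_nonpos_right (hlow u) ?_
    have h1 : Real.sin (2 * Real.pi * u - Real.pi) = - Real.sin (2 * Real.pi * u) :=
      Real.sin_sub_pi _
    have h2 := Real.sin_nonneg_of_nonneg_of_le_pi (x := 2 * Real.pi * u - Real.pi)
      (by nlinarith [hu.1, Real.pi_pos]) (by nlinarith [hu.2, Real.pi_pos])
    linarith
  rw [← intervalIntegral.integral_add_adjacent_intervals
    (hi 0 (1/2) le_rfl (by norm_num) (by norm_num)) (hi (1/2) 1 (by norm_num) (by norm_num) le_rfl)] at hfub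
  rw [hsin] at hstrict hle
  have c1 : Real.cos (2 * Real.pi * (1/2)) = -1 := by
    rw [show 2 * Real.pi * (1/2) = Real.pi by ring, Real.cos_pi]
  rw [c1] at hstrict hle
  simp only [mul_zero, mul_one, Real.cos_zero, Real.cos_two_pi] at hstrict hle
  have h5 : τ * volume.real A / Real.pi ≤ (∫ x in A, Real.cos (2 * Real.pi * (x / L + θ))) / Real.pi := by
    gcongr
  have h6 : (1 + τ) / 2 * volume.real A * ((1 - -1) / (2 * Real.pi)) +
     (1 - τ) / 2 * volume.real A * ((-1 - 1) / (2 * Real.pi)) = τ * volume.real A / Real.pi := by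
    field_simp; ring
  linarith

section Fourier
open AddCircle
variable {T : ℝ} [hT : Fact (0 < T)]

/-- The density of the set of representations of `t` as `u + v` with `u ∈ U`, `v ∈ V`. -/
noncomputable def circleConv (U V : Set (AddCircle T)) (t : AddCircle T) : ℝ :=
  (haarAddCircle (T := T)).real (U ∩ (fun s => t - s) ⁻¹' V)

/-- Fourier coefficients of the indicator function of a subset of the circle. -/
noncomputable def setCoeff (U : Set (AddCircle T)) (n : ℤ) : ℂ :=
  fourierCoeff (U.indicator fun _ => (1 : ℂ)) n

lemma hasSum_sq_norm_fourierCoeff {h : AddCircle T → ℂ}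
    (hm : AEStronglyMeasurable h (haarAddCircle (T := T))) (hb : ∀ t, ‖h t‖ ≤ 1) :
    HasSum (fun n => ‖fourierCoeff h n‖ ^ 2) (∫ t, ‖h t‖ ^ 2 ∂haarAddCircle) := by
  have hL : MemLp h 2 (haarAddCircle (T := T)) :=
    MemLp.of_bound hm 1 (Filter.Eventually.of_forall hb)
  have := hasSum_sq_fourierCoeff hL.toLp
  convert this using 1
  · ext n
    rw [fourierCoeff_congr_ae hL.coeFn_toLp]
  · exact integral_congr_ae (hL.coeFn_toLp.mono fun t ht => by simp only [ht])

lemma circleConv_eq_integral {U V : Set (AddCircle T)} (hU : MeasurableSet U)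
    (hV : MeasurableSet V) (t : AddCircle T) :
    (circleConv U V t : ℂ) = ∫ s, U.indicator (fun _ => (1 : ℂ)) s *
      V.indicator (fun _ => (1 : ℂ)) (t - s) ∂haarAddCircle := by
  have hm : MeasurableSet (U ∩ (fun s => t - s) ⁻¹' V) := hU.inter (hV.preimage (by fun_prop))
  rw [circleConv, ← integral_indicator_one hm, ← integral_complex_ofReal]
  congr 1; ext s
  by_cases h : s ∈ U <;> by_cases h' : t - s ∈ V <;> simp [indicator, h, h']

lemma integrable_conv_kernel {U V : Set (AddCircle T)} (hU : MeasurableSet U)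
    (hV : MeasurableSet V) {e : AddCircle T → ℂ} (he : Continuous e) (he1 : ∀ t, ‖e t‖ ≤ 1) :
    Integrable (Function.uncurry fun (t s : AddCircle T) => e t * (U.indicator (fun _ => (1 : ℂ)) s *
      V.indicator (fun _ => (1 : ℂ)) (t - s)))
      ((haarAddCircle (T := T)).prod (haarAddCircle (T := T))) := by
  refine Integrable.mono' (g := fun _ => (1:ℝ)) (integrable_const _) ?_ ?_
  · refine (Measurable.mul (by fun_prop) (Measurable.mul ?_ ?_)).aestronglyMeasurable
    · exact (measurable_const.indicator hU).comp measurable_snd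
    · exact (measurable_const.indicator hV).comp (by fun_prop)
  · refine Filter.Eventually.of_forall fun p => ?_
    simp only [Function.uncurry, indicator]
    split_ifs <;> simp [he1]

lemma aestronglyMeasurable_circleConv {U V : Set (AddCircle T)} (hU : MeasurableSet U)
    (hV : MeasurableSet V) :
    AEStronglyMeasurable (fun t => (circleConv U V t : ℂ)) (haarAddCircle (T := T)) := by
  simp_rw [circleConv_eq_integral hU hV]
  have := (integrable_conv_kernel hU hV (e := fun _ => 1) (by fun_prop) (by simp)).aestronglyMeasurable.integral_prod_right'
  simpa [Function.uncurry] using this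

lemma circleConv_nonneg (U V : Set (AddCircle T)) (t : AddCircle T) : 0 ≤ circleConv U V t :=
  measureReal_nonneg

lemma circleConv_le_one (U V : Set (AddCircle T)) (t : AddCircle T) : circleConv U V t ≤ 1 :=
  measureReal_le_one

lemma fourierCoeff_circleConv {U V : Set (AddCircle T)} (hU : MeasurableSet U)
    (hV : MeasurableSet V) (n : ℤ) :
    fourierCoeff (fun t => (circleConv U V t : ℂ)) n = setCoeff U n * setCoeff V n := by
  simp only [fourierCoeff, setCoeff]
  simp_rw [circleConv_eq_integral hU hV, smul_eq_mul]
  have hin : ∀ t : AddCircle T, fourier (-n) t * ∫ s, U.indicator (fun _ => (1 : ℂ)) s *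
      V.indicator (fun _ => (1 : ℂ)) (t - s) ∂haarAddCircle = ∫ s, fourier (-n) t *
      (U.indicator (fun _ => (1 : ℂ)) s * V.indicator (fun _ => (1 : ℂ)) (t - s)) ∂haarAddCircle :=
    fun t => (integral_const_mul _ _).symm
  simp_rw [hin]
  rw [integral_integral_swap (integrable_conv_kernel hU hV (by fun_prop)
    (fun t => by rw [fourier_apply, Circle.norm_coe]))]
  rw [← integral_mul_const]
  congr 1; ext s
  have : ∀ t : AddCircle T, fourier (-n) t * (U.indicator (fun _ => (1:ℂ)) s *
      V.indicator (fun _ => (1:ℂ)) (t - s)) = (fourier (-n) s * U.indicator (fun _ => (1:ℂ)) s) *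
      (fourier (-n) (t - s) * V.indicator (fun _ => (1:ℂ)) (t - s)) := by
    intro t
    have : fourier (-n) t = fourier (-n) s * fourier (-n) (t - s) := by
      rw [fourier_apply, fourier_apply, fourier_apply, ← Circle.coe_mul, ← toCircle_add,
        ← smul_add, add_sub_cancel]
    rw [this]; ring
  simp_rw [this]
  rw [integral_const_mul, integral_sub_right_eq_self
    (fun t => fourier (-n) t * V.indicator (fun _ => (1:ℂ)) t) s]

lemma setCoeff_zero {U : Set (AddCircle T)} (hU : MeasurableSet U) :
    setCoeff U 0 = ((haarAddCircle (T := T)).real U : ℂ) := by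
  simp only [setCoeff, fourierCoeff, neg_zero, fourier_zero, one_smul]
  rw [integral_indicator_const _ hU]; simp

lemma norm_setCoeff_le {U : Set (AddCircle T)} (hU : MeasurableSet U) (n : ℤ) :
    ‖setCoeff U n‖ ≤ (haarAddCircle (T := T)).real U := by
  rw [setCoeff, fourierCoeff]
  refine (norm_integral_le_integral_norm _).trans_eq ?_
  rw [← integral_indicator_one hU]
  congr 1; ext s
  by_cases h : s ∈ U
  · simp only [indicator, h, fourier_apply, if_true, smul_eq_mul, mul_one, Circle.norm_coe,
      Pi.one_apply]
  · simp [indicator, h]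

lemma hasSum_sq_setCoeff {U : Set (AddCircle T)} (hU : MeasurableSet U) :
    HasSum (fun n => ‖setCoeff U n‖ ^ 2) ((haarAddCircle (T := T)).real U) := by
  have := hasSum_sq_norm_fourierCoeff (h := U.indicator fun _ => (1 : ℂ))
    (measurable_const.indicator hU).aestronglyMeasurable
    (fun t => by simp only [indicator]; split_ifs <;> simp)
  have e : ∫ t, ‖U.indicator (fun _ => (1 : ℂ)) t‖ ^ 2 ∂haarAddCircle
      = (haarAddCircle (T := T)).real U := by
    rw [← integral_indicator_one hU]
    congr 1; ext s
    by_cases h : s ∈ U <;> simp [indicator, h]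
  rwa [e] at this

lemma integrable_circleConv {U V : Set (AddCircle T)} (hU : MeasurableSet U)
    (hV : MeasurableSet V) : Integrable (circleConv U V) (haarAddCircle (T := T)) := by
  have h : Integrable (fun t => (circleConv U V t : ℂ)) (haarAddCircle (T := T)) :=
    Integrable.mono' (integrable_const (1:ℝ)) (aestronglyMeasurable_circleConv hU hV)
      (Filter.Eventually.of_forall fun t => by
        rw [Complex.norm_of_nonneg (circleConv_nonneg _ _ _)]; exact circleConv_le_one _ _ _)
  exact h.re

lemma integrable_circleConv_sq {U V : Set (AddCircle T)} (hU : MeasurableSet U)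
    (hV : MeasurableSet V) : Integrable (fun t => circleConv U V t ^ 2) (haarAddCircle (T := T)) :=
  Integrable.mono' (integrable_const (1:ℝ))
    ((integrable_circleConv hU hV).aestronglyMeasurable.pow 2)
      (Filter.Eventually.of_forall fun t => by
        rw [Real.norm_of_nonneg (by positivity)]
        exact pow_le_one₀ (circleConv_nonneg _ _ _) (circleConv_le_one _ _ _))

lemma integral_circleConv {U V : Set (AddCircle T)} (hU : MeasurableSet U)
    (hV : MeasurableSet V) : ∫ t, circleConv U V t ∂haarAddCircle =
      (haarAddCircle (T := T)).real U * (haarAddCircle (T := T)).real V := by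
  have h := fourierCoeff_circleConv hU hV 0
  rw [setCoeff_zero hU, setCoeff_zero hV, fourierCoeff] at h
  simp only [neg_zero, fourier_zero, one_smul] at h
  rw [integral_complex_ofReal] at h
  exact_mod_cast h

lemma hasSum_sq_circleConv {U V : Set (AddCircle T)} (hU : MeasurableSet U)
    (hV : MeasurableSet V) : HasSum (fun n => ‖setCoeff U n‖ ^ 2 * ‖setCoeff V n‖ ^ 2)
      (∫ t, circleConv U V t ^ 2 ∂haarAddCircle) := by
  have := hasSum_sq_norm_fourierCoeff (h := fun t => (circleConv U V t : ℂ))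
    (aestronglyMeasurable_circleConv hU hV) (fun t => by
      rw [Complex.norm_of_nonneg (circleConv_nonneg _ _ _)]; exact circleConv_le_one _ _ _)
  simp_rw [fourierCoeff_circleConv hU hV, norm_mul, mul_pow,
    Complex.norm_of_nonneg (circleConv_nonneg _ _ _)] at this
  exact this

/-- Small sumset gives large additive energy. -/
lemma energy_ge {U S : Set (AddCircle T)} (hU : MeasurableSet U) (hS : MeasurableSet S)
    (hUS : U + U ⊆ S)
    (hsmall : (haarAddCircle (T := T)).real S ≤ 4 * (haarAddCircle (T := T)).real U) :
    (haarAddCircle (T := T)).real U ^ 3 / 4 ≤ ∫ t, circleConv U U t ^ 2 ∂haarAddCircle := by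
  set α := (haarAddCircle (T := T)).real U
  have hα : 0 ≤ α := measureReal_nonneg
  have hpt : ∀ t, α / 2 * circleConv U U t - S.indicator (fun _ => α ^ 2 / 16) t
      ≤ circleConv U U t ^ 2 := by
    intro t
    by_cases h : t ∈ S
    · simp only [h, indicator_of_mem]
      nlinarith [sq_nonneg (circleConv U U t - α / 4)]
    · have : circleConv U U t = 0 := by
        rw [circleConv]
        convert measureReal_empty
        ext s
        simp only [mem_inter_iff, mem_preimage, mem_empty_iff_false, iff_false, not_and]
        intro h1 h2
        exact h (hUS ⟨s, h1, t - s, h2, by simp⟩)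
      simp [this, h]
  have := integral_mono (((integrable_circleConv hU hU).const_mul (α / 2)).sub
    ((integrable_const (α ^ 2 / 16)).indicator hS)) (integrable_circleConv_sq hU hU) hpt
  simp only [Pi.sub_apply] at this
  rw [integral_sub ((integrable_circleConv hU hU).const_mul (α / 2))
    ((integrable_const (α ^ 2 / 16)).indicator hS), integral_const_mul, integral_circleConv hU hU,
    integral_indicator_const _ hS, smul_eq_mul] at this
  refine le_trans ?_ this
  have : (haarAddCircle (T := T)).real S * (α ^ 2 / 16) ≤ 4 * α * (α ^ 2 / 16) := by gcongr
  nlinarith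

/-- The spectrum of a set with small doubling. -/
lemma exists_spectrum {U S : Set (AddCircle T)} (hU : MeasurableSet U) (hS : MeasurableSet S)
    (hUS : U + U ⊆ S)
    (hsmall : (haarAddCircle (T := T)).real S ≤ 4 * (haarAddCircle (T := T)).real U)
    (hpos : 0 < (haarAddCircle (T := T)).real U)
    (hα : (haarAddCircle (T := T)).real U ≤ 1 / 20) :
    ∃ (F : Finset ℤ) (N : ℤ), N ≠ 0 ∧ N ∈ F ∧ (∀ n ∈ F, |n| ≤ |N|) ∧
      0.45 * (haarAddCircle (T := T)).real U ≤ ‖setCoeff U N‖ ∧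
      0.058 * (haarAddCircle (T := T)).real U ≤ ∑ n ∈ F, ‖setCoeff U n‖ ^ 2 := by
  set α := (haarAddCircle (T := T)).real U
  have hsum := hasSum_sq_setCoeff hU
  have hsum2 := hasSum_sq_circleConv hU hU
  have henergy := energy_ge hU hS hUS hsmall
  have hfin : {n : ℤ | 0.45 * α ≤ ‖setCoeff U n‖}.Finite := by
    have h := hsum.summable.tendsto_cofinite_zero.eventually
      (gt_mem_nhds (show (0:ℝ) < (0.45 * α) ^ 2 by positivity))
    rw [Filter.eventually_cofinite] at h
    refine h.subset fun n hn => ?_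
    simp only [mem_ofPred_eq, not_lt] at *
    gcongr
  set F := hfin.toFinset with hF
  have hFm : ∀ n, n ∈ F ↔ 0.45 * α ≤ ‖setCoeff U n‖ := by simp [hF]
  have hb : 0.058 * α ≤ ∑ n ∈ F, ‖setCoeff U n‖ ^ 2 := by
    have h1 : HasSum (fun n => 0.2025 * α ^ 2 * ‖setCoeff U n‖ ^ 2 +
        (F : Set ℤ).indicator (fun n => 0.7975 * α ^ 2 * ‖setCoeff U n‖ ^ 2) n)
        (0.2025 * α ^ 2 * α + 0.7975 * α ^ 2 * ∑ n ∈ F, ‖setCoeff U n‖ ^ 2) := by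
      refine (hsum.mul_left _).add ?_
      rw [Finset.mul_sum]
      have := hasSum_sum_of_ne_finset_zero (s := F)
        (f := (F : Set ℤ).indicator (fun n => 0.7975 * α ^ 2 * ‖setCoeff U n‖ ^ 2))
        (L := .unconditional ℤ)
        (fun b hb => indicator_of_notMem (by simpa using hb) _)
      rwa [Finset.sum_congr rfl fun n hn => indicator_of_mem (Finset.mem_coe.2 hn) _] at this
    have h2 := hasSum_le (fun n => ?_) hsum2 h1
    · have h3 := henergy.trans h2
      have h4 : 0 < α ^ 2 := by positivity
      nlinarith
    · have hc := norm_setCoeff_le hU n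
      have h0 := norm_nonneg (setCoeff U n)
      by_cases hn : n ∈ F
      · rw [indicator_of_mem (by simpa using hn)]
        have : ‖setCoeff U n‖ ^ 2 ≤ α ^ 2 := by gcongr
        nlinarith [sq_nonneg ‖setCoeff U n‖]
      · rw [indicator_of_notMem (by simpa using hn), add_zero]
        rw [hFm, not_le] at hn
        have : ‖setCoeff U n‖ ^ 2 ≤ (0.45 * α) ^ 2 := by gcongr
        nlinarith [sq_nonneg ‖setCoeff U n‖]
  have hne : F.Nonempty := by
    by_contra h
    rw [Finset.not_nonempty_iff_eq_empty] at h
    rw [h] at hb; simp at hb; nlinarith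
  obtain ⟨N, hN, hmax⟩ := F.exists_max_image (fun n => |n|) hne
  refine ⟨F, N, ?_, hN, hmax, (hFm N).1 hN, hb⟩
  rintro rfl
  have hF0 : F ⊆ {0} := fun n hn => by
    have := hmax n hn
    simpa using this
  have := hb.trans (Finset.sum_le_sum_of_subset_of_nonneg hF0 fun _ _ _ => by positivity)
  rw [Finset.sum_singleton] at this
  have hc := norm_setCoeff_le hU 0
  have : ‖setCoeff U 0‖ ^ 2 ≤ α ^ 2 := by gcongr
  nlinarith

end Fourier

section Fourier
open AddCircle
variable {T : ℝ} [hT : Fact (0 < T)]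

lemma haarAddCircle_real_eq (U : Set (AddCircle T)) :
    (haarAddCircle (T := T)).real U = volume.real U / T := by
  have hTp := hT.out
  rw [measureReal_def, measureReal_def, volume_eq_smul_haarAddCircle, Measure.smul_apply,
    smul_eq_mul, toReal_mul, toReal_ofReal hTp.le]
  field_simp

lemma re_fourier_coe {T : ℝ} (n : ℤ) (x : ℝ) :
    (fourier n (x : AddCircle T)).re = Real.cos (2 * Real.pi * n * x / T) := by
  rw [fourier_coe_apply, show (2 * Real.pi * Complex.I * n * x / T : ℂ)
    = ((2 * Real.pi * n * x / T : ℝ) : ℂ) * Complex.I by push_cast; ring,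
    Complex.exp_ofReal_mul_I_re]

lemma norm_setCoeff_arc_ge {V : Set (AddCircle T)} (hV : MeasurableSet V) {n : ℤ}
    (h : ∀ t ∈ V, (1:ℝ) / 2 ≤ (fourier (-n) t).re) :
    (haarAddCircle (T := T)).real V / 2 ≤ ‖setCoeff V n‖ := by
  refine le_trans ?_ (Complex.re_le_norm _)
  rw [setCoeff, fourierCoeff]
  have hi : Integrable (fun t => fourier (-n) t • V.indicator (fun _ => (1:ℂ)) t)
      (haarAddCircle (T := T)) :=
    Integrable.fourier_smul ((integrable_const _).indicator hV) _
  have h0 : (∫ t, fourier (-n) t • V.indicator (fun _ => (1:ℂ)) t ∂haarAddCircle).re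
    = ∫ t, (fourier (-n) t • V.indicator (fun _ => (1:ℂ)) t).re ∂haarAddCircle :=
    (integral_re hi).symm
  rw [h0]
  have : (haarAddCircle (T := T)).real V / 2 = ∫ t, V.indicator (fun _ => (1:ℝ)/2) t ∂haarAddCircle := by
    rw [integral_indicator_const _ hV, smul_eq_mul]; ring
  rw [this]
  refine integral_mono ((integrable_const _).indicator hV) hi.re fun t => ?_
  by_cases ht : t ∈ V
  · simpa [ht] using h t ht
  · simp [ht]

end Fourier

lemma exists_circleConv_ge {T : ℝ} [Fact (0 < T)] {U V : Set (AddCircle T)}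
    (hU : MeasurableSet U) (hV : MeasurableSet V) {F : Finset ℤ}
    (hUp : 0 < (AddCircle.haarAddCircle (T := T)).real U)
    (hVp : 0 < (AddCircle.haarAddCircle (T := T)).real V)
    (hF : 0.058 * (AddCircle.haarAddCircle (T := T)).real U ≤ ∑ n ∈ F, ‖setCoeff U n‖ ^ 2)
    (hVF : ∀ n ∈ F, (AddCircle.haarAddCircle (T := T)).real V / 2 ≤ ‖setCoeff V n‖) :
    ∃ t, 0.014 * (AddCircle.haarAddCircle (T := T)).real V ≤ circleConv U V t := by
  by_contra! hcon
  set α := (AddCircle.haarAddCircle (T := T)).real U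
  set β := (AddCircle.haarAddCircle (T := T)).real V
  have h1 : ∫ t, circleConv U V t ^ 2 ∂AddCircle.haarAddCircle ≤ 0.014 * β * (α * β) := by
    rw [← integral_circleConv hU hV, ← integral_const_mul]
    refine integral_mono (integrable_circleConv_sq hU hV) ((integrable_circleConv hU hV).const_mul _)
      fun t => ?_
    simp only
    nlinarith [hcon t, circleConv_nonneg U V t]
  have h2 := sum_le_hasSum F (fun n _ => by positivity) (hasSum_sq_circleConv hU hV)
  have h3 : (∑ n ∈ F, ‖setCoeff U n‖ ^ 2) * (β / 2) ^ 2
      ≤ ∑ n ∈ F, ‖setCoeff U n‖ ^ 2 * ‖setCoeff V n‖ ^ 2 := by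
    rw [Finset.sum_mul]
    refine Finset.sum_le_sum fun n hn => ?_
    have := hVF n hn
    gcongr
  have h4 : 0.058 * α * (β / 2) ^ 2 ≤ (∑ n ∈ F, ‖setCoeff U n‖ ^ 2) * (β / 2) ^ 2 := by gcongr
  have : 0 < α * β * β := by positivity
  nlinarith

lemma integral_cos_eq_norm_setCoeff {D : ℝ} [hT : Fact (0 < 4 * D)] {A : Set ℝ}
    (hA : MeasurableSet A) (hAD : A ⊆ Icc 0 D) {N : ℤ} (hN : N ≠ 0) :
    ∃ θ : ℝ, ∫ x in A, Real.cos (2 * Real.pi * (x / (4 * D / |(N:ℝ)|) + θ)) =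
      4 * D * ‖setCoeff ((↑) '' A : Set (AddCircle (4 * D))) N‖ := by
  have hD : 0 < D := by have := hT.out; linarith
  set c := setCoeff ((↑) '' A : Set (AddCircle (4 * D))) N with hc
  have hAf : volume A ≠ ∞ := measure_ne_top_of_subset hAD (by simp)
  have hfin : IsFiniteMeasure (volume.restrict A) := ⟨by simpa using hAf.lt_top⟩
  have h1 : ((4 * D : ℝ) : ℂ) * c = ∫ x in A, Complex.exp (((-(2 * Real.pi * N * x / (4 * D)) : ℝ) : ℂ) * Complex.I) := by
    rw [hc, setCoeff, fourierCoeff_eq_intervalIntegral _ _ (-D),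
      intervalIntegral.integral_of_le (by linarith), Complex.real_smul, ← mul_assoc]
    rw [show ((4 * D : ℝ) : ℂ) * ((1 / (4 * D) : ℝ) : ℂ) = 1 by
      rw [← Complex.ofReal_mul, mul_one_div_cancel hT.out.ne', Complex.ofReal_one], one_mul]
    rw [← integral_indicator hA, ← integral_indicator measurableSet_Ioc]
    congr 1; ext x
    by_cases hx : x ∈ Ioc (-D) (-D + 4 * D)
    · rw [indicator_of_mem hx]
      by_cases hxA : x ∈ A
      · rw [indicator_of_mem hxA, indicator_of_mem (mem_image_of_mem _ hxA), smul_eq_mul, mul_one,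
          fourier_coe_apply]
        congr 1; push_cast; ring
      · rw [indicator_of_notMem hxA, indicator_of_notMem, smul_zero]
        rintro ⟨a, ha, hax⟩
        obtain ⟨k, hk⟩ := QuotientAddGroup.eq.1 hax
        simp only [zsmul_eq_mul] at hk
        have ha' := hAD ha
        have hk0 : k = 0 := by
          have h1 : (k:ℝ) < 1 := by
            by_contra! h; nlinarith [ha'.1, ha'.2, hx.1, hx.2]
          have h2 : (-1:ℝ) < k := by
            by_contra! h; nlinarith [ha'.1, ha'.2, hx.1, hx.2]
          have h1' : k < 1 := by exact_mod_cast h1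
          have h2' : -1 < k := by exact_mod_cast h2
          omega
        rw [hk0] at hk
        have : x = a := by simp at hk; linarith
        exact hxA (this ▸ ha)
    · rw [indicator_of_notMem hx, indicator_of_notMem]
      intro hxA
      have := hAD hxA
      exact hx ⟨by linarith [this.1], by linarith [this.2]⟩
  have h2 : ∫ x in A, Real.cos (2 * Real.pi * N * x / (4 * D) + Complex.arg c) = 4 * D * ‖c‖ := by
    have h3 : (4 * D * ‖c‖ : ℝ) = (((4 * D : ℝ) : ℂ) * c * Complex.exp ((-Complex.arg c : ℝ) * Complex.I)).re := by
      have h5 : c * Complex.exp ((-Complex.arg c : ℝ) * Complex.I) = (‖c‖ : ℂ) := by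
        conv_lhs => rw [← Complex.norm_mul_exp_arg_mul_I c]
        rw [mul_assoc, ← Complex.exp_add]
        simp
      rw [mul_assoc (((4 * D : ℝ) : ℂ)), h5, ← Complex.ofReal_mul, Complex.ofReal_re]
    rw [h3, h1, ← integral_mul_const]
    have hi : Integrable (fun x : ℝ => Complex.exp (((-(2 * Real.pi * N * x / (4 * D)) : ℝ) : ℂ) * Complex.I) *
        Complex.exp ((-Complex.arg c : ℝ) * Complex.I)) (volume.restrict A) := by
      refine Integrable.mono' (g := fun _ => (1:ℝ)) (integrable_const _)
        (Continuous.aestronglyMeasurable (by fun_prop)) (Filter.Eventually.of_forall fun x => ?_)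
      rw [norm_mul, Complex.norm_exp_ofReal_mul_I, Complex.norm_exp_ofReal_mul_I]; norm_num
    refine Eq.trans ?_ (integral_re hi)
    congr 1; ext x
    rw [← Complex.exp_add, ← add_mul, ← Complex.ofReal_add]
    simp only [RCLike.re_eq_complex_re]
    rw [Complex.exp_ofReal_mul_I_re, ← Real.cos_neg]
    congr 1; ring
  rcases lt_or_gt_of_ne hN with h | h
  · refine ⟨-Complex.arg c / (2 * Real.pi), ?_⟩
    rw [← h2]
    congr 1; ext x
    rw [abs_of_neg (by exact_mod_cast h), ← Real.cos_neg]
    congr 1; have := Real.pi_pos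
    have hN' : (N:ℝ) ≠ 0 := by exact_mod_cast hN
    field_simp; ring
  · refine ⟨Complex.arg c / (2 * Real.pi), ?_⟩
    rw [← h2]
    congr 1; ext x
    rw [abs_of_pos (by exact_mod_cast h)]
    congr 1; have := Real.pi_pos
    have hN' : (N:ℝ) ≠ 0 := by exact_mod_cast hN
    field_simp

/-- A set of small doubling and small density correlates with a periodic half-interval pattern,
and is dense on an interval comparable with the period. -/
lemma exists_period {A : Set ℝ} (hA : MeasurableSet A) {D : ℝ} (hD : 0 < D) (hAD : A ⊆ Icc 0 D)
    (hpos : 0 < volume.real A) (hdbl : volume.real (A + A) ≤ 4 * volume.real A)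
    (hbig : 5 * volume.real A ≤ D) :
    ∃ L : ℝ, 0 < L ∧ L ≤ 4 * D ∧ (∃ x, 0.002 * L ≤ volume.real (A ∩ Ioc (x - L / 6) x)) ∧
      ∃ ψ, 0.72 * volume.real A ≤ volume.real (A ∩ {x | Int.fract (x / L + ψ) < 1 / 2}) := by
  have hT : Fact (0 < 4 * D) := ⟨by linarith⟩
  set U : Set (AddCircle (4 * D)) := (↑) '' A with hUdef
  have hU : MeasurableSet U := measurableSet_coe_image hA
  have hAf : volume A ≠ ∞ := measure_ne_top_of_subset hAD (by simp)
  have hAAf : volume (A + A) ≠ ∞ := by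
    refine measure_ne_top_of_subset (s := Icc (0 + 0) (D + D)) ?_ (by simp)
    rintro _ ⟨a, ha, b, hb, rfl⟩
    exact ⟨add_le_add (hAD ha).1 (hAD hb).1, add_le_add (hAD ha).2 (hAD hb).2⟩
  have hUv : volume.real U = volume.real A := by
    rw [measureReal_def, volume_coe_image_eq (a := 0) (fun x hx => ⟨(hAD hx).1, by
      linarith [(hAD hx).2]⟩), measureReal_def]
  have hUh : (AddCircle.haarAddCircle (T := 4 * D)).real U = volume.real A / (4 * D) := by
    rw [haarAddCircle_real_eq, hUv]
  set S : Set (AddCircle (4 * D)) := toMeasurable volume (U + U)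
  have hS : (AddCircle.haarAddCircle (T := 4 * D)).real S
      ≤ 4 * (AddCircle.haarAddCircle (T := 4 * D)).real U := by
    rw [hUh, haarAddCircle_real_eq, ← mul_div_assoc]
    gcongr
    refine le_trans ?_ hdbl
    rw [measureReal_def, measure_toMeasurable]
    refine toReal_mono hAAf (le_trans (measure_mono ?_) (volume_coe_image_le (A + A)))
    rintro _ ⟨_, ⟨a, ha, rfl⟩, _, ⟨b, hb, rfl⟩, rfl⟩
    exact ⟨a + b, add_mem_add ha hb, by simp⟩
  obtain ⟨F, N, hN0, hNF, hmax, hcN, hsum⟩ := exists_spectrum hU (measurableSet_toMeasurable _ _)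
    (subset_toMeasurable volume (U + U)) hS (by rw [hUh]; positivity)
    (by rw [hUh, div_le_div_iff₀ (by positivity) (by norm_num)]; linarith)
  have hN1 : (1:ℝ) ≤ |(N:ℝ)| := by exact_mod_cast Int.one_le_abs hN0
  have hNp : (0:ℝ) < |(N:ℝ)| := by linarith
  set L := 4 * D / |(N:ℝ)| with hL
  have hLp : 0 < L := by positivity
  have hLD : L ≤ 4 * D := div_le_self (by positivity) hN1
  refine ⟨L, hLp, hLD, ?_, ?_⟩
  · set V : Set (AddCircle (4 * D)) := (↑) '' Ico 0 (L / 6) with hVdef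
    have hV : MeasurableSet V := measurableSet_coe_image measurableSet_Ico
    have hVh : (AddCircle.haarAddCircle (T := 4 * D)).real V = L / 6 / (4 * D) := by
      rw [haarAddCircle_real_eq, measureReal_def, volume_coe_image_eq (a := 0), Real.volume_Ico,
        toReal_ofReal (by linarith), sub_zero]
      exact fun x hx => ⟨hx.1, by linarith [hx.2]⟩
    obtain ⟨t, ht⟩ := exists_circleConv_ge hU hV (by rw [hUh]; positivity) (by rw [hVh]; positivity)
      hsum (fun n hn => by
        refine norm_setCoeff_arc_ge hV ?_
        rintro _ ⟨x, hx, rfl⟩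
        rw [re_fourier_coe, ← Real.cos_pi_div_three, ← Real.cos_abs (2 * _ * _ * _ / _)]
        have hnN : |(n:ℝ)| ≤ |(N:ℝ)| := by exact_mod_cast hmax n hn
        have : |2 * Real.pi * ((-n : ℤ) : ℝ) * x / (4 * D)| ≤ Real.pi / 3 := by
          rw [abs_div, abs_mul, abs_mul, abs_of_pos (by positivity : 0 < 2 * Real.pi),
            abs_of_pos (by positivity : 0 < 4 * D), abs_of_nonneg hx.1]
          push_cast
          rw [abs_neg, div_le_iff₀ (by positivity)]
          have h1 : |(n:ℝ)| * x ≤ |(N:ℝ)| * (L / 6) := by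
            have := hx.2.le
            have := hx.1
            gcongr
          have h2 : |(N:ℝ)| * L = 4 * D := by rw [hL]; field_simp
          nlinarith [Real.pi_pos]
        exact Real.cos_le_cos_of_nonneg_of_le_pi (abs_nonneg _) (by linarith [Real.pi_pos]) this)
    obtain ⟨x, hx, rfl⟩ : ∃ x ∈ Ico 0 (0 + 4 * D), (x : AddCircle (4 * D)) = t :=
      ⟨_, (AddCircle.equivIco (4 * D) 0 t).2, AddCircle.coe_equivIco⟩
    refine ⟨x, ?_⟩
    have hsub : U ∩ (fun s => (x : AddCircle (4 * D)) - s) ⁻¹' V ⊆ (↑) '' (A ∩ Ioc (x - L / 6) x) := by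
      rintro _ ⟨⟨a, ha, rfl⟩, ⟨y, hy, hyx⟩⟩
      refine ⟨a, ⟨ha, ?_⟩, rfl⟩
      simp only [← AddCircle.coe_sub] at hyx
      obtain ⟨k, hk⟩ := QuotientAddGroup.eq.1 hyx
      simp only [zsmul_eq_mul] at hk
      have ha' := hAD ha
      have hk0 : k = 0 := by
        have h1 : (k:ℝ) < 1 := by
          by_contra! h; nlinarith [ha'.1, ha'.2, hx.1, hx.2, hy.1, hy.2]
        have h2 : (-1:ℝ) < k := by
          by_contra! h; nlinarith [ha'.1, ha'.2, hx.1, hx.2, hy.1, hy.2]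
        have h1' : k < 1 := by exact_mod_cast h1
        have h2' : -1 < k := by exact_mod_cast h2
        omega
      rw [hk0] at hk
      simp only [Int.cast_zero, zero_mul] at hk
      exact ⟨by linarith [hy.2], by linarith [hy.1]⟩
    have h1 : circleConv U V (x : AddCircle (4 * D)) ≤ volume.real (A ∩ Ioc (x - L / 6) x) / (4 * D) := by
      rw [circleConv, haarAddCircle_real_eq]
      gcongr
      refine toReal_mono (measure_ne_top_of_subset inter_subset_left hAf)
        (le_trans (measure_mono hsub) (volume_coe_image_le _))
    have h2 := ht.trans h1
    rw [hVh, ← mul_div_assoc, div_le_div_iff_of_pos_right (by positivity)] at h2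
    linarith
  · obtain ⟨θ, hθ⟩ := integral_cos_eq_norm_setCoeff hA hAD hN0
    obtain ⟨ψ, hψ⟩ := exists_halfArc hAf (τ := 0.45) (L := L) (θ := θ) (by
      rw [hL, hθ]
      rw [hUh] at hcN
      calc 0.45 * volume.real A = 4 * D * (0.45 * (volume.real A / (4 * D))) := by field_simp
        _ ≤ _ := by gcongr)
    exact ⟨ψ, le_trans (by nlinarith) hψ⟩

lemma sum_volume_inter_le {α ι : Type*} [MeasureSpace α] (s : Finset ι) {S : Set α}
    (hS : volume S ≠ ⊤) {P : ι → Set α} (hP : ∀ i ∈ s, MeasurableSet (P i))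
    (hd : (s : Set ι).PairwiseDisjoint P) :
    ∑ i ∈ s, volume.real (S ∩ P i) ≤ volume.real S := by
  have h1 : ∀ i ∈ s, volume.real (S ∩ P i) = (volume.restrict S).real (P i) := by
    intro i hi
    rw [measureReal_restrict_apply (hP i hi), inter_comm]
  have : IsFiniteMeasure (volume.restrict S) := ⟨by simpa using hS.lt_top⟩
  rw [Finset.sum_congr rfl h1, ← measureReal_biUnion_finset hd hP]
  calc _ ≤ (volume.restrict S).real univ := measureReal_mono (subset_univ _)
    _ = _ := by simp [measureReal_def]

lemma sum_volume_le_of_disjoint {α ι : Type*} [MeasureSpace α] (s : Finset ι) {S : Set α}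
    (hS : volume S ≠ ⊤) {P : ι → Set α} (hP : ∀ i ∈ s, MeasurableSet (P i))
    (hd : (s : Set ι).PairwiseDisjoint P) (hsub : ∀ i ∈ s, P i ⊆ S) :
    ∑ i ∈ s, volume.real (P i) ≤ volume.real S := by
  refine le_trans (le_of_eq ?_) (sum_volume_inter_le s hS hP hd)
  exact Finset.sum_congr rfl fun i hi => by rw [inter_eq_right.2 (hsub i hi)]

lemma volume_real_add_le {X Y : Set ℝ} (hX : MeasurableSet X) (hY : MeasurableSet Y)
    (hX0 : X.Nonempty) (hY0 : Y.Nonempty) (hfin : volume (X + Y) ≠ ⊤) :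
    volume.real X + volume.real Y ≤ volume.real (X + Y) := by
  have h := volume_add_volume_le hX hY hX0 hY0
  have hX1 : volume X ≠ ⊤ := ne_top_of_le_ne_top hfin (le_trans (le_add_right le_rfl) h)
  have hY1 : volume Y ≠ ⊤ := ne_top_of_le_ne_top hfin (le_trans (le_add_left le_rfl) h)
  rw [measureReal_def, measureReal_def, measureReal_def, ← ENNReal.toReal_add hX1 hY1]
  exact ENNReal.toReal_mono hfin h

/-- If weighted sums exceed one another then some common level set does too. -/
lemma exists_level {I J : Finset ℤ} {a m : ℤ → ℝ} {u w K : ℝ} (hu : 0 ≤ u) (huw : u ≤ w)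
    (ha : ∀ i ∈ I, a i ≤ w) (hm : ∀ s ∈ J, 0 ≤ m s)
    (h : ∑ s ∈ J, m s + K * (w - u) < 2.9 * ∑ i ∈ I, (a i - u)) :
    ∃ l, u ≤ l ∧ ((J.filter fun s => l < m s).card : ℝ) + K <
      2.9 * ((I.filter fun i => l < a i).card : ℝ) := by
  by_contra! hc
  have hIint : ∀ b : ℝ, IntegrableOn (fun l => if l < b then (1 : ℝ) else 0) (Ioc u w) := by
    intro b
    have : (fun l => if l < b then (1 : ℝ) else 0) = (Iio b).indicator (fun _ => 1) := by
      ext l; simp [indicator]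
    rw [this]
    exact (integrable_const (1 : ℝ)).indicator measurableSet_Iio
  have hval : ∀ b : ℝ, ∫ l in Ioc u w, (if l < b then (1 : ℝ) else 0) =
      volume.real (Iio b ∩ Ioc u w) := by
    intro b
    have : (fun l => if l < b then (1 : ℝ) else 0) = (Iio b).indicator (fun _ => 1) := by
      ext l; simp [indicator]
    rw [this, integral_indicator_const _ measurableSet_Iio, smul_eq_mul, mul_one,
      measureReal_restrict_apply measurableSet_Iio]
  have hcard : ∀ (S : Finset ℤ) (f : ℤ → ℝ) (l : ℝ), ((S.filter fun i => l < f i).card : ℝ) =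
      ∑ i ∈ S, if l < f i then (1 : ℝ) else 0 := by
    intro S f l
    simp
  have hA : ∀ i ∈ I, a i - u ≤ ∫ l in Ioc u w, (if l < a i then (1 : ℝ) else 0) := by
    intro i hi
    rw [hval]
    have : Ioo u (a i) ⊆ Iio (a i) ∩ Ioc u w := fun x hx => ⟨hx.2, hx.1, hx.2.le.trans (ha i hi)⟩
    calc a i - u ≤ max (a i - u) 0 := le_max_left _ _
      _ = volume.real (Ioo u (a i)) := by
        rw [measureReal_def, Real.volume_Ioo, ENNReal.toReal_ofReal']
      _ ≤ _ := measureReal_mono this (measure_ne_top_of_subset inter_subset_right (by simp))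
  have hM : ∀ s ∈ J, ∫ l in Ioc u w, (if l < m s then (1 : ℝ) else 0) ≤ m s := by
    intro s hs
    rw [hval]
    have : Iio (m s) ∩ Ioc u w ⊆ Ioo 0 (m s) := fun x hx => ⟨hu.trans_lt hx.2.1, hx.1⟩
    calc _ ≤ volume.real (Ioo 0 (m s)) := measureReal_mono this (by simp)
      _ = _ := by simp [measureReal_def, Real.volume_Ioo, hm s hs]
  have hI : ∫ l in Ioc u w, 2.9 * ∑ i ∈ I, (if l < a i then (1 : ℝ) else 0) ≤
      ∫ l in Ioc u w, (∑ s ∈ J, (if l < m s then (1 : ℝ) else 0) + K) := by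
    refine setIntegral_mono_on ?_ ?_ measurableSet_Ioc ?_
    · exact (integrable_finsetSum _ fun i _ => hIint _).const_mul _
    · exact (integrable_finsetSum _ fun i _ => hIint _).add (integrable_const _)
    · intro l hl
      rw [← hcard, ← hcard]
      exact hc l hl.1.le
  rw [integral_const_mul, integral_finsetSum _ fun i _ => hIint _,
    integral_add (integrable_finsetSum _ fun i _ => hIint _) (integrable_const _),
    integral_finsetSum _ fun i _ => hIint _] at hI
  have h1 := Finset.sum_le_sum hA
  have h2 := Finset.sum_le_sum hM
  have h3 : ∫ _ in Ioc u w, K = K * (w - u) := by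
    simp [measureReal_def, huw, mul_comm]
  rw [h3] at hI
  linarith

/-- The part of `A` in the half-open lower half of the `i`-th period. -/
def halfRow (A : Set ℝ) (L ψ : ℝ) (i : ℤ) : Set ℝ := {x ∈ A | x / L + ψ ∈ Ico (i : ℝ) (i + 1 / 2)}

lemma measurableSet_halfRow {A : Set ℝ} (hA : MeasurableSet A) (L ψ : ℝ) (i : ℤ) :
    MeasurableSet (halfRow A L ψ i) := by
  have : Measurable fun x : ℝ => x / L + ψ := by fun_prop
  exact hA.inter (this measurableSet_Ico)

lemma halfRow_bounds {A : Set ℝ} {L ψ : ℝ} (hL : 0 < L) {i : ℤ} {x : ℝ}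
    (hx : x ∈ halfRow A L ψ i) : L * (i - ψ) ≤ x ∧ x < L * (i - ψ) + L / 2 := by
  obtain ⟨-, h1, h2⟩ := hx
  have e : x = L * (x / L) := by field_simp
  constructor <;> rw [e] <;> nlinarith

lemma volume_halfRow_le {A : Set ℝ} {L ψ : ℝ} (hL : 0 < L) (i : ℤ) :
    volume.real (halfRow A L ψ i) ≤ L / 2 := by
  have : halfRow A L ψ i ⊆ Icc (L * (i - ψ)) (L * (i - ψ) + L / 2) :=
    fun x hx => ⟨(halfRow_bounds hL hx).1, (halfRow_bounds hL hx).2.le⟩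
  calc _ ≤ volume.real (Icc (L * (i - ψ)) (L * (i - ψ) + L / 2)) :=
        measureReal_mono this (by simp)
    _ = L / 2 := by rw [Real.volume_real_Icc_of_le (by linarith)]; ring

lemma pairwiseDisjoint_halfRow (A : Set ℝ) (L ψ : ℝ) (s : Set ℤ) :
    s.PairwiseDisjoint (halfRow A L ψ) := by
  intro i _ j _ hij
  refine Set.disjoint_left.2 fun x hx hy => hij ?_
  obtain ⟨-, h1, h2⟩ := hx
  obtain ⟨-, h3, h4⟩ := hy
  have h5 : (i : ℝ) < j + 1 := by linarith
  have h6 : (j : ℝ) < i + 1 := by linarith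
  norm_cast at h5 h6
  omega

lemma exists_dense_rows {A : Set ℝ} (hA : MeasurableSet A) {D : ℝ} (hD : 0 < D)
    (hAD : A ⊆ Icc 0 D) (hpos : 0 < volume.real A)
    (hdbl : volume.real (A + A) ≤ 4 * volume.real A) (hbig : 5 * volume.real A ≤ D) :
    ∃ L ψ : ℝ, ∃ X : Finset ℤ, 0 < L ∧ L ≤ 4 * D ∧
      (∀ i ∈ X, L / 200000 ≤ volume.real (halfRow A L ψ i)) ∧
      0.02 * volume.real A / L ≤ X.card ∧ ((X + X).card : ℝ) < 2.9 * X.card := by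
  obtain ⟨L, hL, hLD, ⟨x, hx⟩, ψ, hψ⟩ := exists_period hA hD hAD hpos hdbl hbig
  have hAA : A + A ⊆ Icc (0 + 0) (D + D) := (add_subset_add hAD hAD).trans
    (Icc_add_Icc_subset _ _ _ _)
  have hAAfin : volume (A + A) ≠ ⊤ := measure_ne_top_of_subset hAA (by simp)
  have hAfin : volume A ≠ ⊤ := measure_ne_top_of_subset hAD (by simp)
  set a : ℤ → ℝ := fun i => volume.real (halfRow A L ψ i) with ha
  set I0 : Finset ℤ := Finset.Icc ⌊ψ⌋ ⌈D / L + ψ⌉ with hI0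
  set I : Finset ℤ := I0.filter fun i => 0 < a i with hI
  have hne : ∀ i ∈ I, (halfRow A L ψ i).Nonempty := by
    intro i hi
    have : 0 < a i := (Finset.mem_filter.1 hi).2
    by_contra hcon
    rw [not_nonempty_iff_eq_empty] at hcon
    simp [ha, hcon] at this
  -- total mass
  have hsum : 0.72 * volume.real A ≤ ∑ i ∈ I, a i := by
    have h1 : ∑ i ∈ I, a i = ∑ i ∈ I0, a i := by
      refine Finset.sum_filter_of_ne fun i _ h => lt_of_le_of_ne measureReal_nonneg (Ne.symm h)
    rw [h1]
    have h2 : A ∩ {x | Int.fract (x / L + ψ) < 1 / 2} ⊆ ⋃ i ∈ I0, halfRow A L ψ i := by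
      rintro y ⟨hy, hy2⟩
      have hy2 : Int.fract (y / L + ψ) < 1 / 2 := hy2
      have hy0 := (hAD hy).1
      have hyD := (hAD hy).2
      simp only [mem_iUnion, exists_prop]
      refine ⟨⌊y / L + ψ⌋, ?_, hy, Int.floor_le _, ?_⟩
      · rw [hI0, Finset.mem_Icc]
        constructor
        · apply Int.floor_mono
          have : 0 ≤ y / L := by positivity
          linarith
        · refine (Int.floor_le_ceil _).trans (Int.ceil_mono ?_)
          have : y / L ≤ D / L := by gcongr
          linarith
      · have := Int.floor_add_fract (y / L + ψ)
        linarith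
    have h3 : volume (⋃ i ∈ I0, halfRow A L ψ i) ≠ ⊤ :=
      measure_ne_top_of_subset (iUnion₂_subset fun i _ => fun y hy => hy.1) hAfin
    calc _ ≤ _ := hψ
      _ ≤ volume.real (⋃ i ∈ I0, halfRow A L ψ i) := measureReal_mono h2 h3
      _ ≤ _ := measureReal_biUnion_finset_le _ _
  -- number of rows
  have hcard : (I.card : ℝ) * (0.002 * L) ≤ 4 * volume.real A := by
    choose! y hy using hne
    set W := A ∩ Ioc (x - L / 6) x with hW
    have hWm : MeasurableSet W := hA.inter measurableSet_Ioc
    have h1 : ∑ i ∈ I, volume.real ((fun z => y i + z) '' W) ≤ volume.real (A + A) := by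
      refine sum_volume_le_of_disjoint I hAAfin ?_ ?_ ?_
      · intro i _
        rw [image_add_left]
        exact hWm.preimage (measurable_const_add _)
      · intro i hi j hj hij
        refine Set.disjoint_left.2 ?_
        rintro z ⟨z1, hz1, rfl⟩ ⟨z2, hz2, h⟩
        apply hij
        have h3 := halfRow_bounds hL (hy i hi)
        have h4 := halfRow_bounds hL (hy j hj)
        have h5 := hz1.2
        have h6 := hz2.2
        simp only at h
        have h7 : L * i < L * (j + 1) := by
          nlinarith [h5.1, h5.2, h6.1, h6.2, h3.1, h3.2, h4.1, h4.2]
        have h8 : L * j < L * (i + 1) := by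
          nlinarith [h5.1, h5.2, h6.1, h6.2, h3.1, h3.2, h4.1, h4.2]
        have h7 := lt_of_mul_lt_mul_left h7 hL.le
        have h8 := lt_of_mul_lt_mul_left h8 hL.le
        norm_cast at h7 h8
        omega
      · rintro i hi z ⟨z1, hz1, rfl⟩
        exact add_mem_add (hy i hi).1 hz1.1
    have h2 : ∀ i ∈ I, volume.real ((fun z => y i + z) '' W) = volume.real W := by
      intro i _
      rw [measureReal_def, image_add_left, measure_preimage_add, measureReal_def]
    rw [Finset.sum_congr rfl h2, Finset.sum_const, nsmul_eq_mul] at h1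
    calc _ ≤ (I.card : ℝ) * volume.real W := by gcongr
      _ ≤ _ := h1.trans hdbl
  set Q : ℤ → Set ℝ := fun s => {z | ⌊z / L + 2 * ψ⌋ = s} with hQ
  have hQm : ∀ s, MeasurableSet (Q s) := by
    intro s
    have : Measurable fun z : ℝ => ⌊z / L + 2 * ψ⌋ := by fun_prop
    exact this (measurableSet_singleton s)
  set m : ℤ → ℝ := fun s => volume.real ((A + A) ∩ Q s) / 2 with hm
  have hmsum : ∑ s ∈ I + I, m s ≤ 2 * volume.real A := by
    have h1 := sum_volume_inter_le (I + I) hAAfin (P := Q) (fun i _ => hQm i) (by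
      intro i _ j _ hij
      refine Set.disjoint_left.2 fun z hz hz' => hij ?_
      exact (show ⌊z / L + 2 * ψ⌋ = i from hz).symm.trans hz')
    rw [hm, ← Finset.sum_div]
    linarith
  have hmge : ∀ i ∈ I, ∀ j ∈ I, (a i + a j) / 2 ≤ m (i + j) := by
    intro i hi j hj
    have hsub : halfRow A L ψ i + halfRow A L ψ j ⊆ (A + A) ∩ Q (i + j) := by
      rintro _ ⟨p, hp, q, hq, rfl⟩
      refine ⟨add_mem_add hp.1 hq.1, ?_⟩
      change ⌊(p + q) / L + 2 * ψ⌋ = i + j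
      have e : (p + q) / L + 2 * ψ = (p / L + ψ) + (q / L + ψ) := by ring
      rw [e, Int.floor_eq_iff]
      obtain ⟨-, h1, h2⟩ := hp
      obtain ⟨-, h3, h4⟩ := hq
      push_cast
      constructor <;> linarith
    have hf : volume ((A + A) ∩ Q (i + j)) ≠ ⊤ := measure_ne_top_of_subset inter_subset_left hAAfin
    have h1 := volume_real_add_le (measurableSet_halfRow hA L ψ i) (measurableSet_halfRow hA L ψ j)
      (hne i hi) (hne j hj) (measure_ne_top_of_subset hsub hf)
    have h2 := measureReal_mono hsub hf
    simp only [ha, hm]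
    linarith
  have hmain : ∑ s ∈ I + I, m s + (0.058 * volume.real A / L) * (L / 2 - L / 200000) <
      2.9 * ∑ i ∈ I, (a i - L / 200000) := by
    rw [Finset.sum_sub_distrib, Finset.sum_const, nsmul_eq_mul]
    have e : (0.058 * volume.real A / L) * (L / 2 - L / 200000) =
      0.058 * volume.real A * (1 / 2 - 1 / 200000) := by field_simp
    rw [e]
    linarith
  obtain ⟨l, hl, hlt⟩ := exists_level (by positivity) (by linarith)
    (fun i _ => volume_halfRow_le hL i) (fun s _ => by positivity) hmain
  have hXX : (I.filter fun i => l < a i) + (I.filter fun i => l < a i) ⊆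
      (I + I).filter fun s => l < m s := by
    intro s hs
    obtain ⟨i, hi, j, hj, rfl⟩ := Finset.mem_add.1 hs
    rw [Finset.mem_filter] at hi hj ⊢
    refine ⟨Finset.add_mem_add hi.1 hj.1, ?_⟩
    have := hmge i hi.1 j hj.1
    linarith [hi.2, hj.2]
  have hcXX : (((I.filter fun i => l < a i) + (I.filter fun i => l < a i)).card : ℝ) ≤
      ((I + I).filter fun s => l < m s).card := by exact_mod_cast Finset.card_le_card hXX
  have hK : 0 ≤ 0.058 * volume.real A / L := by positivity
  refine ⟨L, ψ, I.filter fun i => l < a i, hL, hLD, ?_, ?_, by linarith⟩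
  · intro i hi
    exact hl.trans (Finset.mem_filter.1 hi).2.le
  · have e : 0.058 * volume.real A / L = 2.9 * (0.02 * volume.real A / L) := by ring
    have : (0 : ℝ) ≤ ((I + I).filter fun s => l < m s).card := by positivity
    linarith

lemma exists_few_classes {X : Finset ℤ} (hX : 100 ≤ X.card)
    (h : ((X + X).card : ℝ) < 2.9 * X.card) :
    ∃ (p q : ℤ) (k d : ℕ) (Z : Finset ℤ), p ∈ X ∧ q ∈ X ∧ (∀ x ∈ X, p ≤ x ∧ x ≤ q) ∧
      q - p = k * d ∧ p + 99 ≤ q ∧ 0 < d ∧ k ≤ 24 * X.card ∧ Z.card ≤ 24 ∧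
      ∀ x ∈ X, ∃ z ∈ Z, (d : ℤ) ∣ x - z := by
  classical
  have hne : X.Nonempty := Finset.card_pos.1 (by omega)
  set p := X.min' hne with hp
  set q := X.max' hne with hq
  have hpX : p ∈ X := X.min'_mem hne
  have hqX : q ∈ X := X.max'_mem hne
  have hpq : ∀ x ∈ X, p ≤ x ∧ x ≤ q := fun x hx => ⟨X.min'_le x hx, X.le_max' x hx⟩
  have hcard : (X.card : ℤ) ≤ q + 1 - p := by
    have : X ⊆ Finset.Icc p q := fun x hx => Finset.mem_Icc.2 (hpq x hx)
    have h2 := Finset.card_le_card this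
    rw [Int.card_Icc] at h2
    omega
  obtain ⟨n, hn⟩ : ∃ n : ℕ, q - p = n := ⟨(q - p).toNat, by omega⟩
  have hn99 : 99 ≤ n := by omega
  have : NeZero n := ⟨by omega⟩
  let f : ℤ → Multiplicative (ZMod n) := fun x => Multiplicative.ofAdd (x : ZMod n)
  have hf : ∀ x y, f (x + y) = f x * f y := fun x y => by simp [f, ofAdd_add]
  have hfeq : ∀ x y, f x = f y ↔ (n : ℤ) ∣ y - x := fun x y => by
    simp only [f, EmbeddingLike.apply_eq_iff_eq]
    exact ZMod.intCast_eq_intCast_iff_dvd_sub x y n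
  have hf1 : ∀ x, f x = 1 ↔ (n : ℤ) ∣ x := fun x => by
    rw [← ZMod.intCast_zmod_eq_zero_iff_dvd]; exact Iff.rfl
  set Y := X.image f with hY
  have hYne : Y.Nonempty := hne.image f
  have hYcard : X.card ≤ Y.card + 1 := by
    have h1 : (X.erase q).card ≤ Y.card := by
      refine Finset.card_le_card_of_injOn f (fun x hx => Finset.mem_image_of_mem f
        (Finset.mem_of_mem_erase hx)) ?_
      intro x hx y hy hxy
      rw [hfeq] at hxy
      have hx' := hpq x (Finset.mem_of_mem_erase hx)
      have hy' := hpq y (Finset.mem_of_mem_erase hy)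
      have hx1 := Finset.ne_of_mem_erase hx
      have hy1 := Finset.ne_of_mem_erase hy
      have h3 : y - x = 0 := Int.eq_zero_of_abs_lt_dvd hxy (by rw [abs_lt]; omega)
      omega
    have h2 := Finset.card_erase_add_one hqX
    omega
  have hYY : (Y * Y).card + X.card ≤ (X + X).card := by
    have hsub : (X.image fun x => x + q) ⊆ X + X := by
      intro s hs
      obtain ⟨x, hx, rfl⟩ := Finset.mem_image.1 hs
      exact Finset.add_mem_add hx hqX
    have h1 : (X.image fun x => x + q).card = X.card :=
      Finset.card_image_of_injective _ (add_left_injective q)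
    have h2 := Finset.card_sdiff_add_card_eq_card hsub
    have h3 : Y * Y ⊆ ((X + X) \ (X.image fun x => x + q)).image f := by
      intro s hs
      obtain ⟨_, hu, _, hv, rfl⟩ := Finset.mem_mul.1 hs
      obtain ⟨x, hx, rfl⟩ := Finset.mem_image.1 hu
      obtain ⟨y, hy, rfl⟩ := Finset.mem_image.1 hv
      rw [← hf]
      have key : ∀ x ∈ X, f (x + p) ∈ ((X + X) \ (X.image fun x => x + q)).image f := by
        intro x hx
        by_cases hxq : x = q
        · refine Finset.mem_image.2 ⟨p + p, ?_, ?_⟩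
          · refine Finset.mem_sdiff.2 ⟨Finset.add_mem_add hpX hpX, fun hc => ?_⟩
            obtain ⟨y, hy, h4⟩ := Finset.mem_image.1 hc
            have := hpq y hy
            omega
          · rw [hfeq]; exact ⟨1, by subst hxq; omega⟩
        · refine Finset.mem_image.2 ⟨x + p, ?_, rfl⟩
          refine Finset.mem_sdiff.2 ⟨Finset.add_mem_add hx hpX, fun hc => ?_⟩
          obtain ⟨y, hy, h4⟩ := Finset.mem_image.1 hc
          have := hpq y hy
          have := hpq x hx
          omega
      by_cases hc : x + y ∈ X.image fun x => x + q
      · obtain ⟨z, hz, h4⟩ := Finset.mem_image.1 hc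
        have : f (x + y) = f (z + p) := by
          rw [hfeq]; exact ⟨-1, by omega⟩
        rw [this]
        exact key z hz
      · exact Finset.mem_image_of_mem f (Finset.mem_sdiff.2 ⟨Finset.add_mem_add hx hy, hc⟩)
    have h4 := (Finset.card_le_card h3).trans Finset.card_image_le
    omega
  have hdb : ((Y * Y).card : ℝ) ≤ (2 - 0.08) * Y.card := by
    have h1 : ((Y * Y).card : ℝ) + X.card ≤ (X + X).card := by exact_mod_cast hYY
    have h2 : (X.card : ℝ) ≤ Y.card + 1 := by exact_mod_cast hYcard
    have h3 : (100 : ℝ) ≤ X.card := by exact_mod_cast hX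
    linarith
  obtain ⟨H, hHf, Z, hHc, hZc, hsub⟩ :=
    Finset.doubling_lt_two (ε := 0.08) (by norm_num) (by norm_num) hYne hdb
  have hdvd : Fintype.card H ∣ n := by
    have := Subgroup.card_subgroup_dvd_card H
    simpa [Nat.card_eq_fintype_card] using this
  obtain ⟨d, hd⟩ := hdvd
  have hkpos : 0 < Fintype.card H := Fintype.card_pos
  refine ⟨p, q, Fintype.card H, d, Z.image fun z => (Multiplicative.toAdd z).val, hpX, hqX, hpq,
    ?_, by omega, ?_, ?_, ?_, ?_⟩
  · rw [hn]; exact_mod_cast hd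
  · rcases Nat.eq_zero_or_pos d with h0 | h0
    · subst h0; omega
    · exact h0
  · have h1 : (Y.card : ℝ) ≤ X.card := by exact_mod_cast Finset.card_image_le
    have h2 : (Fintype.card H : ℝ) ≤ 24 * X.card := by
      refine hHc.trans ?_
      norm_num
      exact_mod_cast h1
    exact_mod_cast h2
  · have h2 : (Z.card : ℝ) ≤ 24 := hZc.trans (by norm_num)
    exact Finset.card_image_le.trans (by exact_mod_cast h2)
  · intro x hx
    obtain ⟨g, hg, z, hz, hgz⟩ := hsub (Finset.mem_coe.2 (Finset.mem_image_of_mem f hx))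
    refine ⟨_, Finset.mem_image_of_mem _ hz, ?_⟩
    have hz' : f ((Multiplicative.toAdd z).val : ℤ) = z := by
      simp [f]
    set z' : ℤ := ((Multiplicative.toAdd z).val : ℤ) with hz'd
    have h1 : f (x - z') = g := by
      have h2 : f (x - z') * f z' = g * z := by
        rw [← hf, sub_add_cancel]; exact hgz.symm
      rw [hz'] at h2
      exact mul_right_cancel h2
    have hpow : g ^ Fintype.card H = 1 := by
      have := congrArg Subtype.val (pow_card_eq_one (x := (⟨g, hg⟩ : H)))
      exact this
    have hfpow : ∀ k : ℕ, f (x - z') ^ k = f (k * (x - z')) := by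
      intro k
      induction k with
      | zero => simp [f]
      | succ k ih => rw [pow_succ, ih, ← hf]; push_cast; ring_nf
    rw [← h1, hfpow, hf1, show (n : ℤ) = (Fintype.card H : ℤ) * d by exact_mod_cast hd] at hpow
    exact (mul_dvd_mul_iff_left (by exact_mod_cast hkpos.ne')).1 hpow

/-- A covering lemma of Ruzsa type. -/
lemma exists_cover_by_translates {A M : Set ℝ} (hM : MeasurableSet M) (hMA : M ⊆ A)
    (hfin : volume (A + A) ≠ ⊤) (hM0 : 0 < volume.real M) {N : ℕ}
    (hN : volume.real (A + A) ≤ N * volume.real M) :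
    ∃ F : Finset ℝ, F.card ≤ N ∧ ∀ a ∈ A, ∃ f ∈ F, ∃ m ∈ M, ∃ m' ∈ M, a = f + m - m' := by
  classical
  set T : ℝ → Set ℝ := fun f => (fun z => f + z) '' M with hT
  let P : ℕ → Prop := fun n => ∃ F : Finset ℝ, F.card = n ∧ (F : Set ℝ) ⊆ A ∧
    (F : Set ℝ).PairwiseDisjoint T
  have hvol : ∀ f, volume.real (T f) = volume.real M := by
    intro f
    rw [measureReal_def, hT]
    simp only
    rw [image_add_left, measure_preimage_add, measureReal_def]
  have hbound : ∀ n, P n → n ≤ N := by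
    rintro n ⟨F, rfl, hFA, hd⟩
    have h1 := sum_volume_le_of_disjoint F hfin (P := T) (fun f _ => by
      rw [hT]; simp only; rw [image_add_left]; exact hM.preimage (measurable_const_add _)) hd
      (by rintro f hf _ ⟨z, hz, rfl⟩; exact add_mem_add (hFA hf) (hMA hz))
    rw [Finset.sum_congr rfl fun f _ => hvol f, Finset.sum_const, nsmul_eq_mul] at h1
    have := le_of_mul_le_mul_right (h1.trans hN) hM0
    exact_mod_cast this
  have h0 : P 0 := ⟨∅, rfl, by simp, by simp⟩
  obtain ⟨F, hFc, hFA, hd⟩ := Nat.findGreatest_spec (P := P) (Nat.zero_le N) h0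
  refine ⟨F, hFc.trans_le (Nat.findGreatest_le N), fun a ha => ?_⟩
  by_cases haF : a ∈ F
  · obtain ⟨m, hm⟩ : M.Nonempty := by
      by_contra hc
      rw [not_nonempty_iff_eq_empty] at hc
      simp [hc] at hM0
    exact ⟨a, haF, m, hm, m, hm, by ring⟩
  · by_contra! hc
    have hP : P (F.card + 1) := by
      refine ⟨insert a F, Finset.card_insert_of_notMem haF, ?_, ?_⟩
      · intro x hx
        rcases Finset.mem_insert.1 (Finset.mem_coe.1 hx) with rfl | h
        · exact ha
        · exact hFA h
      · rw [Finset.coe_insert]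
        refine hd.insert fun f hf _ => ?_
        refine Set.disjoint_left.2 ?_
        rintro _ ⟨m', hm', rfl⟩ ⟨m, hm, h⟩
        exact hc f hf m hm m' hm' (by simp only at h; linarith)
    have := Nat.le_findGreatest (hbound _ hP) hP
    omega

set_option maxHeartbeats 1000000 in
lemma exists_structure : ∃ r : ℕ, ∀ Q : ℝ, 1 ≤ Q → ∃ C : ℝ, ∀ (A : Set ℝ) (D : ℝ),
    MeasurableSet A → A ⊆ Icc 0 D → 0 < volume.real A → volume.real (A + A) ≤ 4 * volume.real A →
    C * volume.real A ≤ D →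
    ∃ (F : Finset ℝ) (v l : ℝ), F.card ≤ r ∧ 0 < l ∧ Q * l ≤ v ∧ v ≤ 2 * D ∧
      ∀ a ∈ A, ∃ f ∈ F, ∃ k : ℤ, |a - f - k * v| ≤ l := by
  classical
  refine ⟨40000000 * 10000, fun Q hQ => ⟨5000000 * Q ^ 2, fun A D hA hAD hpos hdbl hbig => ?_⟩⟩
  have hQ2 : 1 ≤ Q ^ 2 := one_le_pow₀ hQ
  have hbig' : 5 * volume.real A ≤ D := by nlinarith
  have hD : 0 < D := by linarith
  have hAA : A + A ⊆ Icc (0 + 0) (D + D) := (add_subset_add hAD hAD).trans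
    (Icc_add_Icc_subset _ _ _ _)
  have hAAfin : volume (A + A) ≠ ⊤ := measure_ne_top_of_subset hAA (by simp)
  have hAfin : volume A ≠ ⊤ := measure_ne_top_of_subset hAD (by simp)
  obtain ⟨L, ψ, X, hL, -, hrow, hXc, hXX⟩ := exists_dense_rows hA hD hAD hpos hdbl hbig'
  have hX0 : (0 : ℝ) < X.card := lt_of_lt_of_le (by positivity) hXc
  set M := ⋃ i ∈ X, halfRow A L ψ i with hM
  have hMm : MeasurableSet M :=
    Finset.measurableSet_biUnion _ fun i _ => measurableSet_halfRow hA L ψ i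
  have hMA : M ⊆ A := iUnion₂_subset fun i _ => fun y hy => hy.1
  have hMvol : X.card * (L / 200000) ≤ volume.real M := by
    rw [hM, measureReal_biUnion_finset (pairwiseDisjoint_halfRow A L ψ _)
      (fun i _ => measurableSet_halfRow hA L ψ i)
      (fun i _ => measure_ne_top_of_subset (fun y hy => hy.1) hAfin), ← nsmul_eq_mul]
    exact Finset.card_nsmul_le_sum _ _ _ hrow
  have hMle : volume.real M ≤ volume.real A := measureReal_mono hMA hAfin
  have hM0 : 0 < volume.real M := lt_of_lt_of_le (by positivity) hMvol
  have hMA' : 0.0000001 * volume.real A ≤ volume.real M := by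
    refine le_trans ?_ hMvol
    rw [div_le_iff₀ hL] at hXc
    linarith
  obtain ⟨F, hFc, hF⟩ := exists_cover_by_translates (N := 40000000) hMm hMA hAAfin hM0
    (by push_cast; linarith)
  have hF' : ∀ a ∈ A, ∃ f ∈ F, ∃ i ∈ X, ∃ j ∈ X, |a - f - L * (i - j)| ≤ L / 2 := by
    intro a ha
    obtain ⟨f, hf, m, hm, m', hm', rfl⟩ := hF a ha
    simp only [hM, mem_iUnion, exists_prop] at hm hm'
    obtain ⟨i, hi, hm⟩ := hm
    obtain ⟨j, hj, hm'⟩ := hm'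
    have h1 := halfRow_bounds hL hm
    have h2 := halfRow_bounds hL hm'
    refine ⟨f, hf, i, hi, j, hj, ?_⟩
    rw [abs_le]
    constructor <;> linarith
  have hX1 : (1 : ℝ) ≤ X.card := by
    have : 0 < X.card := by exact_mod_cast hX0
    exact_mod_cast this
  have hLX : X.card * L ≤ 200000 * volume.real A := by linarith
  rcases lt_or_ge X.card 100 with hX | hX
  · refine ⟨(F ×ˢ (X ×ˢ X)).image fun t => t.1 + L * (t.2.1 - t.2.2), 2 * D,
      L / 2, ?_, by positivity, ?_, le_rfl, ?_⟩
    · refine Finset.card_image_le.trans ?_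
      rw [Finset.card_product, Finset.card_product]
      exact Nat.mul_le_mul hFc (by nlinarith)
    · have : L ≤ 200000 * volume.real A := by nlinarith
      nlinarith [mul_le_mul_of_nonneg_left this (by linarith : 0 ≤ Q)]
    · intro a ha
      obtain ⟨f, hf, i, hi, j, hj, h⟩ := hF' a ha
      refine ⟨_, Finset.mem_image.2 ⟨(f, i, j), by simp [hf, hi, hj], rfl⟩, 0, ?_⟩
      convert h using 2
      push_cast; ring
  obtain ⟨p, q, k, d, Z, hp, hq, hpq, hkd, hpq99, hd0, hk, hZ, hXZ⟩ := exists_few_classes hX hXX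
  have hkd' : (q : ℝ) - p = k * d := by exact_mod_cast hkd
  rcases lt_or_ge Q d with hdQ | hdQ
  · refine ⟨(F ×ˢ (Z ×ˢ Z)).image fun t => t.1 + L * (t.2.1 - t.2.2), d * L,
      L / 2, ?_, by positivity, ?_, ?_, ?_⟩
    · refine Finset.card_image_le.trans ?_
      rw [Finset.card_product, Finset.card_product]
      exact Nat.mul_le_mul hFc (by nlinarith)
    · nlinarith
    · have hk1 : (1 : ℝ) ≤ k := by
        have : k ≠ 0 := by rintro rfl; simp at hkd; omega
        exact_mod_cast Nat.one_le_iff_ne_zero.2 this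
      have hne : ∀ i ∈ X, (halfRow A L ψ i).Nonempty := by
        intro i hi
        by_contra hc
        rw [not_nonempty_iff_eq_empty] at hc
        have := hrow i hi
        simp [hc] at this
        linarith
      obtain ⟨x, hx⟩ := hne p hp
      obtain ⟨y, hy⟩ := hne q hq
      have h1 := halfRow_bounds hL hx
      have h2 := halfRow_bounds hL hy
      have h3 := (hAD hx.1).1
      have h4 := (hAD hy.1).2
      have h5 : (p : ℝ) + 99 ≤ q := by exact_mod_cast hpq99
      have h6 : L * (q - p) ≤ D + L / 2 := by nlinarith
      have h7 : (d : ℝ) ≤ q - p := by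
        rw [hkd']; have : (0 : ℝ) ≤ d := by positivity
        nlinarith
      nlinarith
    · intro a ha
      obtain ⟨f, hf, i, hi, j, hj, h⟩ := hF' a ha
      obtain ⟨z, hz, u, hu⟩ := hXZ i hi
      obtain ⟨z', hz', u', hu'⟩ := hXZ j hj
      refine ⟨_, Finset.mem_image.2 ⟨(f, z, z'), by simp [hf, hz, hz'], rfl⟩, u - u', ?_⟩
      have hu : (i : ℝ) = z + d * u := by have : i = z + d * u := by linarith
                                          exact_mod_cast this
      have hu' : (j : ℝ) = z' + d * u' := by have : j = z' + d * u' := by linarith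
                                             exact_mod_cast this
      convert h using 2
      rw [hu, hu']
      push_cast; ring
  · refine ⟨F, 2 * D, 25 * Q * (200000 * volume.real A), ?_, by positivity, ?_, le_rfl, ?_⟩
    · omega
    · nlinarith
    · intro a ha
      obtain ⟨f, hf, i, hi, j, hj, h⟩ := hF' a ha
      refine ⟨f, hf, 0, ?_⟩
      have hi' := hpq i hi
      have hj' := hpq j hj
      have hij : |(i : ℝ) - j| ≤ q - p := by
        rw [abs_le]
        have h1 : (p : ℝ) ≤ i := by exact_mod_cast hi'.1
        have h2 : (i : ℝ) ≤ q := by exact_mod_cast hi'.2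
        have h3 : (p : ℝ) ≤ j := by exact_mod_cast hj'.1
        have h4 : (j : ℝ) ≤ q := by exact_mod_cast hj'.2
        constructor <;> linarith
      have hqp : (q : ℝ) - p ≤ 24 * X.card * Q := by
        rw [hkd']
        have hk' : (k : ℝ) ≤ 24 * X.card := by exact_mod_cast hk
        gcongr
      have h1 : |a - f| ≤ L * (24 * X.card * Q) + L / 2 := by
        have e : a - f = (a - f - L * (i - j)) + L * (i - j) := by ring
        rw [e]
        refine (abs_add_le _ _).trans ?_
        rw [abs_mul, abs_of_pos hL]
        have := mul_le_mul_of_nonneg_left (hij.trans hqp) hL.le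
        linarith
      have h2 : L / 2 ≤ L * (X.card * Q) := by
        have : 1 ≤ (X.card : ℝ) * Q := by nlinarith
        nlinarith
      have h3 : L * (X.card * Q) ≤ 200000 * volume.real A * Q := by
        have := mul_le_mul_of_nonneg_right hLX (by linarith : 0 ≤ Q)
        linarith
      simp only [Int.cast_zero, zero_mul, sub_zero]
      linarith

lemma nsmul_sub_near {A : Set ℝ} {F : Finset ℝ} {v l : ℝ}
    (h : ∀ a ∈ A, ∃ f ∈ F, ∃ k : ℤ, |a - f - k * v| ≤ l) (n : ℕ) :
    ∀ e ∈ n • (A - A), ∃ g ∈ n • (F - F), ∃ k : ℤ, |e - g - k * v| ≤ n * (2 * l) := by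
  induction n with
  | zero =>
    intro e he
    simp only [zero_nsmul] at he ⊢
    have : e = 0 := he
    exact ⟨0, Finset.zero_mem_zero, 0, by simp [this]⟩
  | succ n ih =>
    intro e he
    rw [succ_nsmul] at he
    obtain ⟨e', he', _, ⟨a, ha, b, hb, rfl⟩, rfl⟩ := he
    obtain ⟨g, hg, k, hk⟩ := ih e' he'
    obtain ⟨f, hf, i, hi⟩ := h a ha
    obtain ⟨f', hf', j, hj⟩ := h b hb
    refine ⟨g + (f - f'), ?_, k + (i - j), ?_⟩
    · rw [succ_nsmul]
      exact Finset.add_mem_add hg (Finset.sub_mem_sub hf hf')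
    · rw [abs_le] at *
      push_cast
      constructor <;> nlinarith

/-- A set of small doubling and large diameter has a scale separating small differences from large
ones. -/
lemma exists_scale (n : ℕ) {K : ℝ} (hK : 1 ≤ K) : ∃ C : ℝ, ∀ (A : Set ℝ) (D : ℝ),
    MeasurableSet A → A ⊆ Icc 0 D → 0 < volume.real A → volume.real (A + A) ≤ 4 * volume.real A →
    C * volume.real A ≤ D →
    ∃ w : ℝ, 0 < w ∧ K * w ≤ D ∧ ∀ e ∈ n • (A - A), |e| ≤ K * w → |e| ≤ w := by
  classical
  obtain ⟨r, hr⟩ := exists_structure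
  set R := (r * r) ^ n with hR
  set p : ℝ := (n + 1) * 2 with hp
  have hp0 : 0 < p := by positivity
  have hKR : 1 ≤ (K + 2) ^ (R + 1) := one_le_pow₀ (by linarith)
  obtain ⟨C, hC⟩ := hr (8 * p * K * (K + 2) ^ (R + 1)) (by
    have h1 : 1 ≤ 8 * p := by simp only [hp]; have : (0:ℝ) ≤ n := by positivity
                              linarith
    have h2 : 1 ≤ 8 * p * K := by nlinarith
    nlinarith)
  refine ⟨C, fun A D hA hAD hpos hdbl hbig => ?_⟩
  obtain ⟨F, v, l, hFr, hl, hlv, hvD, hF⟩ := hC A D hA hAD hpos hdbl hbig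
  set l' := p * l with hl'
  have hl'0 : 0 < l' := by positivity
  have hv : 8 * K * ((K + 2) ^ (R + 1) * l') ≤ v := by
    calc _ = _ := by simp only [hl']; ring
      _ ≤ v := hlv
  have hv8 : 8 * l' ≤ v := by
    refine le_trans ?_ hv
    have : l' ≤ (K + 2) ^ (R + 1) * l' := by nlinarith
    nlinarith
  have hv0 : 0 < v := by linarith
  set red : ℝ → ℝ := fun g => g - v * round (g / v) with hred
  have hred_le : ∀ g, |red g| ≤ v / 2 := by
    intro g
    have h1 := abs_sub_round (g / v)
    have e : red g = v * (g / v - round (g / v)) := by simp only [hred]; field_simp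
    rw [e, abs_mul, abs_of_pos hv0]
    nlinarith
  have hnear : ∀ e ∈ n • (A - A), |e| ≤ v / 4 → ∃ g ∈ n • (F - F), |e - red g| ≤ l' := by
    intro e he hev
    obtain ⟨g, hg, k, hk⟩ := nsmul_sub_near hF n e he
    refine ⟨g, hg, ?_⟩
    have hk' : |e - g - k * v| ≤ l' := hk.trans (by simp only [hl', hp]; nlinarith)
    set k' : ℤ := k + round (g / v) with hk'd
    have e1 : e - g - k * v = e - red g - k' * v := by
      simp only [hred, hk'd]; push_cast; ring
    rw [e1] at hk'
    have h0 : k' = 0 := by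
      have h1 : |(k' : ℝ)| * v < 1 * v := by
        rw [← abs_of_pos hv0, ← abs_mul, abs_of_pos hv0]
        have e2 : (k' : ℝ) * v = e - red g - (e - red g - k' * v) := by ring
        rw [e2]
        have := abs_sub (e - red g) (e - red g - k' * v)
        have := abs_sub e (red g)
        have := hred_le g
        linarith
      have h2 := lt_of_mul_lt_mul_right h1 hv0.le
      have h3 : |k'| < 1 := by exact_mod_cast h2
      exact Int.abs_lt_one_iff.1 h3
    rw [h0] at hk'
    simpa using hk'
  by_contra! hc
  have hw : ∀ j : ℕ, 1 ≤ (K + 2) ^ j := fun j => one_le_pow₀ (by linarith)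
  have hbad : ∀ j ∈ Finset.range (R + 1), ∃ g ∈ n • (F - F),
      (K + 2) ^ (j + 1) * l' - l' < |red g| ∧
      |red g| ≤ K * ((K + 2) ^ (j + 1) * l') + l' := by
    intro j hj
    have hj : j < R + 1 := Finset.mem_range.1 hj
    have hle : (K + 2) ^ (j + 1) * l' ≤ (K + 2) ^ (R + 1) * l' := by
      gcongr
      · linarith
      · omega
    have hKle := mul_le_mul_of_nonneg_left hle (by linarith : 0 ≤ K)
    obtain ⟨e, he, he1, he2⟩ := hc ((K + 2) ^ (j + 1) * l') (by have := hw (j + 1); positivity)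
      (by linarith)
    obtain ⟨g, hg, hg1⟩ := hnear e he (by linarith)
    refine ⟨g, hg, ?_, ?_⟩
    · have := abs_sub_abs_le_abs_sub e (red g)
      linarith
    · have := abs_sub_abs_le_abs_sub (red g) e
      rw [abs_sub_comm] at hg1
      linarith
  choose! g hg hg1 hg2 using hbad
  have hlt : ∀ i ∈ Finset.range (R + 1), ∀ j ∈ Finset.range (R + 1), i < j → g i ≠ g j := by
    intro i hi j hj hij heq
    have h1 := hg2 i hi
    have h2 := hg1 j hj
    rw [← heq] at h2
    have h3 : (K + 2) ^ (i + 1 + 1) * l' ≤ (K + 2) ^ (j + 1) * l' := by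
      gcongr
      · linarith
      · omega
    rw [pow_succ] at h3
    have h4 := hw (i + 1)
    nlinarith
  have hcard : (Finset.range (R + 1)).card ≤ (n • (F - F)).card := by
    refine Finset.card_le_card_of_injOn g (fun i hi => hg i hi) ?_
    intro i hi j hj hij
    rcases lt_trichotomy i j with h | h | h
    · exact absurd hij (hlt i hi j hj h)
    · exact h
    · exact absurd hij.symm (hlt j hj i hi h)
  have h2 : (n • (F - F)).card ≤ R := by
    refine Finset.card_nsmul_le.trans ?_
    rw [hR]
    gcongr
    exact Finset.card_sub_le.trans (Nat.mul_le_mul hFr hFr)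
  rw [Finset.card_range] at hcard
  omega

section Separated

variable {G : Type*} [SeminormedAddCommGroup G]

/-- Short words in `S` have norm at most `w` or more than `100 * w`. -/
def ScaleGap (S : Set G) (w : ℝ) : Prop :=
  ∀ x₁ ∈ S, ∀ x₂ ∈ S, ∀ x₃ ∈ S, ∀ x₄ ∈ S, ∀ y₁ ∈ S, ∀ y₂ ∈ S, ∀ y₃ ∈ S, ∀ y₄ ∈ S, ∀ e : G,
    e = x₁ + x₂ + x₃ + x₄ - y₁ - y₂ - y₃ - y₄ → ‖e‖ ≤ 100 * w → ‖e‖ ≤ w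

/-- The sums of the pairs in `R` are pairwise more than `w` apart. -/
def SumSep (w : ℝ) (R : Finset (G × G)) : Prop :=
  ∀ p ∈ R, ∀ q ∈ R, ‖(p.1 + p.2) - (q.1 + q.2)‖ ≤ w → p = q

/-- The differences of the pairs in `R` are pairwise more than `w` apart. -/
def DiffSep (w : ℝ) (R : Finset (G × G)) : Prop :=
  ∀ p ∈ R, ∀ q ∈ R, ‖(p.1 - p.2) - (q.1 - q.2)‖ ≤ w → p = q

def NormSep (w : ℝ) (X : Finset G) : Prop := ∀ x ∈ X, ∀ y ∈ X, ‖x - y‖ ≤ w → x = y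

lemma norm_le_add {a b c : G} {r s : ℝ} (h : a = b + c) (hb : ‖b‖ ≤ r) (hc : ‖c‖ ≤ s) :
    ‖a‖ ≤ r + s := h ▸ (norm_add_le b c).trans (add_le_add hb hc)

variable {S : Set G} {w : ℝ} {X : Finset G}

/-- In a set with few distinct sums each difference has many representations. -/
lemma card_translate_lt [DecidableEq G] (hw : 0 ≤ w)
    (hX : NormSep w X)
    (hR : ∀ R : Finset (G × G), R ⊆ X ×ˢ X → SumSep w R → 2 * R.card < 3 * X.card)
    {x y : G} (hx : x ∈ X) (hy : y ∈ X) :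
    X.card < 2 * (X.filter fun u => ∃ u' ∈ X, ‖(x + u') - (y + u)‖ ≤ w).card := by
  classical
  set U := X.filter fun u => ∃ u' ∈ X, ‖(x + u') - (y + u)‖ ≤ w with hU
  set V := X.filter fun u => ¬ ∃ u' ∈ X, ‖(x + u') - (y + u)‖ ≤ w with hV
  have hUV : U.card + V.card = X.card := Finset.card_filter_add_card_filter_not _
  let R : Finset (G × G) := X.image (fun u => (x, u)) ∪ V.image (fun u => (y, u))
  have hdisj : Disjoint (X.image (fun u => (x, u))) (V.image (fun u => (y, u))) := by
    rw [Finset.disjoint_left]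
    intro p hp hq
    obtain ⟨u, hu, rfl⟩ := Finset.mem_image.1 hp
    obtain ⟨u', hu', h⟩ := Finset.mem_image.1 hq
    obtain ⟨h1, h2⟩ := Prod.mk.inj h
    refine (Finset.mem_filter.1 hu').2 ⟨u, hu, ?_⟩
    rw [h1, h2]; simpa using hw
  have hRc : R.card = X.card + V.card := by
    rw [Finset.card_union_of_disjoint hdisj, Finset.card_image_of_injective _ (Prod.mk_right_injective x),
      Finset.card_image_of_injective _ (Prod.mk_right_injective y)]
  have h1 := hR R (by
    intro p hp
    rcases Finset.mem_union.1 hp with hp | hp <;> obtain ⟨u, hu, rfl⟩ := Finset.mem_image.1 hp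
    · exact Finset.mk_mem_product hx hu
    · exact Finset.mk_mem_product hy (Finset.mem_filter.1 hu).1) (by
    intro p hp q hq hpq
    rcases Finset.mem_union.1 hp with hp | hp <;> obtain ⟨u, hu, rfl⟩ := Finset.mem_image.1 hp <;>
    rcases Finset.mem_union.1 hq with hq | hq <;> obtain ⟨u', hu', rfl⟩ := Finset.mem_image.1 hq
    · rw [hX u hu u' hu' (by simpa using hpq)]
    · exact absurd ⟨u, hu, hpq⟩ (Finset.mem_filter.1 hu').2
    · rw [norm_sub_rev] at hpq
      exact absurd ⟨u', hu', hpq⟩ (Finset.mem_filter.1 hu).2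
    · rw [hX u (Finset.mem_filter.1 hu).1 u' (Finset.mem_filter.1 hu').1 (by simpa using hpq)])
  omega

lemma exists_diff_near_add (hw : 0 ≤ w) (hS : ScaleGap S w) (hXS : ↑X ⊆ S) (hX : NormSep w X)
    (hR : ∀ R : Finset (G × G), R ⊆ X ×ˢ X → SumSep w R → 2 * R.card < 3 * X.card)
    {x y x' y' : G} (hx : x ∈ X) (hy : y ∈ X) (hx' : x' ∈ X) (hy' : y' ∈ X) :
    ∃ u ∈ X, ∃ v ∈ X, ‖(x - y) + (x' - y') - (u - v)‖ ≤ w := by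
  classical
  have h1 := card_translate_lt hw hX hR hy hx
  have h2 := card_translate_lt hw hX hR hx' hy'
  obtain ⟨z, hz⟩ : ((X.filter fun u => ∃ u' ∈ X, ‖(y + u') - (x + u)‖ ≤ w) ∩
      (X.filter fun u => ∃ u' ∈ X, ‖(x' + u') - (y' + u)‖ ≤ w)).Nonempty := by
    rw [← Finset.card_pos]
    have h3 := Finset.card_union_add_card_inter
      (X.filter fun u => ∃ u' ∈ X, ‖(y + u') - (x + u)‖ ≤ w)
      (X.filter fun u => ∃ u' ∈ X, ‖(x' + u') - (y' + u)‖ ≤ w)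
    have h4 : ((X.filter fun u => ∃ u' ∈ X, ‖(y + u') - (x + u)‖ ≤ w) ∪
      (X.filter fun u => ∃ u' ∈ X, ‖(x' + u') - (y' + u)‖ ≤ w)).card ≤ X.card :=
      Finset.card_le_card (Finset.union_subset (Finset.filter_subset _ _) (Finset.filter_subset _ _))
    omega
  rw [Finset.mem_inter, Finset.mem_filter, Finset.mem_filter] at hz
  obtain ⟨⟨hz, p, hp, hpn⟩, -, q, hq, hqn⟩ := hz
  refine ⟨p, hp, q, hq, ?_⟩
  refine hS x (hXS hx) x' (hXS hx') q (hXS hq) x (hXS hx) y (hXS hy) y' (hXS hy') p (hXS hp) x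
    (hXS hx) _ (by abel) ?_
  rw [norm_sub_rev] at hpn
  have := norm_le_add (a := (x - y) + (x' - y') - (p - q)) (by abel) hpn hqn
  linarith

lemma card_diffSep_lt (hw : 0 ≤ w) (hS : ScaleGap S w) (hXS : ↑X ⊆ S) (hX : NormSep w X)
    (hX0 : X.Nonempty)
    (hR : ∀ R : Finset (G × G), R ⊆ X ×ˢ X → SumSep w R → 2 * R.card < 3 * X.card)
    {R : Finset (G × G)} (hRX : R ⊆ X ×ˢ X) (hRs : DiffSep w R) : R.card < 2 * X.card := by
  classical
  have hc := hX0.card_pos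
  -- count pairs `(p, q)` in `X ×ˢ X` by the difference they are near
  let f : G × G → Finset (G × G) := fun p => (X ×ˢ X).filter fun q =>
    ‖(p.1 + q.2) - (p.2 + q.1)‖ ≤ w
  have hf : ∀ p ∈ R, X.card + 1 ≤ 2 * (f p).card := by
    intro p hp
    have hp' := Finset.mem_product.1 (hRX hp)
    have h1 := card_translate_lt hw hX hR hp'.1 hp'.2
    have h2 : (X.filter fun u => ∃ u' ∈ X, ‖(p.1 + u') - (p.2 + u)‖ ≤ w).card ≤ (f p).card := by
      refine Finset.card_le_card_of_surjOn Prod.fst ?_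
      intro u hu
      obtain ⟨hu, u', hu', h⟩ := Finset.mem_filter.1 (Finset.mem_coe.1 hu)
      exact ⟨(u, u'), Finset.mem_coe.2 (Finset.mem_filter.2 ⟨Finset.mk_mem_product hu hu', h⟩), rfl⟩
    omega
  have hdisj : (R : Set (G × G)).PairwiseDisjoint f := by
    intro p hp q hq hpq
    refine Finset.disjoint_left.2 fun z hz hz' => hpq ?_
    obtain ⟨hz0, hz⟩ := Finset.mem_filter.1 hz
    obtain ⟨-, hz'⟩ := Finset.mem_filter.1 hz'
    refine hRs p hp q hq ?_
    have hp' := Finset.mem_product.1 (hRX hp)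
    have hq' := Finset.mem_product.1 (hRX hq)
    refine hS p.1 (hXS hp'.1) q.2 (hXS hq'.2) p.1 (hXS hp'.1) p.1 (hXS hp'.1) p.2 (hXS hp'.2) q.1
      (hXS hq'.1) p.1 (hXS hp'.1) p.1 (hXS hp'.1) _ (by abel) ?_
    rw [norm_sub_rev] at hz'
    have := norm_le_add (a := (p.1 - p.2) - (q.1 - q.2)) (by abel) hz hz'
    linarith
  have h1 : ∑ p ∈ R, (f p).card ≤ X.card * X.card := by
    rw [← Finset.card_product, ← Finset.card_biUnion hdisj]
    exact Finset.card_le_card (Finset.biUnion_subset.2 fun p _ => Finset.filter_subset _ _)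
  have h2 : R.card * (X.card + 1) ≤ 2 * ∑ p ∈ R, (f p).card := by
    rw [Finset.mul_sum, ← smul_eq_mul]
    exact Finset.card_nsmul_le_sum _ _ _ hf
  by_contra! hcon
  nlinarith

lemma exists_sum_near (hw : 0 ≤ w) (hS : ScaleGap S w) (hXS : ↑X ⊆ S) (hX : NormSep w X)
    (hR : ∀ R : Finset (G × G), R ⊆ X ×ˢ X → SumSep w R → 2 * R.card < 3 * X.card)
    {x x' u v : G} (hx : x ∈ X) (hx' : x' ∈ X) (hu : u ∈ X) (hv : v ∈ X) :
    ∃ y ∈ X, ∃ y' ∈ X, ‖x + x' + (u - v) - (y + y')‖ ≤ w := by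
  classical
  by_contra! hc
  have hpq : ∀ y ∈ X, ∃ p ∈ X, ∃ q ∈ X, ‖(x' - y) + (u - v) - (p - q)‖ ≤ w := fun y hy =>
    exists_diff_near_add hw hS hXS hX hR hx' hy hu hv
  choose! p hp q hq hpq using hpq
  let R : Finset (G × G) := X.image (fun y => (y, x)) ∪ X.image (fun y => (p y, q y))
  have hsep : ∀ y ∈ X, ∀ y' ∈ X, ‖(p y - q y) - (p y' - q y')‖ ≤ w → y = y' := by
    intro y hy y' hy' h
    refine hX y hy y' hy' ?_
    refine hS y (hXS hy) x (hXS hx) x (hXS hx) x (hXS hx) y' (hXS hy') x (hXS hx) x (hXS hx) x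
      (hXS hx) _ (by abel) ?_
    have h1 := hpq y hy
    have h2 := hpq y' hy'
    rw [norm_sub_rev] at h h1
    have h3 := norm_le_add (a := (x' - y') + (u - v) - (p y - q y)) (by abel) h2 h
    have h4 := norm_le_add (a := y - y') (by abel) h3 h1
    linarith
  have hno : ∀ z ∈ X, ∀ y ∈ X, ¬ ‖(z - x) - (p y - q y)‖ ≤ w := by
    intro z hz y hy h
    refine absurd ?_ (not_le.2 (hc y hy z hz))
    refine hS x (hXS hx) x' (hXS hx') u (hXS hu) x (hXS hx) y (hXS hy) z (hXS hz) v (hXS hv) x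
      (hXS hx) _ (by abel) ?_
    have h1 := hpq y hy
    rw [norm_sub_rev] at h
    have h3 := norm_le_add (a := x + x' + (u - v) - (y + z)) (by abel) h1 h
    linarith
  have hdisj : Disjoint (X.image (fun y => (y, x))) (X.image (fun y => (p y, q y))) := by
    rw [Finset.disjoint_left]
    intro z hz hz'
    obtain ⟨y, hy, rfl⟩ := Finset.mem_image.1 hz
    obtain ⟨y', hy', h⟩ := Finset.mem_image.1 hz'
    obtain ⟨h1, h2⟩ := Prod.mk.inj h
    refine hno y hy y' hy' ?_
    rw [h1, h2]; simpa using hw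
  have h1 := card_diffSep_lt hw hS hXS hX ⟨x, hx⟩ hR (R := R) (by
    intro z hz
    rcases Finset.mem_union.1 hz with hz | hz <;> obtain ⟨y, hy, rfl⟩ := Finset.mem_image.1 hz
    · exact Finset.mk_mem_product hy hx
    · exact Finset.mk_mem_product (hp y hy) (hq y hy)) (by
    intro z hz z' hz' h
    rcases Finset.mem_union.1 hz with hz | hz <;> obtain ⟨y, hy, rfl⟩ := Finset.mem_image.1 hz <;>
    rcases Finset.mem_union.1 hz' with hz' | hz' <;> obtain ⟨y', hy', rfl⟩ := Finset.mem_image.1 hz'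
    · rw [hX y hy y' hy' (by simpa using h)]
    · exact absurd h (hno y hy y' hy')
    · rw [norm_sub_rev] at h
      exact absurd h (hno y' hy' y hy)
    · rw [hsep y hy y' hy' h])
  rw [Finset.card_union_of_disjoint hdisj, Finset.card_image_of_injective _ (Prod.mk_left_injective x),
    Finset.card_image_of_injOn] at h1
  · omega
  · intro y hy y' hy' h
    obtain ⟨h2, h3⟩ := Prod.mk.inj h
    exact hsep y hy y' hy' (by rw [h2, h3]; simpa using hw)

end Separated

section Separated

variable {G : Type*} [SeminormedAddCommGroup G] {S : Set G} {w : ℝ}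

lemma SumSep.insert_pair [DecidableEq (G × G)] {R : Finset (G × G)} (hR : SumSep w R) {p : G × G}
    (hp : ∀ q ∈ R, w < ‖(p.1 + p.2) - (q.1 + q.2)‖) : SumSep w (insert p R) := by
  intro x hx y hy h
  rcases Finset.mem_insert.1 hx with hx' | hx' <;> rcases Finset.mem_insert.1 hy with hy' | hy'
  · rw [hx', hy']
  · rw [hx'] at h
    exact absurd h (not_le.2 (hp y hy'))
  · rw [norm_sub_rev, hy'] at h
    exact absurd h (not_le.2 (hp x hx'))
  · exact hR x hx' y hy' h

lemma ScaleGap.near_trans (hS : ScaleGap S w) {X : Finset G} (hXS : ↑X ⊆ S)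
    {p q r : G × G} (hp : p ∈ X ×ˢ X) (hq : q ∈ X ×ˢ X) {s t : ℝ} (hst : s + t ≤ 100 * w)
    (h1 : ‖(p.1 + p.2) - (r.1 + r.2)‖ ≤ s) (h2 : ‖(r.1 + r.2) - (q.1 + q.2)‖ ≤ t) :
    ‖(p.1 + p.2) - (q.1 + q.2)‖ ≤ w := by
  have hp' := Finset.mem_product.1 hp
  have hq' := Finset.mem_product.1 hq
  refine hS p.1 (hXS hp'.1) p.2 (hXS hp'.2) p.1 (hXS hp'.1) p.1 (hXS hp'.1) q.1 (hXS hq'.1) q.2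
    (hXS hq'.2) p.1 (hXS hp'.1) p.1 (hXS hp'.1) _ (by abel) ?_
  exact (norm_le_add (by abel) h1 h2).trans hst

lemma SumSep.exists_maximal (hS : ScaleGap S w) (hw : 0 ≤ w) {X : Finset G} (hXS : ↑X ⊆ S)
    {R : Finset (G × G)} (hRX : R ⊆ X ×ˢ X) (hR : SumSep w R) :
    ∃ R', R ⊆ R' ∧ R' ⊆ X ×ˢ X ∧ SumSep w R' ∧
      ∀ R₀ ⊆ X ×ˢ X, SumSep w R₀ → R₀.card ≤ R'.card := by
  classical
  have hne : ((X ×ˢ X).powerset.filter fun T => R ⊆ T ∧ SumSep w T).Nonempty :=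
    ⟨R, by simp [hRX, hR]⟩
  obtain ⟨M, hM, hmax⟩ := Finset.exists_max_image _ Finset.card hne
  simp only [Finset.mem_filter, Finset.mem_powerset] at hM hmax
  refine ⟨M, hM.2.1, hM.1, hM.2.2, fun R₀ h0 h0s => ?_⟩
  have hnear : ∀ p ∈ R₀, ∃ q ∈ M, ‖(p.1 + p.2) - (q.1 + q.2)‖ ≤ w := by
    intro p hp
    by_contra! hc
    have h1 := hmax (insert p M) ⟨Finset.insert_subset (h0 hp) hM.1,
      hM.2.1.trans (Finset.subset_insert _ _), hM.2.2.insert_pair hc⟩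
    rw [Finset.card_insert_of_notMem] at h1
    · omega
    · intro hpM
      have := hc p hpM
      simp only [sub_self, norm_zero] at this
      linarith
  choose! q hq hpq using hnear
  refine Finset.card_le_card_of_injOn q (fun p hp => hq p hp) ?_
  intro p hp p' hp' h
  refine h0s p hp p' hp' ?_
  have h2 := hpq p' hp'
  rw [norm_sub_rev, ← h] at h2
  exact hS.near_trans hXS (h0 hp) (h0 hp') (by linarith) (hpq p hp) h2

/-- Weighted small sumset implies small sumset. -/
lemma card_sumSep_lt (hw : 0 ≤ w) (hS : ScaleGap S w) (n : ℕ) : ∀ X : Finset G, X.card = n →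
    ↑X ⊆ S → NormSep w X → ∀ a : G → ℝ, (∀ x ∈ X, 0 ≤ a x) →
    (∀ R : Finset (G × G), R ⊆ X ×ˢ X → SumSep w R →
      ∑ p ∈ R, (a p.1 + a p.2) < 3 * ∑ x ∈ X, a x) →
    ∀ R : Finset (G × G), R ⊆ X ×ˢ X → SumSep w R → 2 * R.card < 3 * X.card := by
  classical
  induction n using Nat.strong_induction_on with
  | _ n ih =>
  intro X hXn hXS hX a ha hyp R₀ hR₀ hR₀s
  by_contra! hcon
  have hX0 : X.Nonempty := by
    by_contra h
    rw [Finset.not_nonempty_iff_eq_empty] at h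
    have := hyp ∅ (by simp) (by intro p hp; simp at hp)
    simp [h] at this
  obtain ⟨z₀, hz₀, hmin⟩ := Finset.exists_min_image X a hX0
  set c := a z₀ with hc
  have hc0 : 0 ≤ c := ha z₀ hz₀
  set X' := X.filter fun x => c < a x with hX'
  have hX'X : X' ⊆ X := Finset.filter_subset _ _
  have hsumX : ∑ x ∈ X', (a x - c) = ∑ x ∈ X, (a x - c) := by
    refine Finset.sum_filter_of_ne fun x hx h => ?_
    exact lt_of_le_of_ne (hmin x hx) fun h' => h (by rw [← h']; ring)
  have hlt : ∀ R : Finset (G × G), R ⊆ X ×ˢ X → SumSep w R →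
      ∑ p ∈ R, ((a p.1 - c) + (a p.2 - c)) < 3 * ∑ x ∈ X', (a x - c) := by
    intro R hR hRs
    obtain ⟨R', hRR', hR'X, hR's, hR'max⟩ := hRs.exists_maximal hS hw hXS hR
    have h1 := hyp R' hR'X hR's
    have h2 : ∑ p ∈ R, ((a p.1 - c) + (a p.2 - c)) ≤ ∑ p ∈ R', ((a p.1 - c) + (a p.2 - c)) := by
      refine Finset.sum_le_sum_of_subset_of_nonneg hRR' fun p hp _ => ?_
      have hp' := Finset.mem_product.1 (hR'X hp)
      have := hmin p.1 hp'.1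
      have := hmin p.2 hp'.2
      linarith
    have h3 : ∑ p ∈ R', ((a p.1 - c) + (a p.2 - c)) = ∑ p ∈ R', (a p.1 + a p.2) -
        2 * c * R'.card := by
      rw [eq_sub_iff_add_eq, mul_comm _ (R'.card : ℝ), ← nsmul_eq_mul, ← Finset.sum_const,
        ← Finset.sum_add_distrib]
      exact Finset.sum_congr rfl fun _ _ => by ring
    rw [hsumX, Finset.sum_sub_distrib, Finset.sum_const, nsmul_eq_mul]
    have h4 : (3 : ℝ) * X.card ≤ 2 * R'.card := by
      have := hR'max R₀ hR₀ hR₀s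
      exact_mod_cast hcon.trans (by omega)
    nlinarith
  have hX'n : X'.card < n := by
    rw [← hXn]
    refine Finset.card_lt_card (Finset.filter_ssubset.2 ⟨z₀, hz₀, by simp [hc]⟩)
  have hX's : ↑X' ⊆ S := fun x hx => hXS (hX'X hx)
  have hX'sep : NormSep w X' := fun x hx y hy => hX x (hX'X hx) y (hX'X hy)
  have hprod : X' ×ˢ X' ⊆ X ×ˢ X := Finset.product_subset_product hX'X hX'X
  have key := ih X'.card hX'n X' rfl hX's hX'sep (fun x => a x - c)
    (fun x hx => by linarith [(Finset.mem_filter.1 hx).2])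
    (fun R hR hRs => hlt R (hR.trans hprod) hRs)
  have hX'0 : X'.Nonempty := by
    by_contra h
    rw [Finset.not_nonempty_iff_eq_empty] at h
    have := hlt ∅ (by simp) (by intro p hp; simp at hp)
    simp [h] at this
  by_cases hz : ∃ z ∈ X, ∀ x ∈ X', ∀ x₁ ∈ X', ∀ x₂ ∈ X', w < ‖(z + x) - (x₁ + x₂)‖
  · obtain ⟨z, hz, hzn⟩ := hz
    obtain ⟨m, hm, hmax⟩ := Finset.exists_max_image X' a hX'0
    have h1 := hlt (X'.image (fun x => (m, x)) ∪ X'.image (fun x => (z, x))) (by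
      intro p hp
      rcases Finset.mem_union.1 hp with hp | hp <;> obtain ⟨u, hu, rfl⟩ := Finset.mem_image.1 hp
      · exact Finset.mk_mem_product (hX'X hm) (hX'X hu)
      · exact Finset.mk_mem_product hz (hX'X hu)) (by
      intro p hp q hq h
      rcases Finset.mem_union.1 hp with hp | hp <;> obtain ⟨u, hu, rfl⟩ := Finset.mem_image.1 hp <;>
      rcases Finset.mem_union.1 hq with hq | hq <;> obtain ⟨u', hu', rfl⟩ := Finset.mem_image.1 hq
      · rw [hX'sep u hu u' hu' (by simpa using h)]
      · rw [norm_sub_rev] at h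
        exact absurd h (not_le.2 (hzn u' hu' m hm u hu))
      · exact absurd h (not_le.2 (hzn u hu m hm u' hu'))
      · rw [hX'sep u hu u' hu' (by simpa using h)])
    rw [Finset.sum_union, Finset.sum_image, Finset.sum_image] at h1
    · simp only [Finset.sum_add_distrib] at h1
      have h2 : ∑ x ∈ X', (a x - c) ≤ ∑ x ∈ X', (a m - c) :=
        Finset.sum_le_sum fun x hx => by linarith [hmax x hx]
      have h3 : 0 ≤ ∑ x ∈ X', (a z - c) :=
        Finset.sum_nonneg fun x hx => by linarith [hmin z hz]
      linarith
    · exact fun x _ y _ h => (Prod.mk.inj h).2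
    · exact fun x _ y _ h => (Prod.mk.inj h).2
    · rw [Finset.disjoint_left]
      intro p hp hq
      obtain ⟨u, hu, rfl⟩ := Finset.mem_image.1 hp
      obtain ⟨u', hu', h⟩ := Finset.mem_image.1 hq
      obtain ⟨h1, h2⟩ := Prod.mk.inj h
      have := hzn u' hu' m hm u' hu'
      rw [h1] at this
      simp only [sub_self, norm_zero] at this
      linarith
  · push Not at hz
    have hpair : ∀ p ∈ R₀, ∃ y ∈ X', ∃ y' ∈ X', ‖(p.1 + p.2) - (y + y')‖ ≤ 4 * w := by
      intro p hp
      have hp' := Finset.mem_product.1 (hR₀ hp)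
      obtain ⟨x, hx, x₁, hx₁, x₂, hx₂, h1⟩ := hz p.1 hp'.1
      obtain ⟨x', hx', x₁', hx₁', x₂', hx₂', h2⟩ := hz p.2 hp'.2
      obtain ⟨u, hu, v, hv, h3⟩ := exists_diff_near_add hw hS hX's hX'sep key hx₂ hx hx₂' hx'
      obtain ⟨y, hy, y', hy', h4⟩ := exists_sum_near hw hS hX's hX'sep key hx₁ hx₁' hu hv
      refine ⟨y, hy, y', hy', ?_⟩
      have h5 := norm_le_add (a := (p.1 + p.2) - (x₁ + x₁' + (x₂ - x) + (x₂' - x'))) (by abel) h1 h2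
      have h6 := norm_le_add (a := (p.1 + p.2) - (x₁ + x₁' + (u - v))) (by abel) h5 h3
      have h7 := norm_le_add (a := (p.1 + p.2) - (y + y')) (by abel) h6 h4
      linarith
    choose! y hy y' hy' hyy using hpair
    have hinj : ∀ p ∈ R₀, ∀ q ∈ R₀, ‖(y p + y' p) - (y q + y' q)‖ ≤ w → p = q := by
      intro p hp q hq h
      refine hR₀s p hp q hq ?_
      have h2 := hyy q hq
      rw [norm_sub_rev] at h2
      have h3 := norm_le_add (a := (y p + y' p) - (q.1 + q.2)) (by abel) h h2
      exact hS.near_trans hXS (r := (y p, y' p)) (hR₀ hp) (hR₀ hq) (by linarith) (hyy p hp) h3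
    have h1 := key (R₀.image fun p => (y p, y' p)) (by
      intro q hq
      obtain ⟨p, hp, rfl⟩ := Finset.mem_image.1 hq
      exact Finset.mk_mem_product (hy p hp) (hy' p hp)) (by
      intro q hq q' hq' h
      obtain ⟨p, hp, rfl⟩ := Finset.mem_image.1 hq
      obtain ⟨p', hp', rfl⟩ := Finset.mem_image.1 hq'
      rw [hinj p hp p' hp' h])
    rw [Finset.card_image_of_injOn] at h1
    · have := Finset.card_le_card hX'X
      omega
    · intro p hp q hq h
      obtain ⟨h2, h3⟩ := Prod.mk.inj h
      exact hinj p hp q hq (by rw [h2, h3]; simpa using hw)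

end Separated

section Separated

variable {G : Type*} [SeminormedAddCommGroup G] {S : Set G} {w : ℝ} {X : Finset G}

lemma exists_almost_torsion (hw : 0 ≤ w) (hS : ScaleGap S w) (hXS : ↑X ⊆ S) (hX : NormSep w X)
    (hX0 : X.Nonempty)
    (hR : ∀ R : Finset (G × G), R ⊆ X ×ˢ X → SumSep w R → 2 * R.card < 3 * X.card) :
    ∃ R : Finset (G × G), R ⊆ X ×ˢ X ∧ DiffSep w R ∧ 0 < R.card ∧ 2 * R.card < 3 * X.card ∧
      ∀ x ∈ X, ∀ y ∈ X, ‖R.card • (x - y)‖ ≤ R.card * w := by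
  classical
  obtain ⟨x₀, hx₀⟩ := hX0
  have hne : ((X ×ˢ X).powerset.filter fun T => DiffSep w T).Nonempty :=
    ⟨∅, Finset.mem_filter.2 ⟨by simp, fun p hp => by simp at hp⟩⟩
  obtain ⟨M, hM, hmax⟩ := Finset.exists_max_image _ Finset.card hne
  simp only [Finset.mem_filter, Finset.mem_powerset] at hM hmax
  obtain ⟨hMX, hMs⟩ := hM
  have hnear : ∀ p ∈ X ×ˢ X, ∃ q ∈ M, ‖(p.1 - p.2) - (q.1 - q.2)‖ ≤ w := by
    intro p hp
    by_contra! hc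
    have h1 := hmax (insert p M) ⟨Finset.insert_subset hp hMX, by
      intro x hx y hy h
      rcases Finset.mem_insert.1 hx with hx' | hx' <;> rcases Finset.mem_insert.1 hy with hy' | hy'
      · rw [hx', hy']
      · rw [hx'] at h
        exact absurd h (not_le.2 (hc y hy'))
      · rw [norm_sub_rev, hy'] at h
        exact absurd h (not_le.2 (hc x hx'))
      · exact hMs x hx' y hy' h⟩
    rw [Finset.card_insert_of_notMem] at h1
    · omega
    · intro hpM
      have := hc p hpM
      simp only [sub_self, norm_zero] at this
      linarith
  refine ⟨M, hMX, hMs, ?_, ?_, ?_⟩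
  · obtain ⟨q, hq, -⟩ := hnear (x₀, x₀) (Finset.mk_mem_product hx₀ hx₀)
    exact Finset.card_pos.2 ⟨q, hq⟩
  · have hsum : ∀ p ∈ M, ∃ y ∈ X, ∃ y' ∈ X, ‖x₀ + x₀ + (p.1 - p.2) - (y + y')‖ ≤ w :=
      fun p hp => by
        have hp' := Finset.mem_product.1 (hMX hp)
        exact exists_sum_near hw hS hXS hX hR hx₀ hx₀ hp'.1 hp'.2
    choose! y hy y' hy' hyy using hsum
    have hinj : ∀ p ∈ M, ∀ q ∈ M, ‖(y p + y' p) - (y q + y' q)‖ ≤ w → p = q := by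
      intro p hp q hq h
      refine hMs p hp q hq ?_
      have hp' := Finset.mem_product.1 (hMX hp)
      have hq' := Finset.mem_product.1 (hMX hq)
      refine hS p.1 (hXS hp'.1) q.2 (hXS hq'.2) x₀ (hXS hx₀) x₀ (hXS hx₀) p.2 (hXS hp'.2) q.1
        (hXS hq'.1) x₀ (hXS hx₀) x₀ (hXS hx₀) _ (by abel) ?_
      have h1 := hyy p hp
      have h2 := hyy q hq
      rw [norm_sub_rev] at h2
      have h3 := norm_le_add (a := x₀ + x₀ + (p.1 - p.2) - (y q + y' q)) (by abel) h1 h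
      have h4 := norm_le_add (a := (p.1 - p.2) - (q.1 - q.2)) (by abel) h3 h2
      linarith
    have h1 := hR (M.image fun p => (y p, y' p)) (by
      intro q hq
      obtain ⟨p, hp, rfl⟩ := Finset.mem_image.1 hq
      exact Finset.mk_mem_product (hy p hp) (hy' p hp)) (by
      intro q hq q' hq' h
      obtain ⟨p, hp, rfl⟩ := Finset.mem_image.1 hq
      obtain ⟨p', hp', rfl⟩ := Finset.mem_image.1 hq'
      rw [hinj p hp p' hp' h])
    rwa [Finset.card_image_of_injOn] at h1
    intro p hp q hq h
    obtain ⟨h2, h3⟩ := Prod.mk.inj h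
    exact hinj p hp q hq (by rw [h2, h3]; simpa using hw)
  · intro x hx y hy
    have hσ : ∀ p ∈ M, ∃ q ∈ M, ‖(p.1 - p.2) + (x - y) - (q.1 - q.2)‖ ≤ w := by
      intro p hp
      have hp' := Finset.mem_product.1 (hMX hp)
      obtain ⟨u, hu, v, hv, h1⟩ := exists_diff_near_add hw hS hXS hX hR hp'.1 hp'.2 hx hy
      obtain ⟨q, hq, h2⟩ := hnear (u, v) (Finset.mk_mem_product hu hv)
      refine ⟨q, hq, ?_⟩
      have hq' := Finset.mem_product.1 (hMX hq)
      refine hS p.1 (hXS hp'.1) q.2 (hXS hq'.2) x (hXS hx) x₀ (hXS hx₀) p.2 (hXS hp'.2) q.1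
        (hXS hq'.1) y (hXS hy) x₀ (hXS hx₀) _ (by abel) ?_
      have h3 := norm_le_add (a := (p.1 - p.2) + (x - y) - (q.1 - q.2)) (by abel) h1 h2
      linarith
    choose! σ hσM hσ using hσ
    have hinj : Set.InjOn σ M := by
      intro p hp q hq h
      refine hMs p hp q hq ?_
      have hp' := Finset.mem_product.1 (hMX hp)
      have hq' := Finset.mem_product.1 (hMX hq)
      refine hS p.1 (hXS hp'.1) q.2 (hXS hq'.2) x₀ (hXS hx₀) x₀ (hXS hx₀) p.2 (hXS hp'.2) q.1
        (hXS hq'.1) x₀ (hXS hx₀) x₀ (hXS hx₀) _ (by abel) ?_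
      have h1 := hσ p hp
      have h2 := hσ q hq
      rw [norm_sub_rev, ← h] at h2
      have h3 := norm_le_add (a := (p.1 - p.2) - (q.1 - q.2)) (by abel) h1 h2
      linarith
    have hsurj : Set.SurjOn σ M M := Finset.surjOn_of_injOn_of_card_le σ hσM hinj le_rfl
    have hsum : ∑ p ∈ M, ((σ p).1 - (σ p).2) = ∑ p ∈ M, (p.1 - p.2) :=
      Finset.sum_nbij σ hσM hinj hsurj fun _ _ => rfl
    have h1 : M.card • (x - y) = ∑ p ∈ M, ((p.1 - p.2) + (x - y) - ((σ p).1 - (σ p).2)) := by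
      rw [Finset.sum_sub_distrib, Finset.sum_add_distrib, hsum, Finset.sum_const]
      abel
    rw [h1, ← nsmul_eq_mul]
    exact norm_sum_le_of_le _ hσ |>.trans (by rw [Finset.sum_const])

end Separated

lemma AddCircle.norm_coe_le_abs {D : ℝ} (x : ℝ) : ‖(x : AddCircle D)‖ ≤ |x| := by
  exact QuotientAddGroup.norm_mk_le_norm (S := AddSubgroup.zmultiples D) (m := x)

lemma AddCircle.exists_near_grid {D : ℝ} {n : ℕ} (hn : 0 < n) {w : ℝ} {d : AddCircle D}
    (h : ‖n • d‖ ≤ n * w) : ∃ i : ℤ, ‖d - ((i * (D / n) : ℝ) : AddCircle D)‖ ≤ w := by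
  obtain ⟨t, rfl⟩ := QuotientAddGroup.mk_surjective d
  have hn' : (0 : ℝ) < n := by exact_mod_cast hn
  have e : n • ((t : ℝ) : AddCircle D) = ((n * t : ℝ) : AddCircle D) := by
    rw [← AddCircle.coe_nsmul, nsmul_eq_mul]
  change ‖n • (t : AddCircle D)‖ ≤ _ at h
  rw [e, AddCircle.norm_eq] at h
  refine ⟨round (D⁻¹ * (n * t)), ?_⟩
  change ‖(t : AddCircle D) - _‖ ≤ w
  rw [← AddCircle.coe_sub]
  refine (AddCircle.norm_coe_le_abs _).trans ?_
  have e2 : t - (round (D⁻¹ * (n * t))) * (D / n) = (n * t - (round (D⁻¹ * (n * t))) * D) / n := by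
    field_simp
  rw [e2, abs_div, abs_of_pos hn', div_le_iff₀ hn']
  linarith

lemma AddCircle.coe_grid_eq {D : ℝ} {n : ℕ} (hn : n ≠ 0) (a b : ℤ) (hab : (a : ZMod n) = b) :
    ((a * (D / n) : ℝ) : AddCircle D) = ((b * (D / n) : ℝ) : AddCircle D) := by
  rw [ZMod.intCast_eq_intCast_iff_dvd_sub] at hab
  obtain ⟨k, hk⟩ := hab
  have : (b : ℝ) = a + n * k := by
    have : b = a + n * k := by linarith
    exact_mod_cast this
  rw [this]
  have e : ((a + n * k : ℝ)) * (D / n) = a * (D / n) + k • D := by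
    have : (n : ℝ) ≠ 0 := by positivity
    rw [zsmul_eq_mul]; field_simp
  rw [e, AddCircle.coe_add, AddCircle.coe_zsmul, AddCircle.coe_period, smul_zero, add_zero]

/-- A subset of the circle with a scale gap and few sums lies near a finite subgroup. -/
lemma exists_grid {D : ℝ} [hD : Fact (0 < D)] {S : Set (AddCircle D)} {w : ℝ} (hw : 0 < w)
    (hwD : 100 * w ≤ D) (hS : ScaleGap S w) {X : Finset (AddCircle D)} (hXS : ↑X ⊆ S)
    (hX : NormSep w X) (hX0 : X.Nonempty)
    (hR : ∀ R : Finset (AddCircle D × AddCircle D), R ⊆ X ×ˢ X → SumSep w R →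
      2 * R.card < 3 * X.card) :
    ∃ n : ℕ, 0 < n ∧ 2 * n < 3 * X.card ∧ 98 * w ≤ D / n ∧
      ∀ x ∈ X, ∀ y ∈ X, ∃ i : ℤ, ‖(x - y) - ((i * (D / n) : ℝ) : AddCircle D)‖ ≤ w := by
  classical
  obtain ⟨R, hRX, hRs, hn, hnX, htor⟩ := exists_almost_torsion hw.le hS hXS hX hX0 hR
  have hgrid : ∀ x ∈ X, ∀ y ∈ X, ∃ i : ℤ, ‖(x - y) - ((i * (D / R.card) : ℝ) : AddCircle D)‖ ≤ w :=
    fun x hx y hy => AddCircle.exists_near_grid hn (htor x hx y hy)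
  refine ⟨R.card, hn, hnX, ?_, hgrid⟩
  obtain ⟨x₀, hx₀⟩ := hX0
  set n := R.card with hnd
  have hn' : (0 : ℝ) < n := by exact_mod_cast hn
  rcases Nat.lt_or_ge 1 n with h1 | h1
  swap
  · have : n = 1 := by omega
    rw [this]; simp only [Nat.cast_one, div_one]; linarith
  have hsmall : ∀ p ∈ R, ∀ q ∈ R, ‖(p.1 - p.2) - (q.1 - q.2)‖ ≤ 100 * w → p = q := by
    intro p hp q hq h
    have hp' := Finset.mem_product.1 (hRX hp)
    have hq' := Finset.mem_product.1 (hRX hq)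
    exact hRs p hp q hq (hS p.1 (hXS hp'.1) q.2 (hXS hq'.2) x₀ (hXS hx₀) x₀ (hXS hx₀) p.2
      (hXS hp'.2) q.1 (hXS hq'.1) x₀ (hXS hx₀) x₀ (hXS hx₀) _ (by abel) h)
  have hg : ∀ p ∈ R, ∃ i : ℤ, ‖(p.1 - p.2) - ((i * (D / n) : ℝ) : AddCircle D)‖ ≤ w := fun p hp =>
    hgrid _ (Finset.mem_product.1 (hRX hp)).1 _ (Finset.mem_product.1 (hRX hp)).2
  choose! i hi using hg
  have hper := AddCircle.coe_grid_eq (D := D) (n := n) (by omega)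
  have : NeZero n := ⟨by omega⟩
  have hinj : Set.InjOn (fun p => (i p : ZMod n)) R := by
    intro p hp q hq h
    refine hsmall p hp q hq ?_
    have h2 := hi q hq
    rw [norm_sub_rev, ← hper _ _ h] at h2
    have := norm_le_add (a := (p.1 - p.2) - (q.1 - q.2)) (by abel) (hi p hp) h2
    linarith
  have hsurj : ∀ s : ZMod n, ∃ p ∈ R, (i p : ZMod n) = s := by
    have h2 : R.image (fun p => (i p : ZMod n)) = Finset.univ := by
      apply Finset.eq_univ_of_card
      rw [Finset.card_image_of_injOn hinj, ZMod.card]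
    intro s
    exact Finset.mem_image.1 (h2 ▸ Finset.mem_univ s)
  obtain ⟨p, hp, hp0⟩ := hsurj ((0 : ℤ) : ZMod n)
  obtain ⟨q, hq, hq1⟩ := hsurj ((1 : ℤ) : ZMod n)
  have hpq : p ≠ q := by
    rintro rfl
    rw [hp0] at hq1
    have : Fact (1 < n) := ⟨h1⟩
    simp at hq1
  by_contra! hcon
  refine hpq (hsmall p hp q hq ?_)
  have h2 := hi p hp
  have h3 := hi q hq
  rw [hper _ _ hp0] at h2
  rw [hper _ _ hq1] at h3
  simp only [Int.cast_zero, zero_mul, Int.cast_one, one_mul] at h2 h3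
  have h4 : ‖((D / n : ℝ) : AddCircle D)‖ ≤ D / n := by
    refine (AddCircle.norm_coe_le_abs _).trans (abs_of_nonneg ?_).le
    have := hD.out
    positivity
  rw [← norm_neg] at h4
  rw [norm_sub_rev] at h3
  rw [AddCircle.coe_zero, sub_zero] at h2
  have h5 := norm_le_add (a := (p.1 - p.2) - ((D / n : ℝ) : AddCircle D)) (by abel) h2 h4
  have h6 := norm_le_add (a := (p.1 - p.2) - (q.1 - q.2)) (by abel) h5 h3
  linarith

lemma int_mul_mem_nsmul_sub {B : Set ℝ} {D : ℝ} (h0 : 0 ∈ B) (hD : D ∈ B) (m : ℕ) :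
    ∀ j : ℤ, |j| ≤ m → (j * D : ℝ) ∈ m • (B - B) := by
  induction m with
  | zero =>
    intro j hj
    have : j = 0 := by simpa using hj
    simp [this]
  | succ m ih =>
    intro j hj
    rw [succ_nsmul]
    rcases lt_trichotomy j 0 with h | h | h
    · refine ⟨_, ih (j + 1) (by rw [abs_le] at *; push_cast at *; omega), 0 - D,
        sub_mem_sub h0 hD, ?_⟩
      push_cast; ring
    · exact ⟨_, ih 0 (by simp), 0 - 0, sub_mem_sub h0 h0, by simp [h]⟩
    · refine ⟨_, ih (j - 1) (by rw [abs_le] at *; push_cast at *; omega), D - 0,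
        sub_mem_sub hD h0, ?_⟩
      push_cast; ring

lemma scaleGap_coe {B : Set ℝ} {D w : ℝ} [hD : Fact (0 < D)] (h0 : 0 ∈ B) (hDB : D ∈ B)
    (hB : B ⊆ Icc 0 D) (h : ∀ e ∈ 8 • (B - B), |e| ≤ 100 * w → |e| ≤ w) :
    ScaleGap ((↑) '' B : Set (AddCircle D)) w := by
  rintro _ ⟨x₁, hx₁, rfl⟩ _ ⟨x₂, hx₂, rfl⟩ _ ⟨x₃, hx₃, rfl⟩ _ ⟨x₄, hx₄, rfl⟩ _ ⟨y₁, hy₁, rfl⟩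
    _ ⟨y₂, hy₂, rfl⟩ _ ⟨y₃, hy₃, rfl⟩ _ ⟨y₄, hy₄, rfl⟩ e he hn
  have hD0 := hD.out
  have he' : e = ((x₁ + x₂ + x₃ + x₄ - y₁ - y₂ - y₃ - y₄ : ℝ) : AddCircle D) := by
    rw [he]; rfl
  have hhalf := AddCircle.norm_le_half_period D (x := e) hD0.ne'
  rw [he', AddCircle.norm_eq] at hn ⊢
  rw [he', AddCircle.norm_eq, abs_of_pos hD0] at hhalf
  set k := round (D⁻¹ * (x₁ + x₂ + x₃ + x₄ - y₁ - y₂ - y₃ - y₄)) with hk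
  refine h _ ?_ hn
  have hkb : |(-k)| ≤ ((4 : ℕ) : ℤ) := by
    rw [abs_neg]
    have h1 : |(k : ℝ)| * D < 5 * D := by
      rw [← abs_of_pos hD0, ← abs_mul, abs_of_pos hD0]
      have := hB hx₁; have := hB hx₂; have := hB hx₃; have := hB hx₄
      have := hB hy₁; have := hB hy₂; have := hB hy₃; have := hB hy₄
      simp only [mem_Icc] at *
      rw [abs_le] at hhalf
      rw [abs_lt]
      constructor <;> linarith
    have h2 := lt_of_mul_lt_mul_right h1 hD0.le
    have h3 : |k| < 5 := by exact_mod_cast h2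
    push_cast; omega
  have h1 := int_mul_mem_nsmul_sub h0 hDB 4 (-k) hkb
  have h2 : (x₁ - y₁) + (x₂ - y₂) + (x₃ - y₃) + (x₄ - y₄) ∈ 4 • (B - B) := by
    rw [show (4 : ℕ) = 0 + 1 + 1 + 1 + 1 by rfl, succ_nsmul, succ_nsmul, succ_nsmul, succ_nsmul,
      zero_nsmul, zero_add]
    exact add_mem_add (add_mem_add (add_mem_add (sub_mem_sub hx₁ hy₁) (sub_mem_sub hx₂ hy₂))
      (sub_mem_sub hx₃ hy₃)) (sub_mem_sub hx₄ hy₄)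
  have h3 := add_mem_add h2 h1
  rw [← add_nsmul] at h3
  convert h3 using 1
  push_cast; ring

lemma AddCircle.exists_real_near {D : ℝ} {n : ℕ} (hn : 0 < n) {r b : ℝ} {i : ℤ}
    (h : ‖(b : AddCircle D) - ((i * (D / n) : ℝ) : AddCircle D)‖ ≤ r) :
    ∃ j : ℤ, (j : ZMod n) = i ∧ |b - j * (D / n)| ≤ r := by
  rw [← AddCircle.coe_sub, AddCircle.norm_eq] at h
  set k := round (D⁻¹ * (b - i * (D / n)))
  refine ⟨i + n * k, by simp, ?_⟩
  convert h using 2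
  have : (n : ℝ) ≠ 0 := by positivity
  push_cast; field_simp; ring

lemma NormSep.exists_cover {G : Type*} [SeminormedAddCommGroup G] {S : Set G} {w : ℝ} (hw : 0 < w)
    (hS : ScaleGap S w) (htot : TotallyBounded S) :
    ∃ X : Finset G, ↑X ⊆ S ∧ NormSep w X ∧ ∀ b ∈ S, ∃ x ∈ X, ‖b - x‖ ≤ w := by
  classical
  obtain ⟨t, htS, htf, hcov⟩ := totallyBounded_iff_subset.1 htot _
    (Metric.dist_mem_uniformity hw)
  lift t to Finset G using htf
  have hne : (t.powerset.filter fun X => NormSep w X).Nonempty :=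
    ⟨∅, Finset.mem_filter.2 ⟨by simp, fun p hp => by simp at hp⟩⟩
  obtain ⟨X, hX, hmax⟩ := Finset.exists_max_image _ Finset.card hne
  simp only [Finset.mem_filter, Finset.mem_powerset] at hX hmax
  have hXS : ↑X ⊆ S := fun x hx => htS (hX.1 hx)
  refine ⟨X, hXS, hX.2, fun b hb => ?_⟩
  have hnear : ∀ y ∈ t, ∃ x ∈ X, ‖y - x‖ ≤ w := by
    intro p hp
    by_contra! hc
    have h1 := hmax (insert p X) ⟨Finset.insert_subset hp hX.1, by
      intro x hx y hy h
      rcases Finset.mem_insert.1 hx with hx' | hx' <;> rcases Finset.mem_insert.1 hy with hy' | hy'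
      · rw [hx', hy']
      · rw [hx'] at h
        exact absurd h (not_le.2 (hc y hy'))
      · rw [norm_sub_rev, hy'] at h
        exact absurd h (not_le.2 (hc x hx'))
      · exact hX.2 x hx' y hy' h⟩
    rw [Finset.card_insert_of_notMem] at h1
    · omega
    · intro hpM
      have := hc p hpM
      simp only [sub_self, norm_zero] at this
      linarith
  obtain ⟨y, hy, hby⟩ := mem_iUnion₂.1 (hcov hb)
  obtain ⟨x, hx, hyx⟩ := hnear y hy
  refine ⟨x, hx, hS b hb b hb b hb b hb x (hXS hx) b hb b hb b hb _ (by abel) ?_⟩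
  have h1 : ‖b - y‖ ≤ w := by
    rw [← dist_eq_norm]; exact (show dist b y < w from hby).le
  have := norm_le_add (a := b - x) (by abel) h1 hyx
  linarith

lemma card_sumSep_lt_of_volume {D : ℝ} [hD : Fact (0 < D)] {S : Set (AddCircle D)} {w : ℝ}
    (hw : 0 < w) (hS : ScaleGap S w) (hSm : MeasurableSet S)
    (hdbl : volume.real (S + S) < 3 * volume.real S) (hsmall : 2 * volume.real S ≤ D)
    {X : Finset (AddCircle D)} (hXS : ↑X ⊆ S) (hX : NormSep w X)
    (hcov : ∀ b ∈ S, ∃ x ∈ X, ‖b - x‖ ≤ w) :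
    ∀ R : Finset (AddCircle D × AddCircle D), R ⊆ X ×ˢ X → SumSep w R →
      2 * R.card < 3 * X.card := by
  set c : AddCircle D → Set (AddCircle D) := fun x => S ∩ Metric.closedBall x w with hc
  have hcm : ∀ x, MeasurableSet (c x) := fun x => hSm.inter Metric.isClosed_closedBall.measurableSet
  refine card_sumSep_lt hw.le hS X.card X rfl hXS hX (fun x => volume.real (c x))
    (fun x _ => measureReal_nonneg) fun R hRX hRs => ?_
  have hsum : volume.real S ≤ ∑ x ∈ X, volume.real (c x) := by
    refine (measureReal_mono ?_ (measure_ne_top _ _)).trans (measureReal_biUnion_finset_le X c)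
    intro b hb
    obtain ⟨x, hx, h⟩ := hcov b hb
    exact mem_iUnion₂.2 ⟨x, hx, hb, by rw [Metric.mem_closedBall, dist_eq_norm]; exact h⟩
  have hle : ∑ p ∈ R, (volume.real (c p.1) + volume.real (c p.2)) ≤ volume.real (S + S) := by
    refine le_trans (Finset.sum_le_sum fun p hp => ?_) (sum_volume_inter_le R (measure_ne_top _ _)
      (P := fun p => Metric.closedBall (p.1 + p.2) (2 * w))
      (fun p _ => Metric.isClosed_closedBall.measurableSet) ?_)
    · have hp' := Finset.mem_product.1 (hRX hp)
      have hne : ∀ x ∈ X, (c x).Nonempty := fun x hx =>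
        ⟨x, hXS hx, Metric.mem_closedBall_self hw.le⟩
      have h1 := raikov (hcm p.1) (hcm p.2) (hne _ hp'.1) (hne _ hp'.2)
      have h2 : volume.real (c p.1) ≤ volume.real S :=
        measureReal_mono inter_subset_left (measure_ne_top _ _)
      have h3 : volume.real (c p.2) ≤ volume.real S :=
        measureReal_mono inter_subset_left (measure_ne_top _ _)
      rw [min_eq_right (by linarith)] at h1
      refine h1.trans (measureReal_mono ?_ (measure_ne_top _ _))
      rintro _ ⟨x, hx, y, hy, rfl⟩
      refine ⟨add_mem_add hx.1 hy.1, ?_⟩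
      have hx2 := hx.2
      have hy2 := hy.2
      rw [Metric.mem_closedBall, dist_eq_norm] at hx2 hy2 ⊢
      have := norm_le_add (a := (x + y) - (p.1 + p.2)) (by abel) hx2 hy2
      linarith
    · intro p hp q hq hpq
      refine Set.disjoint_left.2 fun z hz hz' => hpq (hRs p hp q hq ?_)
      rw [Metric.mem_closedBall, dist_eq_norm] at hz hz'
      rw [norm_sub_rev] at hz
      exact hS.near_trans hXS (r := (z, 0)) (hRX hp) (hRX hq) (by linarith) (s := 2 * w)
        (t := 2 * w) (by simpa using hz) (by simpa using hz')
  linarith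

/-- A set of doubling less than `4` and large diameter lies near an arithmetic progression, most of
whose terms it meets. -/
lemma exists_rows : ∃ C : ℝ, ∀ (B : Set ℝ) (D : ℝ), MeasurableSet B → IsLeast B 0 →
    IsGreatest B D → 0 < volume.real B → volume.real (B + B) < 4 * volume.real B →
    C * volume.real B ≤ D →
    ∃ (n : ℕ) (w : ℝ) (X : Finset (ZMod n)), 0 < n ∧ 0 < w ∧ 98 * w ≤ D / n ∧ 2 * n < 3 * X.card ∧
      (∀ b ∈ B, ∃ i : ℤ, |b - i * (D / n)| ≤ 3 * w) ∧
      ∀ s ∈ X, ∃ b ∈ B, ∃ i : ℤ, (i : ZMod n) = s ∧ |b - i * (D / n)| ≤ 3 * w := by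
  classical
  obtain ⟨C, hC⟩ := exists_scale 8 (K := 100) (by norm_num)
  refine ⟨max C 2, fun B D hB hl hr hpos hdbl hbig => ?_⟩
  have h2B : 2 * volume.real B ≤ D :=
    le_trans (mul_le_mul_of_nonneg_right (le_max_right _ _) hpos.le) hbig
  have hCB : C * volume.real B ≤ D :=
    le_trans (mul_le_mul_of_nonneg_right (le_max_left _ _) hpos.le) hbig
  have hD : Fact (0 < D) := ⟨by linarith⟩
  have hBD : B ⊆ Icc 0 D := fun b hb => ⟨hl.2 hb, hr.2 hb⟩
  obtain ⟨w, hw, hwD, hgap⟩ := hC B D hB hBD hpos hdbl.le hCB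
  set S : Set (AddCircle D) := (↑) '' B with hSdef
  have hS : ScaleGap S w := scaleGap_coe hl.1 hr.1 hBD hgap
  have hvol : volume.real S = volume.real B := by
    rw [measureReal_def, measureReal_def, volume_coe_image_eq (a := 0) (by simpa using hBD)]
  have hBB : B + B ⊆ Icc (0 + 0) (D + D) := (add_subset_add hBD hBD).trans
    (Icc_add_Icc_subset _ _ _ _)
  have hBBfin : volume (B + B) ≠ ⊤ := measure_ne_top_of_subset hBB (by simp)
  have hBfin : volume B ≠ ⊤ := measure_ne_top_of_subset hBD (by simp)
  have hdbl3 : volume.real (S + S) < 3 * volume.real S := by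
    have h1 := volume_add_volume_circle_le hB hl hr (by ring)
    have h2 := ENNReal.toReal_mono hBBfin h1
    rw [ENNReal.toReal_add hBfin (measure_ne_top _ _)] at h2
    change volume.real B + volume.real (S + S) ≤ volume.real (B + B) at h2
    rw [hvol]
    linarith
  have hSm : MeasurableSet S := measurableSet_coe_image hB
  obtain ⟨X, hXS, hX, hcov⟩ := NormSep.exists_cover hw hS
    (isCompact_univ.totallyBounded.subset (subset_univ S))
  have hfew := card_sumSep_lt_of_volume hw hS hSm hdbl3 (by rw [hvol]; exact h2B) hXS hX hcov
  have h0S : (0 : AddCircle D) ∈ S := ⟨0, hl.1, by simp⟩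
  obtain ⟨x₀, hx₀, h0x⟩ := hcov 0 h0S
  obtain ⟨n, hn, hnX, hwn, hgrid⟩ := exists_grid hw hwD hS hXS hX ⟨x₀, hx₀⟩ hfew
  have hi : ∀ x ∈ X, ∃ i : ℤ, ‖(x - x₀) - ((i * (D / n) : ℝ) : AddCircle D)‖ ≤ w :=
    fun x hx => hgrid x hx x₀ hx₀
  choose! i hi using hi
  rw [norm_sub_rev] at h0x
  have hi0 : ∀ x ∈ X, ‖x - ((i x * (D / n) : ℝ) : AddCircle D)‖ ≤ 2 * w := by
    intro x hx
    have := norm_le_add (a := x - ((i x * (D / n) : ℝ) : AddCircle D)) (by abel) (hi x hx) h0x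
    linarith
  have hreal : ∀ b ∈ B, ∀ x ∈ X, ‖(b : AddCircle D) - x‖ ≤ w →
      ∃ j : ℤ, (j : ZMod n) = i x ∧ |b - j * (D / n)| ≤ 3 * w := by
    intro b hb x hx hbx
    refine AddCircle.exists_real_near hn ?_
    have := norm_le_add (a := (b : AddCircle D) - ((i x * (D / n) : ℝ) : AddCircle D)) (by abel) hbx
      (hi0 x hx)
    linarith
  refine ⟨n, w, X.image fun x => (i x : ZMod n), hn, hw, hwn, ?_, ?_, ?_⟩
  · rwa [Finset.card_image_of_injOn]
    intro x hx y hy hxy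
    have h2 := hi0 y hy
    rw [norm_sub_rev, ← AddCircle.coe_grid_eq hn.ne' _ _ hxy] at h2
    refine hX x hx y hy (hS x (hXS hx) x (hXS hx) x (hXS hx) x (hXS hx) y (hXS hy) x (hXS hx) x
      (hXS hx) x (hXS hx) _ (by abel) ?_)
    have := norm_le_add (a := x - y) (by abel) (hi0 x hx) h2
    linarith
  · intro b hb
    obtain ⟨x, hx, hbx⟩ := hcov _ ⟨b, hb, rfl⟩
    obtain ⟨j, -, hj⟩ := hreal b hb x hx hbx
    exact ⟨j, hj⟩
  · intro s hs
    obtain ⟨x, hx, rfl⟩ := Finset.mem_image.1 hs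
    obtain ⟨b, hb, rfl⟩ := hXS hx
    obtain ⟨j, hj, hj'⟩ := hreal b hb _ hx (by simpa using hw.le)
    exact ⟨b, hb, j, hj, hj'⟩

lemma Finset.exists_antitone_enum {G : Type*} [Nonempty G] (X : Finset G) (u : G → ℝ) :
    ∃ e : ℕ → G, (∀ i < X.card, e i ∈ X) ∧ Set.InjOn e (Finset.range X.card) ∧
      (∀ i j, i ≤ j → j < X.card → u (e j) ≤ u (e i)) ∧
      ∀ f : G → ℝ, ∑ s ∈ X, f s = ∑ i ∈ Finset.range X.card, f (e i) := by
  classical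
  set τ : Equiv.Perm (Fin X.card) := Tuple.sort fun i => -u (X.equivFin.symm i)
  have hτ := Tuple.monotone_sort fun i => -u (X.equivFin.symm i)
  set g : Fin X.card ≃ X := τ.trans X.equivFin.symm
  have hval : ∀ i (hi : i < X.card), (fun i => if h : i < X.card then (g ⟨i, h⟩ : G) else
      Classical.arbitrary G) i = g ⟨i, hi⟩ := fun i hi => dif_pos hi
  refine ⟨fun i => if h : i < X.card then (g ⟨i, h⟩ : G) else Classical.arbitrary G,
    fun i hi => ?_, fun i hi j hj hij => ?_, fun i j hij hj => ?_, fun f => ?_⟩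
  · rw [hval i hi]; exact (g _).2
  · simp only [Finset.coe_range] at hi hj
    rw [hval i hi, hval j hj] at hij
    exact congrArg Fin.val (g.injective (Subtype.ext hij))
  · rw [hval j hj, hval i (by omega)]
    have := hτ (show (⟨i, by omega⟩ : Fin X.card) ≤ ⟨j, hj⟩ from hij)
    exact neg_le_neg_iff.1 this
  · rw [← Fin.sum_univ_eq_sum_range (fun i => f (if h : i < X.card then (g ⟨i, h⟩ : G) else
      Classical.arbitrary G)), ← Finset.sum_coe_sort, ← g.sum_comp]
    refine Finset.sum_congr rfl fun i _ => ?_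
    simp

/-- A weighted sumset inequality in a finite abelian group for functions supported on at least two
thirds of the group. -/
lemma min_le_sum_of_add_le {G : Type*} [AddCommGroup G] [Fintype G] [DecidableEq G] {X : Finset G}
    (hX : 2 * Fintype.card G ≤ 3 * X.card) {u z : G → ℝ} {W : ℝ} (hu0 : ∀ a ∈ X, 0 ≤ u a)
    (huW : ∀ a ∈ X, u a ≤ W) (hz : ∀ a ∈ X, ∀ b ∈ X, min W (u a + u b) ≤ z (a + b)) :
    min (Fintype.card G * W) (2 * ∑ a ∈ X, u a) ≤ ∑ s, z s := by
  set h := Fintype.card G with hh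
  have hpos : 0 < h := Fintype.card_pos
  have hXh : X.card ≤ h := Finset.card_le_univ X
  obtain ⟨e, heX, hinj, hanti, hsum⟩ := X.exists_antitone_enum u
  set x := X.card with hx
  -- popular sums
  have hpop : ∀ i < x, h - 1 - i < x → ∀ s, min W (u (e i) + u (e (h - 1 - i))) ≤ z s := by
    intro i hi hj s
    set P := (Finset.range (i + 1)).image e
    set Q := (Finset.range (h - 1 - i + 1)).image (fun j => s - e j)
    have hP : P.card = i + 1 := by
      rw [Finset.card_image_of_injOn, Finset.card_range]
      exact hinj.mono (by simpa using hi)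
    have hQ : Q.card = h - 1 - i + 1 := by
      rw [Finset.card_image_of_injOn, Finset.card_range]
      intro a ha b hb hab
      simp only [Finset.coe_range, mem_Iio] at ha hb
      exact hinj (by simp; omega) (by simp; omega) (by simpa using hab)
    have : (P ∩ Q).Nonempty := by
      rw [← Finset.card_pos]
      have h1 := Finset.card_union_add_card_inter P Q
      have h2 := Finset.card_le_univ (P ∪ Q)
      omega
    obtain ⟨c, hc⟩ := this
    rw [Finset.mem_inter] at hc
    obtain ⟨i', hi', rfl⟩ := Finset.mem_image.1 hc.1
    obtain ⟨j', hj', hs⟩ := Finset.mem_image.1 hc.2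
    rw [Finset.mem_range] at hi' hj'
    have h3 := hz (e i') (heX _ (by omega)) (e j') (heX _ (by omega))
    rw [show e i' + e j' = s by rw [← hs]; abel] at h3
    refine (min_le_min_left _ ?_).trans h3
    exact add_le_add (hanti _ _ (by omega) hi) (hanti _ _ (by omega) hj)
  set M := Finset.Ico (h - x) x with hM
  have hMne : M.Nonempty := by rw [hM, Finset.nonempty_Ico]; omega
  obtain ⟨i₀, hi₀, hmax⟩ := M.exists_max_image (fun i => u (e i) + u (e (h - 1 - i))) hMne
  rw [hM, Finset.mem_Ico] at hi₀
  set μ := u (e i₀) + u (e (h - 1 - i₀)) with hμ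
  have hall : ∀ s, min W μ ≤ z s := hpop i₀ hi₀.2 (by omega)
  rcases le_or_gt W μ with hWμ | hWμ
  · rw [min_eq_left hWμ] at hall
    refine (min_le_left _ _).trans ?_
    have := Finset.card_nsmul_le_sum Finset.univ z W (fun s _ => hall s)
    simpa using this
  rw [min_eq_right hWμ.le] at hall
  refine (min_le_right _ _).trans ?_
  set m := u (e 0) with hm
  have hum : ∀ i < x, u (e i) ≤ m := fun i hi => hanti 0 i (by omega) hi
  have hmW : m ≤ W := huW _ (heX 0 (by omega))
  have hmid : 2 * ∑ i ∈ M, u (e i) ≤ (2 * x - h : ℝ) * μ := by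
    have h1 : ∑ i ∈ M, u (e i) = ∑ i ∈ M, u (e (h - 1 - i)) := by
      refine Finset.sum_nbij' (fun i => h - 1 - i) (fun i => h - 1 - i) ?_ ?_ ?_ ?_ ?_
      all_goals intro i hi; rw [hM, Finset.mem_Ico] at hi
      · rw [hM, Finset.mem_Ico]; omega
      · rw [hM, Finset.mem_Ico]; omega
      · omega
      · omega
      · rw [show h - 1 - (h - 1 - i) = i by omega]
    rw [two_mul]
    nth_rewrite 2 [h1]
    rw [← Finset.sum_add_distrib]
    refine (Finset.sum_le_card_nsmul M _ μ hmax).trans_eq ?_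
    rw [hM, Nat.card_Ico, nsmul_eq_mul, Nat.cast_sub (by omega), Nat.cast_sub hXh]
    ring
  have hsplit : ∀ f : ℕ → ℝ, ∑ i ∈ Finset.range x, f i =
      ∑ i ∈ Finset.range (h - x), f i + ∑ i ∈ M, f i := fun f => by
    rw [hM, Finset.sum_range_add_sum_Ico f (by omega)]
  -- lower bound for the sum of `z`
  have hzsum : ∑ i ∈ Finset.range x, z (e i + e 0) + (h - x : ℝ) * μ ≤ ∑ s, z s := by
    set T := (Finset.range x).image (fun i => e i + e 0)
    have hinj' : Set.InjOn (fun i => e i + e 0) (Finset.range x) := fun a ha b hb hab =>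
      hinj ha hb (by simpa using hab)
    have hT : T.card = x := by rw [Finset.card_image_of_injOn hinj', Finset.card_range]
    rw [← Finset.sum_add_sum_compl T z, Finset.sum_image hinj']
    gcongr
    refine le_trans (le_of_eq ?_) (Finset.card_nsmul_le_sum Tᶜ z μ (fun s _ => hall s))
    rw [Finset.card_compl, hT, nsmul_eq_mul, Nat.cast_sub hXh]
  have hzi : ∀ i < x, min W (u (e i) + m) ≤ z (e i + e 0) := fun i hi =>
    hz _ (heX i hi) _ (heX 0 (by omega))
  have hzmid : (2 * x - h : ℝ) * max μ m ≤ ∑ i ∈ M, z (e i + e 0) := by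
    refine le_trans (le_of_eq ?_) (Finset.card_nsmul_le_sum M _ (max μ m) fun i hi => ?_)
    · rw [hM, Nat.card_Ico, nsmul_eq_mul, Nat.cast_sub (by omega), Nat.cast_sub hXh]
      ring
    · rw [hM, Finset.mem_Ico] at hi
      refine max_le (hall _) (le_trans (le_min hmW ?_) (hzi i hi.2))
      linarith [hu0 _ (heX i hi.2)]
  have hztop : ∑ i ∈ Finset.range (h - x), (2 * u (e i) - m) ≤
      ∑ i ∈ Finset.range (h - x), z (e i + e 0) := by
    refine Finset.sum_le_sum fun i hi => ?_
    rw [Finset.mem_range] at hi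
    refine le_trans (le_min ?_ ?_) (hzi i (by omega))
    · linarith [hum i (by omega), huW _ (heX i (by omega))]
    · linarith [hum i (by omega), hu0 _ (heX 0 (by omega))]
  rw [Finset.sum_sub_distrib, ← Finset.mul_sum, Finset.sum_const, Finset.card_range, nsmul_eq_mul,
    Nat.cast_sub hXh] at hztop
  rw [hsplit] at hzsum
  rw [hsum, hsplit]
  have hX' : (2 * h : ℝ) ≤ 3 * x := by exact_mod_cast hX
  have hXh' : (x : ℝ) ≤ h := by exact_mod_cast hXh
  rcases le_total m μ with hc | hc
  · rw [max_eq_left hc] at hzmid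
    nlinarith [mul_nonneg (sub_nonneg.2 hXh') (sub_nonneg.2 hc)]
  · rw [max_eq_right hc] at hzmid
    nlinarith [mul_nonneg (sub_nonneg.2 hX') (sub_nonneg.2 hc)]

/-- The winding of the set `Y (s - j • g)`, shifted by `j * ω`, around the circle of length `W`. -/
def windPiece {G : Type*} [AddCommGroup G] (Y : G → Set ℝ) (g : G) (ω W : ℝ) (s : G) (j : ℕ) :
    Set (AddCircle W) :=
  (fun y : ℝ => ((y + j * ω : ℝ) : AddCircle W)) '' Y (s - j • g)

def windSet {G : Type*} [AddCommGroup G] (Y : G → Set ℝ) (g : G) (ω W : ℝ) (s : G) :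
    Set (AddCircle W) :=
  ⋃ j ∈ Finset.range (addOrderOf g), windPiece Y g ω W s j

section Wind

variable {G : Type*} [AddCommGroup G] {g : G} {ω W : ℝ}

lemma windPiece_eq_image (Y : G → Set ℝ) (s : G) (j : ℕ) :
    windPiece Y g ω W s j = (↑) '' ((fun y => y + -(j * ω)) ⁻¹' Y (s - j • g)) := by
  ext x
  constructor
  · rintro ⟨y, hy, rfl⟩
    exact ⟨y + j * ω, by simpa using hy, rfl⟩
  · rintro ⟨y, hy, rfl⟩
    exact ⟨y + -(j * ω), hy, by simp⟩

lemma windPiece_mod (hW : W = addOrderOf g * ω) (Y : G → Set ℝ) (s : G) (j : ℕ) :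
    windPiece Y g ω W s j = windPiece Y g ω W s (j % addOrderOf g) := by
  have h2 : ((j : ℝ)) = (j % addOrderOf g : ℕ) + (addOrderOf g : ℝ) * (j / addOrderOf g : ℕ) := by
    exact_mod_cast (Nat.mod_add_div j (addOrderOf g)).symm
  unfold windPiece
  rw [mod_addOrderOf_nsmul]
  congr 1
  funext y
  have h3 : (y + j * ω : ℝ) = (y + (j % addOrderOf g : ℕ) * ω) + (j / addOrderOf g : ℕ) • W := by
    rw [h2, hW, nsmul_eq_mul]
    ring
  rw [h3, AddCircle.coe_add, AddCircle.coe_nsmul, AddCircle.coe_period, smul_zero, add_zero]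

lemma windPiece_subset [Finite G] (hW : W = addOrderOf g * ω) (Y : G → Set ℝ) (s : G) (j : ℕ) :
    windPiece Y g ω W s j ⊆ windSet Y g ω W s := by
  rw [windPiece_mod hW]
  exact subset_biUnion_of_mem (u := fun j => windPiece Y g ω W s j)
    (Finset.mem_coe.2 (Finset.mem_range.2 (Nat.mod_lt _ (addOrderOf_pos g))))

lemma windSet_add_subset [Finite G] (hW : W = addOrderOf g * ω) {Y Z : G → Set ℝ}
    (hZ : ∀ a b, Y a + Y b ⊆ Z (a + b)) (a b : G) :
    windSet Y g ω W a + windSet Y g ω W b ⊆ windSet Z g ω W (a + b) := by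
  rintro _ ⟨x, hx, x', hx', rfl⟩
  obtain ⟨j, -, y, hy, rfl⟩ := mem_iUnion₂.1 hx
  obtain ⟨k, -, y', hy', rfl⟩ := mem_iUnion₂.1 hx'
  refine windPiece_subset hW Z _ (j + k) ⟨y + y', ?_, ?_⟩
  · have := hZ _ _ (add_mem_add hy hy')
    rwa [show a - j • g + (b - k • g) = a + b - (j + k) • g by rw [add_nsmul]; abel] at this
  · change ((_ : ℝ) : AddCircle W) = (_ : ℝ) + (_ : ℝ)
    rw [← AddCircle.coe_add]
    congr 1
    push_cast
    ring

lemma measurableSet_windSet [Fact (0 < W)] {Y : G → Set ℝ} (hY : ∀ s, MeasurableSet (Y s)) (s : G) :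
    MeasurableSet (windSet Y g ω W s) := by
  refine Finset.measurableSet_biUnion _ fun j _ => ?_
  rw [windPiece_eq_image]
  exact measurableSet_coe_image ((hY _).preimage (by fun_prop))

lemma volume_windPiece_le [Fact (0 < W)] (Y : G → Set ℝ) (hY : ∀ s, volume (Y s) ≠ ⊤) (s : G)
    (j : ℕ) : volume.real (windPiece Y g ω W s j) ≤ volume.real (Y (s - j • g)) := by
  refine ENNReal.toReal_mono (hY _) ?_
  rw [windPiece_eq_image]
  refine (volume_coe_image_le _).trans_eq ?_
  rw [measure_preimage_add_right]

lemma sum_volume_le_windSet [Fact (0 < W)] (hω : 0 < ω) (hW : W = addOrderOf g * ω)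
    {Y : G → Set ℝ} {p : ℝ} (hp : ∀ s, Y s ⊆ Icc p (p + ω)) (s : G) :
    ∑ j ∈ Finset.range (addOrderOf g), volume.real (Y (s - j • g)) ≤
      volume.real (windSet Y g ω W s) := by
  set o := addOrderOf g with ho
  set V : Set ℝ := ⋃ j ∈ Finset.range o, (fun y => y + -(j * ω)) ⁻¹' Y (s - j • g) with hV
  have hVW : V ⊆ Icc p (p + W) := by
    intro x hx
    obtain ⟨j, hj, hx⟩ := mem_iUnion₂.1 hx
    have h1 := hp _ hx
    have h2 : (j + 1 : ℝ) ≤ o := by exact_mod_cast Finset.mem_range.1 hj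
    rw [mem_Icc] at h1 ⊢
    have h3 : (0 : ℝ) ≤ j * ω := by positivity
    have h4 := mul_le_mul_of_nonneg_right h2 hω.le
    constructor <;> linarith
  have himg : windSet Y g ω W s = (↑) '' V := by
    rw [hV, image_iUnion₂]
    simp only [windSet, windPiece_eq_image]
    rfl
  have h1 : volume.real V ≤ volume.real (windSet Y g ω W s) := by
    rw [himg]
    exact ENNReal.toReal_mono (measure_ne_top _ _) (volume_le_coe_image hVW)
  refine le_trans ?_ h1
  refine le_trans (Finset.sum_le_sum fun j hj => ?_) (sum_volume_inter_le (Finset.range o)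
    (S := V) (measure_ne_top_of_subset hVW (by simp))
    (P := fun j : ℕ => Ico (p + j * ω) (p + (j + 1) * ω)) (fun _ _ => measurableSet_Ico) ?_)
  · have hfin : volume (V ∩ Ico (p + j * ω) (p + (j + 1) * ω) ∪ {p + (j + 1) * ω}) ≠ ⊤ :=
      measure_union_ne_top (measure_ne_top_of_subset (inter_subset_left.trans hVW)
        isCompact_Icc.measure_lt_top.ne) isCompact_singleton.measure_lt_top.ne
    have h2 : volume.real (Y (s - j • g)) =
        volume.real ((fun y => y + -(j * ω)) ⁻¹' Y (s - j • g)) := by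
      rw [measureReal_def, measureReal_def, measure_preimage_add_right]
    rw [h2]
    refine (measureReal_mono (s₂ := V ∩ Ico (p + j * ω) (p + (j + 1) * ω) ∪ {p + (j + 1) * ω})
      ?_ hfin).trans ((measureReal_union_le _ _).trans_eq ?_)
    · intro x hx
      have h3 := hp _ hx
      rw [mem_Icc] at h3
      by_cases h : x = p + (j + 1) * ω
      · exact Or.inr h
      · exact Or.inl ⟨mem_iUnion₂.2 ⟨j, hj, hx⟩, by linarith,
          lt_of_le_of_ne (by linarith) h⟩
    · simp [measureReal_def]
  · intro i _ j _ hij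
    refine Set.disjoint_left.2 fun x hx hx' => hij ?_
    have h1 : (i : ℝ) * ω < (j + 1) * ω := by linarith [hx.1, hx'.2]
    have h2 : (j : ℝ) * ω < (i + 1) * ω := by linarith [hx.2, hx'.1]
    have h1 := lt_of_mul_lt_mul_right h1 hω.le
    have h2 := lt_of_mul_lt_mul_right h2 hω.le
    have h1 : i < j + 1 := by exact_mod_cast h1
    have h2 : j < i + 1 := by exact_mod_cast h2
    omega

end Wind

/-- For a family of closed-ended subsets of an interval of length `q - p`, indexed by a finite abelian
group, whose extreme points are attained. -/
lemma sum_add_min_le_sum_sumset {G : Type*} [AddCommGroup G] [Fintype G] [DecidableEq G]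
    {Y Z : G → Set ℝ} {p q : ℝ} (hpq : p < q) (hYm : ∀ s, MeasurableSet (Y s))
    (hY : ∀ s, Y s ⊆ Icc p q) {i₀ j₀ : G} (hi₀ : p ∈ Y i₀) (hj₀ : q ∈ Y j₀)
    (hX : ∃ X : Finset G, 2 * Fintype.card G ≤ 3 * X.card ∧ ∀ s ∈ X, (Y s).Nonempty)
    (hYZ : ∀ a b, Y a + Y b ⊆ Z (a + b)) (hZ : ∀ s, Z s ⊆ Icc (p + p) (q + q)) :
    ∑ s, volume.real (Y s) + min (Fintype.card G * (q - p)) (2 * ∑ s, volume.real (Y s)) ≤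
      ∑ s, volume.real (Z s) := by
  classical
  set g := j₀ - i₀ with hg
  set o := addOrderOf g with ho
  have hopos : 0 < o := addOrderOf_pos g
  set ω := q - p with hω
  have hω0 : 0 < ω := sub_pos.2 hpq
  set W : ℝ := o * ω with hW
  have hWf : Fact (0 < W) := ⟨by positivity⟩
  have hYfin : ∀ s, volume (Y s) ≠ ⊤ := fun s => measure_ne_top_of_subset (hY s) (by simp)
  have hZfin : ∀ s, volume (Z s) ≠ ⊤ := fun s => measure_ne_top_of_subset (hZ s) (by simp)
  have hYω : ∀ s, volume.real (Y s) ≤ ω := fun s => by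
    refine (measureReal_mono (hY s) (by simp)).trans_eq ?_
    simp [measureReal_def, hω, hpq.le]
  set E : G → Set ℝ := fun s => (fun y => y + -q) ⁻¹' Y (s - j₀) with hE
  have hEm : ∀ s, MeasurableSet (E s) := fun s => (hYm _).preimage (by fun_prop)
  have hEZ : ∀ s, E s ⊆ Z s := fun s x hx => by
    have := hYZ _ _ (add_mem_add hx hj₀)
    simpa using this
  have hEvol : ∀ s, volume.real (Z s \ E s) = volume.real (Z s) - volume.real (Y (s - j₀)) := by
    intro s
    have h1 : volume.real (E s) = volume.real (Y (s - j₀)) := by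
      rw [measureReal_def, measureReal_def, hE, measure_preimage_add_right]
    have h2 := measureReal_inter_add_sdiff (μ := volume) (s := Z s) (hEm s) (hZfin s)
    rw [inter_eq_right.2 (hEZ s), h1] at h2
    linarith
  have hshift : ∀ (f : G → ℝ) (c : G), ∑ s, f (s - c) = ∑ s, f s := fun f c =>
    (Equiv.subRight c).sum_comp f
  -- the winding of `Z` is covered by that of `Z \ E`
  have hcover : ∀ s, volume.real (windSet Z g ω W s) ≤
      ∑ j ∈ Finset.range o, volume.real (Z (s - j • g) \ E (s - j • g)) := by
    intro s
    set N₀ : Finset ℝ := (Finset.range o).image fun j : ℕ => p + q + (j + 1 : ℕ) * ω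
    set N : Set (AddCircle W) := (↑) '' (N₀ : Set ℝ) with hNdef
    have hsub : windSet Z g ω W s ⊆ windSet (fun s => Z s \ E s) g ω W s ∪ N := by
      intro x hx
      obtain ⟨j, hj, y, hy, rfl⟩ := mem_iUnion₂.1 hx
      by_cases hyE : y ∈ E (s - j • g)
      swap
      · exact Or.inl (windPiece_subset rfl _ s j ⟨y, ⟨hy, hyE⟩, rfl⟩)
      have e1 : (y + j * ω : ℝ) = (y + -q + p) + (j + 1 : ℕ) * ω := by
        push_cast; rw [hω]; ring
      have e2 : s - j • g - j₀ = s - (j + 1) • g - i₀ := by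
        rw [succ_nsmul, hg]; abel
      have hy1 : y + -q ∈ Y (s - (j + 1) • g - i₀) := by
        rw [← e2]; exact hyE
      by_cases hyE' : y + -q + p ∈ E (s - (j + 1) • g)
      · right
        have h1 := (hY _ hy1).2
        have h2 := (hY _ hyE').1
        have h3 : y + -q = q := le_antisymm h1 (by linarith)
        refine ⟨_, Finset.mem_coe.2 (Finset.mem_image.2 ⟨j, hj, rfl⟩), ?_⟩
        change _ = ((y + j * ω : ℝ) : AddCircle W)
        rw [e1, h3, add_comm q p]
      · left
        refine windPiece_subset rfl _ s (j + 1) ⟨y + -q + p, ⟨?_, hyE'⟩, ?_⟩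
        · have := hYZ _ _ (add_mem_add hy1 hi₀)
          simpa using this
        · change ((_ : ℝ) : AddCircle W) = ((y + j * ω : ℝ) : AddCircle W)
          rw [e1]
    refine (measureReal_mono hsub (measure_ne_top _ _)).trans ((measureReal_union_le _ _).trans ?_)
    have hN : volume.real N = 0 := by
      have := volume_coe_image_le (T := W) (N₀ : Set ℝ)
      rw [N₀.finite_toSet.measure_zero, nonpos_iff_eq_zero] at this
      rw [measureReal_def, hNdef, this, ENNReal.toReal_zero]
    rw [hN, add_zero]
    refine (measureReal_biUnion_finset_le _ _).trans (Finset.sum_le_sum fun j _ => ?_)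
    exact volume_windPiece_le _ (fun s => measure_ne_top_of_subset sdiff_subset (hZfin s)) s j
  have hcsum : ∑ s, volume.real (windSet Z g ω W s) ≤
      o * (∑ s, volume.real (Z s) - ∑ s, volume.real (Y s)) := by
    refine (Finset.sum_le_sum fun s _ => hcover s).trans_eq ?_
    rw [Finset.sum_comm]
    simp only [hshift (fun s => volume.real (Z s \ E s))]
    simp only [hEvol, Finset.sum_sub_distrib, hshift (fun s => volume.real (Y s)),
      Finset.sum_const, Finset.card_range, nsmul_eq_mul, mul_sub]
  set u : G → ℝ := fun s => ∑ j ∈ Finset.range o, volume.real (Y (s - j • g)) with hu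
  have husum : ∑ s, u s = o * ∑ s, volume.real (Y s) := by
    rw [hu, Finset.sum_comm]
    simp only [hshift (fun s => volume.real (Y s)), Finset.sum_const, Finset.card_range,
      nsmul_eq_mul]
  have huU : ∀ s, u s ≤ volume.real (windSet Y g ω W s) :=
    sum_volume_le_windSet (p := p) hω0 rfl (fun s => by simpa [hω] using hY s)
  set X := Finset.univ.filter fun s => (windSet Y g ω W s).Nonempty with hXdef
  obtain ⟨X', hX'c, hX'⟩ := hX
  have hXX : X' ⊆ X := by
    intro s hs
    obtain ⟨y, hy⟩ := hX' s hs
    refine Finset.mem_filter.2 ⟨Finset.mem_univ _, _, windPiece_subset rfl Y s 0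
      ⟨y, by simpa using hy, rfl⟩⟩
  have huX : ∑ s ∈ X, u s = ∑ s, u s := by
    refine Finset.sum_subset (Finset.subset_univ _) fun s _ hs => ?_
    rw [hXdef, Finset.mem_filter, not_and, not_nonempty_iff_eq_empty] at hs
    have h1 := huU s
    rw [hs (Finset.mem_univ _), measureReal_empty] at h1
    exact le_antisymm h1 (Finset.sum_nonneg fun _ _ => measureReal_nonneg)
  have key := min_le_sum_of_add_le (X := X) (u := u)
    (z := fun s => volume.real (windSet Z g ω W s)) (W := W)
    (by have := Finset.card_le_card hXX; omega)
    (fun a _ => Finset.sum_nonneg fun _ _ => measureReal_nonneg)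
    (fun a _ => (Finset.sum_le_card_nsmul _ _ ω fun j _ => hYω _).trans_eq (by
      rw [Finset.card_range, nsmul_eq_mul]))
    (fun a ha b hb => by
      have h1 := raikov (measurableSet_windSet hYm a) (measurableSet_windSet hYm b)
        (Finset.mem_filter.1 ha).2 (Finset.mem_filter.1 hb).2 (T := W)
      refine (min_le_min_left _ (add_le_add (huU a) (huU b))).trans (h1.trans ?_)
      exact measureReal_mono (windSet_add_subset rfl hYZ a b) (measure_ne_top _ _))
  rw [huX, husum] at key
  have hfin := key.trans hcsum
  have ho' : (0 : ℝ) < o := by exact_mod_cast hopos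
  rw [hW, show (Fintype.card G * (o * ω) : ℝ) = o * (Fintype.card G * ω) by ring,
    show (2 * (o * ∑ s, volume.real (Y s)) : ℝ) = o * (2 * ∑ s, volume.real (Y s)) by ring,
    ← mul_min_of_nonneg _ _ ho'.le] at hfin
  have := le_of_mul_le_mul_left hfin ho'
  linarith

/-- Nonempty intersections with intervals with rational ends attain their bounds. -/
def EndClosed (B : Set ℝ) : Prop :=
  ∀ a b : ℚ, (B ∩ Icc (a : ℝ) b).Nonempty →
    (∃ l, IsLeast (B ∩ Icc (a : ℝ) b) l) ∧ ∃ r, IsGreatest (B ∩ Icc (a : ℝ) b) r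

lemma EndClosed.exists_isLeast_isGreatest {B : Set ℝ} (hB : EndClosed B) {x y w : ℝ} (hw : 0 < w)
    (hgap : ∀ b ∈ B, x - w < b → b < y + w → b ∈ Icc x y) (hne : (B ∩ Icc x y).Nonempty) :
    (∃ l, IsLeast (B ∩ Icc x y) l) ∧ ∃ r, IsGreatest (B ∩ Icc x y) r := by
  obtain ⟨a, ha, ha'⟩ := exists_rat_btwn (show x - w < x by linarith)
  obtain ⟨b, hb, hb'⟩ := exists_rat_btwn (show y < y + w by linarith)
  have : B ∩ Icc x y = B ∩ Icc (a : ℝ) b := by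
    ext z
    constructor
    · rintro ⟨h1, h2⟩
      exact ⟨h1, by linarith [h2.1], by linarith [h2.2]⟩
    · rintro ⟨h1, h2⟩
      exact ⟨h1, hgap z h1 (by linarith [h2.1]) (by linarith [h2.2])⟩
  rw [this] at hne ⊢
  exact hB a b hne

lemma exists_isLeast_biUnion {ι : Type*} (s : Finset ι) (R : ι → Set ℝ)
    (h : ∀ i ∈ s, (R i).Nonempty → ∃ l, IsLeast (R i) l) (hne : (⋃ i ∈ s, R i).Nonempty) :
    ∃ l, IsLeast (⋃ i ∈ s, R i) l := by
  classical
  obtain ⟨x, hx⟩ := hne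
  obtain ⟨i₀, hi₀, hx⟩ := mem_iUnion₂.1 hx
  set s' := s.filter fun i => (R i).Nonempty
  have h' : ∀ i ∈ s', ∃ l, IsLeast (R i) l := fun i hi =>
    h i (Finset.mem_filter.1 hi).1 (Finset.mem_filter.1 hi).2
  choose! l hl using h'
  obtain ⟨i, hi, hmin⟩ := s'.exists_min_image l ⟨i₀, Finset.mem_filter.2 ⟨hi₀, x, hx⟩⟩
  refine ⟨l i, mem_iUnion₂.2 ⟨i, (Finset.mem_filter.1 hi).1, (hl i hi).1⟩, fun y hy => ?_⟩
  obtain ⟨j, hj, hy⟩ := mem_iUnion₂.1 hy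
  have hj' : j ∈ s' := Finset.mem_filter.2 ⟨hj, y, hy⟩
  exact (hmin j hj').trans ((hl j hj').2 hy)

lemma exists_isGreatest_biUnion {ι : Type*} (s : Finset ι) (R : ι → Set ℝ)
    (h : ∀ i ∈ s, (R i).Nonempty → ∃ l, IsGreatest (R i) l) (hne : (⋃ i ∈ s, R i).Nonempty) :
    ∃ l, IsGreatest (⋃ i ∈ s, R i) l := by
  have hneg : ⋃ i ∈ s, -R i = -⋃ i ∈ s, R i := by
    ext x; simp
  obtain ⟨l, hl⟩ := exists_isLeast_biUnion s (fun i => -R i) (fun i hi hn => by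
    obtain ⟨l, hl⟩ := h i hi (by simpa using hn)
    exact ⟨-l, by simpa using hl.1, fun x hx => neg_le.1 (hl.2 hx)⟩) (by rw [hneg]; simpa using hne)
  rw [hneg] at hl
  exact ⟨-l, by simpa using hl.1, fun x hx => le_neg.1 (hl.2 (show -x ∈ _ by simpa using hx))⟩

/-- The part of `S` near the point of the grid with index `s`. -/
def gridRow {D : ℝ} (n : ℕ) (S : Set (AddCircle D)) (r : ℝ) (s : ZMod n) : Set ℝ :=
  {y | |y| ≤ r ∧ ((y + s.val * (D / n) : ℝ) : AddCircle D) ∈ S}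

lemma grid_eq_of_near {D : ℝ} {n : ℕ} (hn : 0 < n) {r : ℝ} (hr : r < D / n) {s t : ZMod n}
    (h : ‖((s.val * (D / n) : ℝ) : AddCircle D) - ((t.val * (D / n) : ℝ) : AddCircle D)‖ ≤ r) :
    s = t := by
  have : NeZero n := ⟨hn.ne'⟩
  obtain ⟨j, hj, hj'⟩ := AddCircle.exists_real_near (i := (t.val : ℤ)) hn
    (by exact_mod_cast h)
  have hD : 0 < D / n := (abs_nonneg _).trans_lt (hj'.trans_lt hr)
  rw [← sub_mul, abs_mul, abs_of_pos hD] at hj'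
  have h1 : |(s.val : ℝ) - j| < 1 := by
    refine lt_of_mul_lt_mul_right ?_ hD.le
    rw [one_mul]
    exact hj'.trans_lt hr
  have h2 : |((s.val : ℤ) - j : ℤ)| < 1 := by exact_mod_cast h1
  have h3 : (s.val : ℤ) = j := by
    rw [abs_lt] at h2; omega
  have h4 : ((s.val : ℤ) : ZMod n) = ((t.val : ℤ) : ZMod n) := by rw [h3, hj]
  simpa using h4

lemma mem_gridRow_iff {B : Set ℝ} {D : ℝ} [Fact (0 < D)] {n : ℕ} (hn : 0 < n) {r : ℝ} {s : ZMod n}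
    {y : ℝ} : y ∈ gridRow n ((↑) '' B : Set (AddCircle D)) r s ↔
      |y| ≤ r ∧ ∃ i : ℤ, (i : ZMod n) = s ∧ y + i * (D / n) ∈ B := by
  have : NeZero n := ⟨hn.ne'⟩
  have hn' : (n : ℝ) ≠ 0 := by positivity
  refine and_congr_right fun _ => ⟨?_, ?_⟩
  · rintro ⟨b, hb, hbe⟩
    rw [← sub_eq_zero, ← AddCircle.coe_sub, AddCircle.coe_eq_zero_iff] at hbe
    obtain ⟨k, hk⟩ := hbe
    refine ⟨s.val + n * k, by simp, ?_⟩
    convert hb using 1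
    rw [zsmul_eq_mul] at hk
    have : (n * k * (D / n) : ℝ) = k * D := by field_simp
    push_cast
    linear_combination hk + this
  · rintro ⟨i, rfl, hi⟩
    refine ⟨_, hi, ?_⟩
    rw [AddCircle.coe_add, AddCircle.coe_add]
    congr 1
    have := AddCircle.coe_grid_eq (D := D) hn.ne' i ((i : ZMod n).val : ℤ) (by simp)
    exact_mod_cast this

/-- A lower bound for the sumset of a set of the circle near a grid in terms of its rows. -/
lemma sum_volume_gridRow_le {D : ℝ} [Fact (0 < D)] {n : ℕ} [NeZero n] {S : Set (AddCircle D)} {w : ℝ}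
    (hw : 0 < w) (hwn : 98 * w ≤ D / n)
    (Z : ZMod n → Set ℝ) (hZ : ∀ s, ∀ z ∈ Z s, ∃ a b, a + b = s ∧ z ∈
      gridRow n S (3 * w) a + gridRow n S (3 * w) b) :
    ∑ s, volume.real (Z s) ≤ volume.real (S + S) := by
  have hn : 0 < n := Nat.pos_of_ne_zero (NeZero.ne n)
  have hn1 : (1 : ℝ) ≤ n := by exact_mod_cast hn
  have hDn : D / n ≤ D := by
    have := (inferInstance : Fact (0 < D)).out
    exact div_le_self this.le hn1
  have hz6 : ∀ s, ∀ z ∈ Z s, |z| ≤ 6 * w := by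
    intro s z hz
    obtain ⟨a, b, -, x, hx, y, hy, rfl⟩ := hZ s z hz
    have := abs_add_le x y
    change |x + y| ≤ _
    linarith [hx.1, hy.1]
  refine le_trans (Finset.sum_le_sum fun s _ => ?_) (sum_volume_inter_le Finset.univ
    (measure_ne_top _ _)
    (P := fun s : ZMod n => Metric.closedBall ((s.val * (D / n) : ℝ) : AddCircle D) (6 * w))
    (fun p _ => Metric.isClosed_closedBall.measurableSet) ?_)
  · have h1 : volume.real (Z s) = volume.real ((fun y => y + -(s.val * (D / n) : ℝ)) ⁻¹' Z s) := by
      rw [measureReal_def, measureReal_def, measure_preimage_add_right]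
    rw [h1]
    refine (ENNReal.toReal_mono (measure_ne_top _ _) (volume_le_coe_image (T := D)
      (a := s.val * (D / n) - 6 * w) ?_)).trans (measureReal_mono ?_ (measure_ne_top _ _))
    · intro y hy
      have := abs_le.1 (hz6 s _ hy)
      rw [mem_Icc]
      constructor <;> linarith
    · rintro _ ⟨y, hy, rfl⟩
      refine ⟨?_, ?_⟩
      · obtain ⟨a, b, hab, x, hx, x', hx', hxx⟩ := hZ s _ hy
        have hab' : (((a.val + b.val : ℕ) : ℤ) : ZMod n) = ((s.val : ℤ) : ZMod n) := by
          simp [hab]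
        have h2 := AddCircle.coe_grid_eq (D := D) hn.ne' _ _ hab'
        refine ⟨_, hx.2, _, hx'.2, ?_⟩
        change ((_ : ℝ) : AddCircle D) + (_ : ℝ) = _
        change x + x' = _ at hxx
        rw [← AddCircle.coe_add,
          show x + a.val * (D / n) + (x' + b.val * (D / n)) =
            (x + x') + ((a.val + b.val : ℕ) : ℤ) * (D / n) by push_cast; ring, AddCircle.coe_add, h2,
          ← AddCircle.coe_add, hxx]
        congr 1
        push_cast
        ring
      · rw [Metric.mem_closedBall, dist_eq_norm, ← AddCircle.coe_sub]
        exact (AddCircle.norm_coe_le_abs _).trans (hz6 s _ hy)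
  · intro s _ t _ hst
    refine Set.disjoint_left.2 fun z hz hz' => hst
      (grid_eq_of_near (r := 12 * w) hn ((show 12 * w < 98 * w by linarith only [hw]).trans_le hwn) ?_)
    rw [Metric.mem_closedBall, dist_eq_norm] at hz hz'
    rw [norm_sub_rev] at hz
    have := norm_le_add (a := ((s.val * (D / n) : ℝ) : AddCircle D) - ((t.val * (D / n) : ℝ) :
      AddCircle D)) (by abel) hz hz'
    linarith

lemma volume_le_sum_gridRow {D : ℝ} [Fact (0 < D)] {n : ℕ} [NeZero n] {S : Set (AddCircle D)} {r : ℝ}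
    (hS : ∀ x ∈ S, ∃ s, ∃ y ∈ gridRow n S r s, x = ((y + s.val * (D / n) : ℝ) : AddCircle D)) :
    volume.real S ≤ ∑ s, volume.real (gridRow n S r s) := by
  have hfin : ∀ s, volume (gridRow n S r s) ≠ ⊤ := fun s =>
    measure_ne_top_of_subset (t := gridRow n S r s) (s := Icc (-r) r) (fun y hy => abs_le.1 hy.1)
      isCompact_Icc.measure_lt_top.ne
  have hsub : S ⊆ ⋃ s ∈ Finset.univ, ((↑) '' ((fun y => y + -(s.val * (D / n) : ℝ)) ⁻¹'
      gridRow n S r s) : Set (AddCircle D)) := by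
    intro x hx
    obtain ⟨s, y, hy, rfl⟩ := hS x hx
    exact mem_iUnion₂.2 ⟨s, Finset.mem_univ _, y + s.val * (D / n), by simpa using hy, rfl⟩
  refine (measureReal_mono hsub (measure_ne_top _ _)).trans
    ((measureReal_biUnion_finset_le _ _).trans (Finset.sum_le_sum fun s _ => ?_))
  refine ENNReal.toReal_mono (hfin s) ((volume_coe_image_le _).trans_eq ?_)
  rw [measure_preimage_add_right]

/-- An end-closed set of doubling less than `4` and large diameter is contained in a progression of
short intervals of small total length, most of which it meets. -/
lemma exists_strip : ∃ C : ℝ, ∀ (B : Set ℝ) (D : ℝ), MeasurableSet B → IsLeast B 0 →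
    IsGreatest B D → EndClosed B → 0 < volume.real B → volume.real (B + B) < 4 * volume.real B →
    C * volume.real B ≤ D →
    ∃ (n : ℕ) (p q : ℝ), 0 < n ∧ p ≤ 0 ∧ 0 ≤ q ∧ p < q ∧ n * (q - p) < 2 * volume.real B ∧
      16 * (q - p) ≤ D / n ∧
      (∀ b ∈ B, ∃ i ≤ n, b ∈ Icc (i * (D / n) + p) (i * (D / n) + q)) ∧
      (∀ i : ℕ, (B ∩ Icc (i * (D / n) + p) (i * (D / n) + q)).Nonempty →
        (∃ l, IsLeast (B ∩ Icc (i * (D / n) + p) (i * (D / n) + q)) l) ∧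
        ∃ r, IsGreatest (B ∩ Icc (i * (D / n) + p) (i * (D / n) + q)) r) ∧
      ∃ X ⊆ Finset.range (n + 1), 2 * n + 3 < 3 * X.card ∧
        ∀ i ∈ X, (B ∩ Icc (i * (D / n) + p) (i * (D / n) + q)).Nonempty := by
  classical
  obtain ⟨C, hC⟩ := exists_rows
  refine ⟨max C 2, fun B D hB hl hr hend hpos hdbl hbig => ?_⟩
  have h2B : 2 * volume.real B ≤ D :=
    le_trans (mul_le_mul_of_nonneg_right (le_max_right _ _) hpos.le) hbig
  have hCB : C * volume.real B ≤ D :=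
    le_trans (mul_le_mul_of_nonneg_right (le_max_left _ _) hpos.le) hbig
  have hD0 : 0 < D := by linarith
  have hD : Fact (0 < D) := ⟨hD0⟩
  have hBD : B ⊆ Icc 0 D := fun b hb => ⟨hl.2 hb, hr.2 hb⟩
  obtain ⟨n, w, X, hn, hw, hwn, hnX, hcov, hXne⟩ := hC B D hB hl hr hpos hdbl hCB
  have : NeZero n := ⟨hn.ne'⟩
  have hn' : (0 : ℝ) < n := by exact_mod_cast hn
  set v := D / n with hv
  have hnv : n * v = D := by rw [hv]; field_simp
  have hv0 : 0 < v := by linarith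
  -- the index of a row is between `0` and `n`
  have hidx : ∀ b ∈ B, ∀ i : ℤ, |b - i * v| ≤ 3 * w → 0 ≤ i ∧ i ≤ n := by
    intro b hb i hi
    have h1 := abs_le.1 hi
    have h2 := hBD hb
    rw [mem_Icc, ← hnv] at h2
    constructor
    · by_contra! hc
      have : (i : ℝ) + 1 ≤ 0 := by exact_mod_cast hc
      nlinarith
    · by_contra! hc
      have : (n : ℝ) + 1 ≤ i := by exact_mod_cast hc
      nlinarith
  have hcovn : ∀ b ∈ B, ∃ i ≤ n, |b - (i : ℕ) * v| ≤ 3 * w := by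
    intro b hb
    obtain ⟨i, hi⟩ := hcov b hb
    obtain ⟨h0, h1⟩ := hidx b hb i hi
    lift i to ℕ using h0
    exact ⟨i, by exact_mod_cast h1, by exact_mod_cast hi⟩
  -- attained extremes of each row
  have hrow : ∀ i : ℕ, (B ∩ Icc (i * v - 3 * w) (i * v + 3 * w)).Nonempty →
      (∃ l, IsLeast (B ∩ Icc (i * v - 3 * w) (i * v + 3 * w)) l) ∧
      ∃ r, IsGreatest (B ∩ Icc (i * v - 3 * w) (i * v + 3 * w)) r := by
    intro i
    refine hend.exists_isLeast_isGreatest hw fun b hb h1 h2 => ?_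
    obtain ⟨j, -, hj⟩ := hcovn b hb
    have hj := abs_le.1 hj
    have hij : (j : ℝ) = i := by
      rcases lt_trichotomy j i with h | h | h
      · have : (j : ℝ) + 1 ≤ i := by exact_mod_cast h
        nlinarith
      · rw [h]
      · have : (i : ℝ) + 1 ≤ j := by exact_mod_cast h
        nlinarith
    rw [hij] at hj
    exact ⟨by linarith, by linarith⟩
  set R : ℕ → Set ℝ := fun i => (fun y => y - i * v) '' (B ∩ Icc (i * v - 3 * w) (i * v + 3 * w))
    with hR
  have hmemR : ∀ i y, y ∈ R i ↔ y + i * v ∈ B ∧ |y| ≤ 3 * w := by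
    intro i y
    constructor
    · rintro ⟨b, ⟨hb, hb'⟩, rfl⟩
      refine ⟨by simpa using hb, abs_le.2 ⟨?_, ?_⟩⟩ <;> linarith [hb'.1, hb'.2]
    · rintro ⟨hy, hy'⟩
      have := abs_le.1 hy'
      exact ⟨y + i * v, ⟨hy, by linarith, by linarith⟩, by simp⟩
  have hmono : ∀ c : ℝ, Monotone fun y : ℝ => y - c := fun c x y h => by simpa using h
  have hRl : ∀ i ∈ Finset.range (n + 1), (R i).Nonempty → ∃ l, IsLeast (R i) l := by
    intro i _ hne
    obtain ⟨l, hl⟩ := (hrow i (image_nonempty.1 hne)).1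
    exact ⟨_, (hmono _).map_isLeast hl⟩
  have hRr : ∀ i ∈ Finset.range (n + 1), (R i).Nonempty → ∃ l, IsGreatest (R i) l := by
    intro i _ hne
    obtain ⟨l, hl⟩ := (hrow i (image_nonempty.1 hne)).2
    exact ⟨_, (hmono _).map_isGreatest hl⟩
  have h0R : (0 : ℝ) ∈ ⋃ i ∈ Finset.range (n + 1), R i := by
    refine mem_iUnion₂.2 ⟨0, by simp, (hmemR 0 0).2 ⟨by simpa using hl.1, ?_⟩⟩
    rw [abs_zero]; linarith
  obtain ⟨p, hp⟩ := exists_isLeast_biUnion (Finset.range (n + 1)) R hRl ⟨0, h0R⟩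
  obtain ⟨q, hq⟩ := exists_isGreatest_biUnion (Finset.range (n + 1)) R hRr ⟨0, h0R⟩
  have hp0 : p ≤ 0 := hp.2 h0R
  have hq0 : 0 ≤ q := hq.2 h0R
  have hpq3 : ∀ i ≤ n, ∀ y ∈ R i, p ≤ y ∧ y ≤ q := fun i hi y hy =>
    have : y ∈ ⋃ i ∈ Finset.range (n + 1), R i :=
      mem_iUnion₂.2 ⟨i, Finset.mem_range.2 (by omega), hy⟩
    ⟨hp.2 this, hq.2 this⟩
  obtain ⟨i₀, hi₀, hpi⟩ := mem_iUnion₂.1 hp.1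
  obtain ⟨j₀, hj₀, hqj⟩ := mem_iUnion₂.1 hq.1
  have hp3 := abs_le.1 ((hmemR _ _).1 hpi).2
  have hq3 := abs_le.1 ((hmemR _ _).1 hqj).2
  -- the rows on the circle
  set S : Set (AddCircle D) := (↑) '' B with hSdef
  have hYiff : ∀ s y, y ∈ gridRow n S (3 * w) s ↔ ∃ i : ℕ, i ≤ n ∧ (i : ZMod n) = s ∧ y ∈ R i := by
    intro s y
    rw [mem_gridRow_iff hn]
    constructor
    · rintro ⟨hy, i, rfl, hi⟩
      obtain ⟨h0, h1⟩ := hidx _ hi i (by rw [← hv, add_sub_cancel_right]; exact hy)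
      lift i to ℕ using h0
      exact ⟨i, by exact_mod_cast h1, by simp, (hmemR _ _).2 ⟨by exact_mod_cast hi, hy⟩⟩
    · rintro ⟨i, hi, rfl, hy⟩
      rw [hmemR] at hy
      exact ⟨hy.2, i, by simp, by exact_mod_cast hy.1⟩
  have hYpq : ∀ s, gridRow n S (3 * w) s ⊆ Icc p q := by
    intro s y hy
    obtain ⟨i, hi, -, hy⟩ := (hYiff s y).1 hy
    exact hpq3 i hi y hy
  have hSm : MeasurableSet S := measurableSet_coe_image hB
  have hYm : ∀ s, MeasurableSet (gridRow n S (3 * w) s) := by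
    intro s
    refine MeasurableSet.inter (measurableSet_le (f := fun y : ℝ => |y|) (g := fun _ => 3 * w) (by fun_prop)
      (by fun_prop)) ?_
    exact hSm.preimage (AddCircle.measurable_mk'.comp (by fun_prop))
  have hSY : ∀ x ∈ S, ∃ s, ∃ y ∈ gridRow n S (3 * w) s,
      x = ((y + s.val * (D / n) : ℝ) : AddCircle D) := by
    rintro _ ⟨b, hb, rfl⟩
    obtain ⟨i, hi, hbi⟩ := hcovn b hb
    have hy : b - i * v ∈ gridRow n S (3 * w) (i : ZMod n) :=
      (hYiff _ _).2 ⟨i, hi, rfl, (hmemR _ _).2 ⟨by simpa using hb, hbi⟩⟩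
    refine ⟨_, _, hy, ?_⟩
    have := AddCircle.coe_grid_eq (D := D) hn.ne' i ((i : ZMod n).val : ℤ) (by simp)
    push_cast at this
    rw [AddCircle.coe_add, ← this, ← AddCircle.coe_add]
    simp [hv]
  have hvol : volume.real S = volume.real B := by
    rw [measureReal_def, measureReal_def, volume_coe_image_eq (a := 0) (by simpa using hBD)]
  have hYsum : volume.real B ≤ ∑ s, volume.real (gridRow n S (3 * w) s) :=
    hvol ▸ volume_le_sum_gridRow hSY
  have hYle : ∀ s, volume.real (gridRow n S (3 * w) s) ≤ q - p := fun s => by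
    refine (measureReal_mono (hYpq s) (by simp)).trans_eq ?_
    simp [measureReal_def, hp0.trans hq0]
  have hpq : p < q := by
    by_contra! hc
    have := hYsum.trans (Finset.sum_le_card_nsmul _ _ _ fun s _ => hYle s)
    rw [nsmul_eq_mul] at this
    nlinarith [show (0 : ℝ) ≤ (Finset.univ : Finset (ZMod n)).card by positivity]
  set Z : ZMod n → Set ℝ := fun s =>
    {z | ∃ a b, a + b = s ∧ z ∈ gridRow n S (3 * w) a + gridRow n S (3 * w) b} with hZ
  have hZsum := sum_volume_gridRow_le hw hwn Z (fun s z hz => hz)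
  have hcore := sum_add_min_le_sum_sumset (Y := gridRow n S (3 * w)) (Z := Z) hpq hYm hYpq
    (i₀ := (i₀ : ZMod n)) (j₀ := (j₀ : ZMod n))
    ((hYiff _ _).2 ⟨i₀, by simpa [Nat.lt_succ_iff] using hi₀, rfl, hpi⟩)
    ((hYiff _ _).2 ⟨j₀, by simpa [Nat.lt_succ_iff] using hj₀, rfl, hqj⟩)
    ⟨X, by rw [ZMod.card]; omega, fun s hs => by
      obtain ⟨b, hb, i, hi, hbi⟩ := hXne s hs
      exact ⟨b - i * v, (mem_gridRow_iff hn).2 ⟨hbi, i, hi, by simpa [hv] using hb⟩⟩⟩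
    (fun a b z hz => ⟨a, b, rfl, hz⟩)
    (fun s => by
      rintro _ ⟨a, b, -, x, hx, y, hy, rfl⟩
      exact ⟨add_le_add (hYpq _ hx).1 (hYpq _ hy).1, add_le_add (hYpq _ hx).2 (hYpq _ hy).2⟩)
  have hBB : B + B ⊆ Icc (0 + 0) (D + D) := (add_subset_add hBD hBD).trans
    (Icc_add_Icc_subset _ _ _ _)
  have hBBfin : volume (B + B) ≠ ⊤ := measure_ne_top_of_subset hBB (by simp)
  have hBfin : volume B ≠ ⊤ := measure_ne_top_of_subset hBD (by simp)
  have hcirc : volume.real B + volume.real (S + S) ≤ volume.real (B + B) := by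
    have h2 := ENNReal.toReal_mono hBBfin (volume_add_volume_circle_le (T := D) hB hl hr (by ring))
    rwa [ENNReal.toReal_add hBfin (measure_ne_top _ _)] at h2
  rw [ZMod.card] at hcore
  -- comparison of the rows in the two normalisations
  have hrow_eq : ∀ i : ℕ, i ≤ n → B ∩ Icc (i * v + p) (i * v + q) =
      B ∩ Icc (i * v - 3 * w) (i * v + 3 * w) := by
    intro i hi
    ext b
    refine and_congr_right fun hb => ⟨fun h => ⟨by linarith [h.1], by linarith [h.2]⟩, fun h => ?_⟩
    have := hpq3 i hi (b - i * v) ⟨b, ⟨hb, h⟩, rfl⟩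
    exact ⟨by linarith, by linarith⟩
  have hrow_gt : ∀ i : ℕ, n < i → ¬ (B ∩ Icc (i * v + p) (i * v + q)).Nonempty := by
    rintro i hi ⟨b, hb, hb'⟩
    have h1 := hidx b hb i (abs_le.2 ⟨by push_cast; linarith [hb'.1], by
      push_cast; linarith [hb'.2]⟩)
    omega
  refine ⟨n, p, q, hn, hp0, hq0, hpq, ?_, by linarith, ?_, ?_, ?_⟩
  · by_contra! hc
    rcases le_total (n * (q - p)) (2 * ∑ s, volume.real (gridRow n S (3 * w) s)) with h | h
    · rw [min_eq_left h] at hcore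
      linarith
    · rw [min_eq_right h] at hcore
      linarith
  · intro b hb
    obtain ⟨i, hi, hbi⟩ := hcovn b hb
    have := hpq3 i hi (b - i * v) ((hmemR _ _).2 ⟨by simpa using hb, hbi⟩)
    exact ⟨i, hi, by linarith, by linarith⟩
  · intro i hne
    rcases le_or_gt i n with hi | hi
    · rw [hrow_eq i hi] at hne ⊢
      exact hrow i hne
    · exact absurd hne (hrow_gt i hi)
  · have hzero : (B ∩ Icc ((0 : ℕ) * v + p) ((0 : ℕ) * v + q)).Nonempty :=
      ⟨0, hl.1, by simpa using ⟨hp0, hq0⟩⟩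
    refine ⟨(Finset.range (n + 1)).filter fun i : ℕ => (B ∩ Icc (i * v + p) (i * v + q)).Nonempty,
      Finset.filter_subset _ _, ?_, fun i hi => (Finset.mem_filter.1 hi).2⟩
    have hlast : (B ∩ Icc (n * v + p) (n * v + q)).Nonempty :=
      ⟨D, hr.1, by rw [hnv]; constructor <;> linarith⟩
    rw [Finset.range_add_one, Finset.filter_insert, if_pos hlast,
      Finset.card_insert_of_notMem (by simp)]
    have hXsub : X ⊆ ((Finset.range n).filter fun i : ℕ =>
        (B ∩ Icc (i * v + p) (i * v + q)).Nonempty).image fun i : ℕ => (i : ZMod n) := by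
      intro s hs
      obtain ⟨b, hb, i, rfl, hbi⟩ := hXne s hs
      obtain ⟨h0, h1⟩ := hidx b hb i hbi
      lift i to ℕ using h0
      have hbi : |b - i * v| ≤ 3 * w := by exact_mod_cast hbi
      rcases (show i ≤ n by exact_mod_cast h1).eq_or_lt with rfl | hin
      · exact Finset.mem_image.2 ⟨0, Finset.mem_filter.2 ⟨Finset.mem_range.2 hn, hzero⟩, by simp⟩
      · refine Finset.mem_image.2 ⟨i, Finset.mem_filter.2 ⟨Finset.mem_range.2 hin, ?_⟩, by simp⟩
        have := hpq3 i hin.le (b - i * v) ((hmemR _ _).2 ⟨by simpa using hb, hbi⟩)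
        exact ⟨b, hb, by linarith, by linarith⟩
    have h1 := (Finset.card_le_card hXsub).trans Finset.card_image_le
    omega

/-- The linear interpolation of `r` between `a` and `b`. -/
noncomputable def chord (r : ℕ → ℝ) (a b : ℕ) (x : ℝ) : ℝ :=
  r a + (r b - r a) / (b - a) * (x - a)

lemma chord_left (r : ℕ → ℝ) (a b : ℕ) : chord r a b a = r a := by simp [chord]

lemma chord_right (r : ℕ → ℝ) {a b : ℕ} (hab : a < b) : chord r a b b = r b := by
  have : (b - a : ℝ) ≠ 0 := by
    have : (a : ℝ) < b := by exact_mod_cast hab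
    linarith
  unfold chord
  field_simp
  ring

lemma sum_chord (r : ℕ → ℝ) {a b : ℕ} (hab : a < b) :
    2 * ∑ i ∈ Finset.Ico a b, chord r a b i = (b - a) * (r a + r b) + r a - r b := by
  have hsub : ((b - a : ℕ) : ℝ) = b - a := by rw [Nat.cast_sub hab.le]
  have hne : (b - a : ℝ) ≠ 0 := by
    have : (a : ℝ) < b := by exact_mod_cast hab
    linarith
  have hg : ∀ m : ℕ, 2 * ∑ i ∈ Finset.range m, (i : ℝ) = m * (m - 1) := by
    intro m
    induction m with
    | zero => simp
    | succ m ih => rw [Finset.sum_range_succ, mul_add, ih]; push_cast; ring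
  have h1 : ∑ i ∈ Finset.Ico a b, chord r a b i =
      (b - a) * r a + (r b - r a) / (b - a) * ∑ i ∈ Finset.range (b - a), (i : ℝ) := by
    rw [Finset.sum_Ico_eq_sum_range, Finset.mul_sum, ← hsub]
    have : ((b - a : ℕ) : ℝ) * r a = ∑ i ∈ Finset.range (b - a), r a := by simp
    rw [this, ← Finset.sum_add_distrib]
    refine Finset.sum_congr rfl fun i _ => ?_
    rw [chord, hsub]
    push_cast
    ring
  have h2 := hg (b - a)
  rw [hsub] at h2
  have h3 : 2 * ((b - a) * r a + (r b - r a) / (b - a) * ∑ i ∈ Finset.range (b - a), (i : ℝ)) =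
      2 * (b - a) * r a + (r b - r a) / (b - a) * (2 * ∑ i ∈ Finset.range (b - a), (i : ℝ)) := by
    ring
  rw [h1, h3, h2]
  field_simp
  ring

/-- The path in `ℕ × ℕ` going from `(a, a)` to `(a, b)` and then towards `(b, b)`. -/
def edgePath (a b s : ℕ) : ℕ × ℕ := if s < a + b then (a, s - a) else (s - b, b)

lemma sum_edgePath (f : ℕ → ℕ → ℝ) {a b : ℕ} (hab : a < b) :
    ∑ s ∈ Finset.Ico (2 * a) (2 * b), f (edgePath a b s).1 (edgePath a b s).2 =
      ∑ j ∈ Finset.Ico a b, f a j + ∑ i ∈ Finset.Ico a b, f i b := by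
  rw [← Finset.sum_Ico_consecutive _ (show 2 * a ≤ a + b by omega) (show a + b ≤ 2 * b by omega)]
  congr 1
  · rw [Finset.sum_Ico_eq_sum_range, Finset.sum_Ico_eq_sum_range,
      show a + b - 2 * a = b - a by omega]
    refine Finset.sum_congr rfl fun i hi => ?_
    rw [Finset.mem_range] at hi
    rw [edgePath, if_pos (by omega), show 2 * a + i - a = a + i by omega]
  · rw [Finset.sum_Ico_eq_sum_range, Finset.sum_Ico_eq_sum_range,
      show 2 * b - (a + b) = b - a by omega]
    refine Finset.sum_congr rfl fun i hi => ?_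
    rw [edgePath, if_neg (by omega), show a + b + i - b = a + i by omega]

lemma sum_edgePath_add (r : ℕ → ℝ) {a b : ℕ} (hab : a < b) :
    ∑ s ∈ Finset.Ico (2 * a) (2 * b), (r (edgePath a b s).1 + r (edgePath a b s).2) =
      (b - a) * (r a + r b) + 2 * ∑ i ∈ Finset.Ico a b, r i := by
  rw [sum_edgePath (fun i j => r i + r j) hab]
  simp only [Finset.sum_add_distrib, Finset.sum_const, Nat.card_Ico, nsmul_eq_mul,
    Nat.cast_sub hab.le]
  ring

/-- The least concave majorant of `r` on `[a, b]`, together with a monotone path in the square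
`[a, b]²` measuring the distance from `r` to it. -/
structure IsHullPath (r : ℕ → ℝ) (a b : ℕ) (rh : ℕ → ℝ) (P : ℕ → ℕ × ℕ) : Prop where
  add_eq : ∀ s ∈ Finset.Ico (2 * a) (2 * b), (P s).1 + (P s).2 = s
  bounds : ∀ s ∈ Finset.Ico (2 * a) (2 * b),
    a ≤ (P s).1 ∧ (P s).1 ≤ b ∧ a ≤ (P s).2 ∧ (P s).2 ≤ b
  mono : ∀ s, 2 * a ≤ s → s + 1 < 2 * b → (P s).1 ≤ (P (s + 1)).1 ∧ (P s).2 ≤ (P (s + 1)).2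
  sum_eq : ∑ s ∈ Finset.Ico (2 * a) (2 * b), (r (P s).1 + r (P s).2) =
    ∑ i ∈ Finset.Ico a b, (3 * r i + r (i + 1)) + 2 * ∑ i ∈ Finset.Ico a b, (rh i - r i)
  left : rh a = r a
  right : rh b = r b
  le_of_majorant : ∀ c m : ℝ, (∀ j, a ≤ j → j ≤ b → r j ≤ c + m * j) →
    ∀ i, a ≤ i → i ≤ b → rh i ≤ c + m * i
  exists_majorant : ∀ i, a ≤ i → i ≤ b → ∃ c m : ℝ, rh i = c + m * i ∧
    ∀ j, a ≤ j → j ≤ b → r j ≤ c + m * j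

lemma sum_Ico_telescope (D : ℕ → ℝ) {a b : ℕ} (hab : a ≤ b) :
    ∑ i ∈ Finset.Ico a b, D (i + 1) = ∑ i ∈ Finset.Ico a b, D i + D b - D a := by
  have := Finset.sum_Ico_sub D hab
  rw [Finset.sum_sub_distrib] at this
  linarith

lemma isHullPath_edge {r : ℕ → ℝ} {a b : ℕ} (hab : a < b)
    (h : ∀ i, a ≤ i → i ≤ b → r i ≤ chord r a b i) :
    IsHullPath r a b (fun i => chord r a b i) (edgePath a b) where
  add_eq s hs := by
    rw [Finset.mem_Ico] at hs
    unfold edgePath; split_ifs <;> simp <;> omega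
  bounds s hs := by
    rw [Finset.mem_Ico] at hs
    unfold edgePath; split_ifs <;> simp <;> omega
  mono s h1 h2 := by
    unfold edgePath; split_ifs <;> simp <;> omega
  sum_eq := by
    rw [sum_edgePath_add r hab]
    simp only [Finset.sum_add_distrib, Finset.sum_sub_distrib, mul_sub, sum_chord r hab,
      sum_Ico_telescope r hab.le, ← Finset.mul_sum]
    ring
  left := chord_left r a b
  right := chord_right r hab
  le_of_majorant c m hm i hai hib := by
    have h1 := hm a le_rfl hab.le
    have h2 := hm b hab.le le_rfl
    have hab' : (0 : ℝ) < b - a := by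
      have : (a : ℝ) < b := by exact_mod_cast hab
      linarith
    have hai' : (a : ℝ) ≤ i := by exact_mod_cast hai
    have hib' : (i : ℝ) ≤ b := by exact_mod_cast hib
    have e : chord r a b i = (r a * (b - i) + r b * (i - a)) / (b - a) := by
      unfold chord; field_simp; ring
    change chord r a b i ≤ _
    rw [e, div_le_iff₀ hab']
    nlinarith [mul_le_mul_of_nonneg_right h1 (sub_nonneg.2 hib'),
      mul_le_mul_of_nonneg_right h2 (sub_nonneg.2 hai')]
  exists_majorant i hai hib :=
    ⟨r a - (r b - r a) / (b - a) * a, (r b - r a) / (b - a), by simp only [chord]; ring,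
      fun j h1 h2 => (h j h1 h2).trans_eq (by simp only [chord]; ring)⟩

lemma sum_cost_edgePath_le {D : ℕ → ℝ} {cost : ℕ → ℕ → ℝ} {N a b : ℕ} (hab : a < b) (hbN : b ≤ N)
    (h0 : ∀ i, cost i i ≤ 0) (h1 : ∀ i j, i < j → j ≤ N → cost i j ≤ D i + D j)
    (h2 : ∀ i j, i < j → j < N → cost i j ≤ D j)
    (h3 : ∀ i j, 0 < i → i < j → j ≤ N → cost i j ≤ D i) :
    ∑ s ∈ Finset.Ico (2 * a) (2 * b), cost (edgePath a b s).1 (edgePath a b s).2 ≤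
      ∑ i ∈ Finset.Ico a b, (D i + D (i + 1)) := by
  rw [sum_edgePath cost hab, Finset.sum_add_distrib, sum_Ico_telescope D hab.le]
  rw [Finset.sum_eq_sum_Ico_succ_bot hab, Finset.sum_eq_sum_Ico_succ_bot hab (fun i => cost i b),
    Finset.sum_eq_sum_Ico_succ_bot hab D]
  have e1 : ∑ j ∈ Finset.Ico (a + 1) b, cost a j ≤ ∑ j ∈ Finset.Ico (a + 1) b, D j :=
    Finset.sum_le_sum fun j hj => by
      rw [Finset.mem_Ico] at hj
      exact h2 a j (by omega) (by omega)
  have e2 : ∑ j ∈ Finset.Ico (a + 1) b, cost j b ≤ ∑ j ∈ Finset.Ico (a + 1) b, D j :=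
    Finset.sum_le_sum fun j hj => by
      rw [Finset.mem_Ico] at hj
      exact h3 j b (by omega) (by omega) hbN
  linarith [h0 a, h1 a b hab hbN]

lemma IsHullPath.append {r : ℕ → ℝ} {a b m : ℕ} (ham : a < m) (hmb : m < b) {rh₁ rh₂ : ℕ → ℝ}
    {P₁ P₂ : ℕ → ℕ × ℕ} (h₁ : IsHullPath r a m rh₁ P₁) (h₂ : IsHullPath r m b rh₂ P₂)
    {c k : ℝ} (hm : r m = c + k * m) (hr : ∀ j, a ≤ j → j ≤ b → r j ≤ c + k * j) :
    IsHullPath r a b (fun i => if i < m then rh₁ i else rh₂ i)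
      (fun s => if s < 2 * m then P₁ s else P₂ s) where
  add_eq s hs := by
    rw [Finset.mem_Ico] at hs
    split_ifs with h
    · exact h₁.add_eq s (Finset.mem_Ico.2 ⟨by omega, h⟩)
    · exact h₂.add_eq s (Finset.mem_Ico.2 ⟨by omega, by omega⟩)
  bounds s hs := by
    rw [Finset.mem_Ico] at hs
    split_ifs with h
    · have := h₁.bounds s (Finset.mem_Ico.2 ⟨by omega, h⟩)
      omega
    · have := h₂.bounds s (Finset.mem_Ico.2 ⟨by omega, by omega⟩)
      omega
  mono s hs1 hs2 := by
    by_cases h : s + 1 < 2 * m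
    · rw [if_pos h, if_pos (by omega)]
      exact h₁.mono s hs1 h
    · rw [if_neg h]
      split_ifs with h'
      · have e1 := h₁.bounds s (Finset.mem_Ico.2 ⟨by omega, h'⟩)
        have e2 := h₂.bounds (s + 1) (Finset.mem_Ico.2 ⟨by omega, by omega⟩)
        omega
      · exact h₂.mono s (by omega) hs2
  sum_eq := by
    have e1 : ∀ f g : ℕ → ℝ, ∀ x y z : ℕ, x ≤ y → y ≤ z →
        ∑ s ∈ Finset.Ico x z, (if s < y then f s else g s) =
          ∑ s ∈ Finset.Ico x y, f s + ∑ s ∈ Finset.Ico y z, g s := by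
      intro f g x y z hxy hyz
      rw [← Finset.sum_Ico_consecutive _ hxy hyz]
      congr 1
      · refine Finset.sum_congr rfl fun s hs => if_pos (Finset.mem_Ico.1 hs).2
      · refine Finset.sum_congr rfl fun s hs => if_neg (by have := (Finset.mem_Ico.1 hs).1; omega)
    have e2 : ∀ s, (r (if s < 2 * m then P₁ s else P₂ s).1 + r (if s < 2 * m then P₁ s else P₂ s).2)
        = if s < 2 * m then r (P₁ s).1 + r (P₁ s).2 else r (P₂ s).1 + r (P₂ s).2 := by
      intro s; split_ifs <;> rfl
    have e3 : ∀ i, (if i < m then rh₁ i else rh₂ i) - r i =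
        if i < m then rh₁ i - r i else rh₂ i - r i := by
      intro s; split_ifs <;> rfl
    simp only [e2, e3]
    rw [e1 _ _ _ _ _ (by omega) (by omega), e1 _ _ _ _ _ ham.le hmb.le, h₁.sum_eq, h₂.sum_eq,
      ← Finset.sum_Ico_consecutive _ ham.le hmb.le]
    ring
  left := by simp [ham, h₁.left]
  right := by simp [hmb.not_gt, h₂.right]
  le_of_majorant c' k' h i hai hib := by
    split_ifs with him
    · exact h₁.le_of_majorant c' k' (fun j h1 h2 => h j h1 (by omega)) i hai him.le
    · exact h₂.le_of_majorant c' k' (fun j h1 h2 => h j (by omega) h2) i (by omega) hib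
  exists_majorant i hai hib := by
    have hmr : (m : ℝ) = m := rfl
    rcases lt_trichotomy i m with him | rfl | him
    · obtain ⟨c', k', he, hmaj⟩ := h₁.exists_majorant i hai him.le
      refine ⟨c', k', by simp only [if_pos him, he], fun j h1 h2 => ?_⟩
      rcases le_or_gt j m with hjm | hjm
      · exact hmaj j h1 hjm
      · have h3 := h₁.le_of_majorant c k (fun j h1 h2 => hr j h1 (by omega)) i hai him.le
        have h4 := hmaj m ham.le le_rfl
        have h5 := hr j h1 h2
        have him' : (i : ℝ) < m := by exact_mod_cast him
        have hjm' : (m : ℝ) < j := by exact_mod_cast hjm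
        rw [he] at h3
        have h6 : 0 ≤ (k' - k) * (m - i) := by linarith
        have h7 : 0 ≤ k' - k := nonneg_of_mul_nonneg_left h6 (by linarith)
        nlinarith [mul_nonneg h7 (sub_nonneg.2 hjm'.le)]
    · exact ⟨c, k, by simp [h₂.left, hm], hr⟩
    · obtain ⟨c', k', he, hmaj⟩ := h₂.exists_majorant i him.le hib
      refine ⟨c', k', by simp only [if_neg him.not_gt, he], fun j h1 h2 => ?_⟩
      rcases le_or_gt m j with hjm | hjm
      · exact hmaj j hjm h2
      · have h3 := h₂.le_of_majorant c k (fun j h1 h2 => hr j (by omega) h2) i him.le hib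
        have h4 := hmaj m le_rfl hmb.le
        have h5 := hr j h1 h2
        have him' : (m : ℝ) < i := by exact_mod_cast him
        have hjm' : (j : ℝ) < m := by exact_mod_cast hjm
        rw [he] at h3
        have h6 : 0 ≤ (k - k') * (i - m) := by linarith
        have h7 : 0 ≤ k - k' := nonneg_of_mul_nonneg_left h6 (by linarith)
        nlinarith [mul_nonneg h7 (sub_nonneg.2 hjm'.le)]

lemma exists_isHullPath (r : ℕ → ℝ) {D : ℕ → ℝ} {cost : ℕ → ℕ → ℝ} {N : ℕ}
    (h0 : ∀ i, cost i i ≤ 0) (h1 : ∀ i j, i < j → j ≤ N → cost i j ≤ D i + D j)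
    (h2 : ∀ i j, i < j → j < N → cost i j ≤ D j)
    (h3 : ∀ i j, 0 < i → i < j → j ≤ N → cost i j ≤ D i) :
    ∀ len a b : ℕ, b - a ≤ len → a < b → b ≤ N → ∃ rh P, IsHullPath r a b rh P ∧
      ∑ s ∈ Finset.Ico (2 * a) (2 * b), cost (P s).1 (P s).2 ≤
        ∑ i ∈ Finset.Ico a b, (D i + D (i + 1)) := by
  intro len
  induction len with
  | zero => intro a b h hab; omega
  | succ len ih =>
    intro a b hlen hab hbN
    by_cases h : ∀ i, a ≤ i → i ≤ b → r i ≤ chord r a b i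
    · exact ⟨_, _, isHullPath_edge hab h, sum_cost_edgePath_le hab hbN h0 h1 h2 h3⟩
    · push Not at h
      obtain ⟨i, hai, hib, hi⟩ := h
      obtain ⟨m, hm, hmax⟩ := (Finset.Icc a b).exists_max_image (fun i => r i - chord r a b i)
        ⟨a, Finset.mem_Icc.2 ⟨le_rfl, hab.le⟩⟩
      rw [Finset.mem_Icc] at hm
      have hpos : 0 < r m - chord r a b m :=
        (sub_pos.2 hi).trans_le (hmax i (Finset.mem_Icc.2 ⟨hai, hib⟩))
      have ham : a < m := by
        refine lt_of_le_of_ne hm.1 ?_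
        rintro rfl
        rw [chord_left] at hpos; linarith
      have hmb : m < b := by
        refine lt_of_le_of_ne hm.2 ?_
        rintro rfl
        rw [chord_right _ hab] at hpos; linarith
      obtain ⟨rh₁, P₁, hP₁, hc₁⟩ := ih a m (by omega) ham (by omega)
      obtain ⟨rh₂, P₂, hP₂, hc₂⟩ := ih m b (by omega) hmb hbN
      refine ⟨_, _, hP₁.append ham hmb hP₂
        (c := r a - (r b - r a) / (b - a) * a + (r m - chord r a b m))
        (k := (r b - r a) / (b - a)) (by simp only [chord]; ring) (fun j hj1 hj2 => ?_), ?_⟩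
      · have := hmax j (Finset.mem_Icc.2 ⟨hj1, hj2⟩)
        have e : r a - (r b - r a) / (b - a) * a + (r m - chord r a b m) +
          (r b - r a) / (b - a) * j = chord r a b j + (r m - chord r a b m) := by
          simp only [chord]; ring
        rw [e]; linarith
      · rw [← Finset.sum_Ico_consecutive _ (show 2 * a ≤ 2 * m by omega)
          (show 2 * m ≤ 2 * b by omega), ← Finset.sum_Ico_consecutive _ ham.le hmb.le]
        refine add_le_add (le_trans (le_of_eq ?_) hc₁) (le_trans (le_of_eq ?_) hc₂)
        · refine Finset.sum_congr rfl fun s hs => ?_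
          rw [if_pos (Finset.mem_Ico.1 hs).2]
        · refine Finset.sum_congr rfl fun s hs => ?_
          rw [if_neg (Finset.mem_Ico.1 hs).1.not_gt]

/-- The convex region between the greatest convex minorant of `l` and the least concave majorant
of `r` over `[0, n]`. -/
def hullRegion (n : ℕ) (l r : ℕ → ℝ) : Set (ℝ × ℝ) :=
  {z | 0 ≤ z.2 ∧ z.2 ≤ n ∧ (∀ c m : ℝ, (∀ j ≤ n, r j ≤ c + m * j) → z.1 ≤ c + m * z.2) ∧
    ∀ c m : ℝ, (∀ j ≤ n, c + m * j ≤ l j) → c + m * z.2 ≤ z.1}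

/-- The linear map `(y, x) ↦ y + v x`. -/
def skewMap (v : ℝ) : (ℝ × ℝ) →ₗ[ℝ] ℝ := LinearMap.fst ℝ ℝ ℝ + v • LinearMap.snd ℝ ℝ ℝ

lemma skewMap_apply (v : ℝ) (z : ℝ × ℝ) : skewMap v z = z.1 + v * z.2 := by simp [skewMap]

lemma convex_hullRegion (n : ℕ) (l r : ℕ → ℝ) : Convex ℝ (hullRegion n l r) := by
  rintro ⟨y, x⟩ ⟨h1, h2, h3, h4⟩ ⟨y', x'⟩ ⟨h1', h2', h3', h4'⟩ a b ha hb hab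
  dsimp only at *
  have hb' : b = 1 - a := by linarith
  subst hb'
  refine ⟨?_, ?_, fun c m h => ?_, fun c m h => ?_⟩ <;>
    simp only [Prod.smul_mk, Prod.mk_add_mk, smul_eq_mul]
  · positivity
  · nlinarith
  · nlinarith [h3 c m h, h3' c m h]
  · nlinarith [h4 c m h, h4' c m h]

lemma image_skewMap_fibre (K : Set (ℝ × ℝ)) (v x : ℝ) :
    skewMap v '' (K ∩ {p | p.2 = x}) = (fun y => v * x + y) '' {y | (y, x) ∈ K} := by
  ext w
  constructor
  · rintro ⟨⟨y, x'⟩, ⟨h1, h2⟩, rfl⟩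
    simp only [mem_ofPred_eq] at h2
    subst h2
    exact ⟨y, h1, by rw [skewMap_apply]; ring⟩
  · rintro ⟨y, hy, rfl⟩
    exact ⟨(y, x), ⟨hy, rfl⟩, by rw [skewMap_apply]; ring⟩

lemma image_skewMap_eq_iUnion (K : Set (ℝ × ℝ)) (v : ℝ) :
    skewMap v '' (K ∩ {p | ∃ n : ℤ, p.2 = (n : ℝ)}) =
      ⋃ n : ℤ, skewMap v '' (K ∩ {p | p.2 = (n : ℝ)}) := by
  rw [← image_iUnion, ← inter_iUnion]
  congr 2
  ext p
  simp

lemma isProperCP11_skewMap {K : Set (ℝ × ℝ)} (hK : Convex ℝ K) {p q v : ℝ} (hv : q - p < v)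
    (hKpq : ∀ z ∈ K, z.1 ∈ Icc p q) : IsProperCP11 K (skewMap v) := by
  have hdisj : ∀ m n : ℤ, m ≠ n → Disjoint (skewMap v '' (K ∩ {p | p.2 = (m : ℝ)}))
      (skewMap v '' (K ∩ {p | p.2 = (n : ℝ)})) := by
    have key : ∀ m n : ℤ, m < n → Disjoint (skewMap v '' (K ∩ {p | p.2 = (m : ℝ)}))
      (skewMap v '' (K ∩ {p | p.2 = (n : ℝ)})) := by
      intro m n hmn
      rw [image_skewMap_fibre, image_skewMap_fibre, Set.disjoint_left]
      rintro _ ⟨y, hy, rfl⟩ ⟨y', hy', he⟩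
      have h1 := hKpq _ hy
      have h2 := hKpq _ hy'
      have hmn' : (m : ℝ) + 1 ≤ n := by exact_mod_cast hmn
      have hv0 : 0 < v := by linarith [h1.1.trans h1.2]
      have := mul_le_mul_of_nonneg_left hmn' hv0.le
      simp only [mem_Icc] at he h1 h2
      linarith [h1.1, h1.2, h2.1, h2.2]
    intro m n hmn
    rcases lt_or_gt_of_ne hmn with h | h
    · exact key m n h
    · exact (key n m h).symm
  refine ⟨hK, fun m n hmn => ?_, ?_⟩
  · rw [(hdisj m n hmn).inter_eq, measure_empty]
  · have hconv : ∀ n : ℤ, Convex ℝ {y : ℝ | (y, (n : ℝ)) ∈ K} := by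
      intro n y hy y' hy' a b ha hb hab
      have := hK hy hy' ha hb hab
      simpa [← add_mul, hab] using this
    rw [image_skewMap_eq_iUnion, measure_iUnion (fun m n h => hdisj m n h)]
    · refine tsum_congr fun n => ?_
      rw [image_skewMap_fibre, image_add_left, measure_preimage_add]
    · intro n
      rw [image_skewMap_fibre, image_add_left]
      exact (hconv n).ordConnected.measurableSet.preimage (measurable_const_add _)

lemma hullRegion_fst_mem {n : ℕ} {l r : ℕ → ℝ} {p q : ℝ} (hl : ∀ j ≤ n, p ≤ l j)
    (hr : ∀ j ≤ n, r j ≤ q) : ∀ z ∈ hullRegion n l r, z.1 ∈ Icc p q := by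
  rintro z ⟨-, -, h3, h4⟩
  exact ⟨by simpa using h4 p 0 (by simpa using hl), by simpa using h3 q 0 (by simpa using hr)⟩

lemma subset_cp11Set_hullRegion {n : ℕ} {l r : ℕ → ℝ} {v : ℝ} {B : Set ℝ}
    (hB : ∀ b ∈ B, ∃ i ≤ n, b ∈ Icc (i * v + l i) (i * v + r i)) :
    B ⊆ cp11Set (hullRegion n l r) (skewMap v) 0 := by
  intro b hb
  obtain ⟨i, hi, h1, h2⟩ := hB b hb
  refine ⟨b, ⟨(b - i * v, i), ⟨⟨?_, ?_, fun c m h => ?_, fun c m h => ?_⟩, i, ?_⟩, ?_⟩, zero_add b⟩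
  · positivity
  · exact Nat.cast_le.2 hi
  · have := h i hi
    dsimp only; linarith
  · have := h i hi
    dsimp only; linarith
  · simp
  · rw [skewMap_apply]; ring

lemma cp11Set_hullRegion_subset {n : ℕ} {l r L R : ℕ → ℝ} {v : ℝ}
    (hR : ∀ i ≤ n, ∃ c m : ℝ, c + m * i ≤ R i ∧ ∀ j ≤ n, r j ≤ c + m * j)
    (hL : ∀ i ≤ n, ∃ c m : ℝ, L i ≤ c + m * i ∧ ∀ j ≤ n, c + m * j ≤ l j) :
    cp11Set (hullRegion n l r) (skewMap v) 0 ⊆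
      ⋃ i ∈ Finset.range (n + 1), Icc (i * v + L i) (i * v + R i) := by
  rintro _ ⟨_, ⟨⟨y, x⟩, ⟨⟨h1, h2, h3, h4⟩, k, hk⟩, rfl⟩, rfl⟩
  dsimp only at hk h1 h2 h3 h4
  subst hk
  obtain ⟨i, rfl⟩ : ∃ i : ℕ, k = i := ⟨k.toNat, by
    rw [Int.toNat_of_nonneg]; exact_mod_cast h1⟩
  have hi : i ≤ n := by exact_mod_cast h2
  simp only [mem_iUnion, Finset.mem_range]
  refine ⟨i, by omega, ?_⟩
  obtain ⟨c, m, e1, e2⟩ := hR i hi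
  obtain ⟨c', m', e3, e4⟩ := hL i hi
  have := h3 c m e2
  have := h4 c' m' e4
  push_cast at *
  rw [skewMap_apply]
  constructor <;> dsimp only <;> linarith

lemma volume_biUnion_Icc_le (n : ℕ) (f g : ℕ → ℝ) (hfg : ∀ i ≤ n, f i ≤ g i) :
    volume (⋃ i ∈ Finset.range (n + 1), Icc (f i) (g i)) ≤
      ENNReal.ofReal (∑ i ∈ Finset.range (n + 1), (g i - f i)) := by
  refine (measure_biUnion_finset_le _ _).trans ?_
  rw [ENNReal.ofReal_sum_of_nonneg]
  · exact Finset.sum_le_sum fun i _ => by rw [Real.volume_Icc]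
  · intro i hi
    rw [Finset.mem_range] at hi
    linarith [hfg i (by omega)]

lemma injOn_add_of_monotone_path {ι f g : ℕ → ℕ} {N M : ℕ} (hι : StrictMonoOn ι (Iic N))
    (hbd : ∀ x ∈ Finset.range M, f x ≤ N ∧ g x ≤ N)
    (hadd : ∀ x ∈ Finset.range M, f x + g x = x)
    (hmono : ∀ x, x + 1 < M → f x ≤ f (x + 1) ∧ g x ≤ g (x + 1)) :
    StrictMonoOn (fun x => ι (f x) + ι (g x)) (Finset.range M) := by
  have hm : ∀ x y, x ≤ y → y < M → f x ≤ f y ∧ g x ≤ g y := by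
    intro x y hxy
    induction y, hxy using Nat.le_induction with
    | base => intro _; exact ⟨le_rfl, le_rfl⟩
    | succ y hxy ih =>
      intro h
      have h1 := ih (by omega)
      have h2 := hmono y h
      omega
  intro x hx y hy hxy
  have hx' : x ∈ Finset.range M := hx
  have hy' : y ∈ Finset.range M := hy
  obtain ⟨h1, h2⟩ := hm x y hxy.le (Finset.mem_range.1 hy)
  have e1 := hadd x hx'
  have e2 := hadd y hy'
  obtain ⟨b1, b2⟩ := hbd x hx'
  obtain ⟨b3, b4⟩ := hbd y hy'
  dsimp only
  rcases h1.lt_or_eq with h | h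
  · exact add_lt_add_of_lt_of_le (hι (mem_Iic.2 b1) (mem_Iic.2 b3) h)
      (hι.monotoneOn (mem_Iic.2 b2) (mem_Iic.2 b4) h2)
  · exact add_lt_add_of_le_of_lt (hι.monotoneOn (mem_Iic.2 b1) (mem_Iic.2 b3) h1)
      (hι (mem_Iic.2 b2) (mem_Iic.2 b4) (by omega))

lemma sum_range_half_add (a : ℕ → ℝ) (N : ℕ) :
    ∑ s ∈ Finset.range (2 * N + 1), (a (s / 2) + a ((s + 1) / 2)) =
      4 * ∑ i ∈ Finset.range (N + 1), a i - (a 0 + a N) := by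
  induction N with
  | zero => simp; ring
  | succ N ih =>
    rw [show 2 * (N + 1) + 1 = 2 * N + 1 + 1 + 1 by ring, Finset.sum_range_succ,
      Finset.sum_range_succ, ih, Finset.sum_range_succ _ (N + 1),
      show (2 * N + 1) / 2 = N by omega, show (2 * N + 1 + 1) / 2 = N + 1 by omega,
      show (2 * N + 1 + 1 + 1) / 2 = N + 1 by omega]
    ring

/-- `β` bounds the total mass of any family of pairs of rows with distinct index sums. -/
def PairBound (N : ℕ) (ι : ℕ → ℕ) (a : ℕ → ℝ) (β : ℝ) : Prop :=
  ∀ (X : Finset ℕ) (f g : ℕ → ℕ), (∀ x ∈ X, f x ≤ N ∧ g x ≤ N) →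
    InjOn (fun x => ι (f x) + ι (g x)) X → ∑ x ∈ X, (a (f x) + a (g x)) ≤ β

lemma PairBound.four_mul_sum_le {N : ℕ} {ι : ℕ → ℕ} {a : ℕ → ℝ} {β : ℝ}
    (h : PairBound N ι a β) (hι : StrictMonoOn ι (Iic N)) :
    4 * ∑ i ∈ Finset.range (N + 1), a i - (a 0 + a N) ≤ β := by
  rw [← sum_range_half_add]
  refine h _ _ _ (fun x hx => ?_) (injOn_add_of_monotone_path hι (fun x hx => ?_)
    (fun x hx => ?_) (fun x hx => ?_)).injOn
  all_goals try rw [Finset.mem_range] at hx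
  all_goals omega

lemma PairBound.two_mul_sum_le {N : ℕ} {ι : ℕ → ℕ} {a : ℕ → ℝ} {β : ℝ}
    (h : PairBound N ι a β) (hι : StrictMonoOn ι (Iic N)) (hN : 0 < N) :
    2 * ∑ i ∈ Finset.range (N + 1), a i + N * (a 0 + a N) ≤ β := by
  have h1 := sum_edgePath_add a hN
  have h2 : ∑ s ∈ Finset.range (2 * N + 1), (a (edgePath 0 N s).1 + a (edgePath 0 N s).2) =
      2 * ∑ i ∈ Finset.range (N + 1), a i + N * (a 0 + a N) := by
    rw [Finset.sum_range_succ, Finset.sum_range_succ]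
    rw [mul_zero, ← Finset.range_eq_Ico, ← Finset.range_eq_Ico] at h1
    rw [h1]
    have : edgePath 0 N (2 * N) = (N, N) := by
      rw [edgePath, if_neg (by omega), show 2 * N - N = N by omega]
    rw [this]
    push_cast
    ring
  rw [← h2]
  have hP : ∀ x, (x < N → edgePath 0 N x = (0, x)) ∧ (N ≤ x → edgePath 0 N x = (x - N, N)) :=
    fun x => ⟨fun h => by rw [edgePath, if_pos (by omega), Nat.sub_zero],
      fun h => by rw [edgePath, if_neg (by omega)]⟩
  refine h _ _ _ (fun x hx => ?_) (injOn_add_of_monotone_path hι (fun x hx => ?_)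
    (fun x hx => ?_) (fun x hx => ?_)).injOn
  all_goals try rw [Finset.mem_range] at hx
  · rcases lt_or_ge x N with h' | h'
    · rw [(hP x).1 h']; simp; omega
    · rw [(hP x).2 h']; simp; omega
  · rcases lt_or_ge x N with h' | h'
    · rw [(hP x).1 h']; simp; omega
    · rw [(hP x).2 h']; simp; omega
  · rcases lt_or_ge x N with h' | h'
    · rw [(hP x).1 h']; simp
    · rw [(hP x).2 h']; simp; omega
  · rcases lt_or_ge (x + 1) N with h' | h'
    · rw [(hP x).1 (by omega), (hP _).1 h']; simp
    · rcases lt_or_ge x N with h'' | h''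
      · rw [(hP x).1 h'', (hP _).2 h']; simp; omega
      · rw [(hP x).2 h'', (hP _).2 h']; simp; omega

/-- The hull of the masses is close to the masses. -/
lemma PairBound.chord_le {N : ℕ} {ι : ℕ → ℕ} {a : ℕ → ℝ} {β : ℝ}
    (h : PairBound N ι a β) (hι : StrictMonoOn ι (Iic N)) (hN : 0 < N) {m : ℕ} (hm : m ≤ N) :
    2 * (chord a 0 N m - a m) ≤ β - 4 * ∑ i ∈ Finset.range (N + 1), a i + (a 0 + a N) := by
  obtain ⟨rh, P, hP, -⟩ := exists_isHullPath (N := N) a (D := fun _ => 0) (cost := fun _ _ => 0)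
    (by simp) (by simp) (by simp) (by simp) N 0 N (by omega) hN le_rfl
  have hge : ∀ i ≤ N, a i ≤ rh i := by
    intro i hi
    obtain ⟨c, k, he, hmaj⟩ := hP.exists_majorant i (Nat.zero_le _) hi
    rw [he]; exact hmaj i (Nat.zero_le _) hi
  have hch : chord a 0 N m ≤ rh m := by
    obtain ⟨c, k, he, hmaj⟩ := hP.exists_majorant m (Nat.zero_le _) hm
    rw [he]
    have h1 := hmaj 0 le_rfl (Nat.zero_le _)
    have h2 := hmaj N (Nat.zero_le _) le_rfl
    have hN' : (0 : ℝ) < N := by exact_mod_cast hN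
    have hm' : (m : ℝ) ≤ N := by exact_mod_cast hm
    have e : chord a 0 N m = (a 0 * (N - m) + a N * m) / N := by
      unfold chord; simp only [Nat.cast_zero, sub_zero]; field_simp; ring
    rw [e, div_le_iff₀ hN']
    push_cast at h1
    nlinarith [mul_le_mul_of_nonneg_right h1 (sub_nonneg.2 hm'),
      mul_le_mul_of_nonneg_right h2 (Nat.cast_nonneg (α := ℝ) m)]
  have hsum : rh m - a m ≤ ∑ i ∈ Finset.Ico 0 N, (rh i - a i) := by
    rcases hm.lt_or_eq with hm | rfl
    · exact Finset.single_le_sum (f := fun i => rh i - a i)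
        (fun i hi => sub_nonneg.2 (hge i (Finset.mem_Ico.1 hi).2.le))
        (Finset.mem_Ico.2 ⟨Nat.zero_le _, hm⟩)
    · rw [hP.right, sub_self]
      exact Finset.sum_nonneg fun i hi => sub_nonneg.2 (hge i (Finset.mem_Ico.1 hi).2.le)
  set Q : ℕ → ℕ × ℕ := fun s => if s < 2 * N then P s else (N, N) with hQ
  have hQ1 : ∀ s, s < 2 * N → Q s = P s := fun s hs => if_pos hs
  have hQ2 : Q (2 * N) = (N, N) := if_neg (lt_irrefl _)
  have hb := h (Finset.range (2 * N + 1)) (fun s => (Q s).1) (fun s => (Q s).2) ?_ ?_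
  · have e1 : ∑ s ∈ Finset.range (2 * N + 1), (a (Q s).1 + a (Q s).2) =
        4 * ∑ i ∈ Finset.range (N + 1), a i - (a 0 + a N) +
          2 * ∑ i ∈ Finset.Ico 0 N, (rh i - a i) := by
      rw [Finset.sum_range_succ, hQ2]
      have e2 : ∑ s ∈ Finset.range (2 * N), (a (Q s).1 + a (Q s).2) =
          ∑ s ∈ Finset.Ico (2 * 0) (2 * N), (a (P s).1 + a (P s).2) := by
        rw [mul_zero, ← Finset.range_eq_Ico]
        exact Finset.sum_congr rfl fun s hs => by rw [hQ1 s (Finset.mem_range.1 hs)]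
      rw [e2, hP.sum_eq, Finset.sum_add_distrib, ← Finset.mul_sum,
        sum_Ico_telescope a (Nat.zero_le N), Finset.sum_range_succ, Finset.range_eq_Ico]
      ring
    rw [e1] at hb
    linarith
  · intro x hx
    rw [Finset.mem_range] at hx
    rcases (Nat.lt_succ_iff.1 hx).lt_or_eq with hx | rfl
    · have := hP.bounds x (Finset.mem_Ico.2 ⟨by omega, hx⟩)
      rw [hQ1 x hx]; omega
    · rw [hQ2]; simp
  · refine (injOn_add_of_monotone_path hι (fun x hx => ?_) (fun x hx => ?_) (fun x hx => ?_)).injOn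
    · rw [Finset.mem_range] at hx
      rcases (Nat.lt_succ_iff.1 hx).lt_or_eq with hx | rfl
      · have := hP.bounds x (Finset.mem_Ico.2 ⟨by omega, hx⟩)
        rw [hQ1 x hx]; omega
      · rw [hQ2]; simp
    · rw [Finset.mem_range] at hx
      rcases (Nat.lt_succ_iff.1 hx).lt_or_eq with hx | rfl
      · have := hP.add_eq x (Finset.mem_Ico.2 ⟨by omega, hx⟩)
        rw [hQ1 x hx]; omega
      · rw [hQ2]; simp; omega
    · rcases (show x + 1 ≤ 2 * N by omega).lt_or_eq with hx' | hx'
      · rw [hQ1 x (by omega), hQ1 _ hx']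
        exact hP.mono x (by omega) hx'
      · have := hP.bounds x (Finset.mem_Ico.2 ⟨by omega, by omega⟩)
        rw [hQ1 x (by omega), hx', hQ2]
        omega

lemma PairBound.add_le_of_gap_ne {N : ℕ} {ι : ℕ → ℕ} {a : ℕ → ℝ} {β : ℝ}
    (h : PairBound N ι a β) (hι : StrictMonoOn ι (Iic N)) {m : ℕ} (hm : m + 2 ≤ N)
    (hne : ι m + ι (m + 2) ≠ 2 * ι (m + 1)) :
    a m + a (m + 2) ≤ β - 4 * ∑ i ∈ Finset.range (N + 1), a i + (a 0 + a N) := by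
  set f : ℕ → ℕ := fun s => if s = 2 * N + 1 then m else s / 2 with hf
  set g : ℕ → ℕ := fun s => if s = 2 * N + 1 then m + 2 else (s + 1) / 2 with hg
  have hf1 : ∀ s, s < 2 * N + 1 → f s = s / 2 := fun s hs => if_neg hs.ne
  have hg1 : ∀ s, s < 2 * N + 1 → g s = (s + 1) / 2 := fun s hs => if_neg hs.ne
  have hf2 : f (2 * N + 1) = m := if_pos rfl
  have hg2 : g (2 * N + 1) = m + 2 := if_pos rfl
  have hmono : StrictMonoOn (fun x => ι (f x) + ι (g x)) (Finset.range (2 * N + 1)) := by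
    refine injOn_add_of_monotone_path hι (fun x hx => ?_) (fun x hx => ?_) (fun x hx => ?_)
    · rw [Finset.mem_range] at hx
      rw [hf1 x hx, hg1 x hx]; omega
    · rw [Finset.mem_range] at hx
      rw [hf1 x hx, hg1 x hx]; omega
    · rw [hf1 x (by omega), hg1 x (by omega), hf1 _ hx, hg1 _ hx]; omega
  have hnew : ∀ x < 2 * N + 1, ι (f x) + ι (g x) ≠ ι m + ι (m + 2) := by
    intro x hx he
    have i1 : ι m < ι (m + 1) :=
      hι (mem_Iic.2 (by omega)) (mem_Iic.2 (by omega)) (Nat.lt_succ_self _)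
    have i2 : ι (m + 1) < ι (m + 2) :=
      hι (mem_Iic.2 (by omega)) (mem_Iic.2 (by omega)) (Nat.lt_succ_self _)
    have v1 : ι (f (2 * m + 1)) + ι (g (2 * m + 1)) = ι m + ι (m + 1) := by
      rw [hf1 _ (by omega), hg1 _ (by omega), show (2 * m + 1) / 2 = m by omega,
        show (2 * m + 1 + 1) / 2 = m + 1 by omega]
    have v2 : ι (f (2 * m + 2)) + ι (g (2 * m + 2)) = ι (m + 1) + ι (m + 1) := by
      rw [hf1 _ (by omega), hg1 _ (by omega), show (2 * m + 2) / 2 = m + 1 by omega,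
        show (2 * m + 2 + 1) / 2 = m + 1 by omega]
    have v3 : ι (f (2 * m + 3)) + ι (g (2 * m + 3)) = ι (m + 1) + ι (m + 2) := by
      rw [hf1 _ (by omega), hg1 _ (by omega), show (2 * m + 3) / 2 = m + 1 by omega,
        show (2 * m + 3 + 1) / 2 = m + 2 by omega]
    have hlt : ∀ y z, y < 2 * N + 1 → z < 2 * N + 1 →
        ι (f y) + ι (g y) < ι (f z) + ι (g z) → y < z := by
      intro y z hy hz hyz
      by_contra hcon
      have := hmono.monotoneOn (Finset.mem_coe.2 (Finset.mem_range.2 hz))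
        (Finset.mem_coe.2 (Finset.mem_range.2 hy)) (not_lt.1 hcon)
      omega
    have c1 := hlt (2 * m + 1) x (by omega) hx (by omega)
    have c2 := hlt x (2 * m + 3) hx (by omega) (by omega)
    obtain rfl : x = 2 * m + 2 := by omega
    omega
  have hb := h (Finset.range (2 * N + 1 + 1)) f g ?_ ?_
  · rw [Finset.sum_range_succ, hf2, hg2] at hb
    have : ∑ x ∈ Finset.range (2 * N + 1), (a (f x) + a (g x)) =
        4 * ∑ i ∈ Finset.range (N + 1), a i - (a 0 + a N) := by
      rw [← sum_range_half_add]
      refine Finset.sum_congr rfl fun s hs => ?_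
      rw [hf1 s (Finset.mem_range.1 hs), hg1 s (Finset.mem_range.1 hs)]
    rw [this] at hb
    linarith
  · intro x hx
    rw [Finset.mem_range] at hx
    rcases (Nat.lt_succ_iff.1 hx).lt_or_eq with hx | rfl
    · rw [hf1 x hx, hg1 x hx]; omega
    · rw [hf2, hg2]; omega
  · rw [Finset.range_add_one, Finset.coe_insert, injOn_insert (by simp)]
    refine ⟨hmono.injOn, ?_⟩
    rintro ⟨x, hx, he⟩
    refine hnew x (Finset.mem_range.1 hx) ?_
    dsimp only at he
    rw [he, hf2, hg2]

lemma PairBound.le_mul {N : ℕ} {ι : ℕ → ℕ} {a : ℕ → ℝ} {β : ℝ}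
    (h : PairBound N ι a β) (hι : StrictMonoOn ι (Iic N)) (hN : 0 < N) :
    (4 * N + 2) * ∑ i ∈ Finset.range (N + 1), a i ≤ (N + 1) * β := by
  have h1 := h.four_mul_sum_le hι
  have h2 := h.two_mul_sum_le hι hN
  have hN' : (0 : ℝ) < N := by exact_mod_cast hN
  nlinarith [mul_le_mul_of_nonneg_left h1 hN'.le]

/-- Numerical information on the masses of the rows when `β` is close to its lower bound:
`e` bounds the total loss. -/
lemma PairBound.estimates {N : ℕ} {ι : ℕ → ℕ} {a : ℕ → ℝ} {β S ε : ℝ}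
    (h : PairBound N ι a β) (hι : StrictMonoOn ι (Iic N)) (hN : 0 < N) (ha : ∀ i ≤ N, 0 ≤ a i)
    (hS : S = ∑ i ∈ Finset.range (N + 1), a i) (hS0 : 0 < S)
    (hβ : (N + 1) * β = (4 * N + 2) * S + (N + 1) * ε) (hε : 4 * (N + 1) ^ 2 * ε ≤ S) :
    0 ≤ ε ∧ 0 ≤ β - 4 * S + (a 0 + a N) ∧ N * (β - 4 * S + (a 0 + a N)) ≤ (N + 1) * ε ∧
      β - 4 * S + (a 0 + a N) ≤ 2 * ε ∧
      β - 2 * S - N * (a 0 + a N) ≤ (N + 1) * ε ∧ 0 ≤ β - 2 * S - N * (a 0 + a N) ∧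
      7 * N * ε < a 0 + a N ∧ ∀ m, 0 < m → m < N → 6 * ε < a m := by
  have h0 := h.le_mul hι hN
  have h1 := h.four_mul_sum_le hι
  have h2 := h.two_mul_sum_le hι hN
  have h3 := fun m hm => h.chord_le hι hN (m := m) hm
  rw [← hS] at h0 h1 h2
  simp only [← hS] at h3
  have hN' : (1 : ℝ) ≤ N := by exact_mod_cast hN
  set σ := a 0 + a N with hσ
  have hε0 : 0 ≤ ε := by
    have : 0 ≤ (N + 1) * ε := by linarith
    exact nonneg_of_mul_nonneg_right this (by positivity)
  have hE1 : 0 ≤ β - 4 * S + σ := by linarith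
  have hE2 : 0 ≤ β - 2 * S - N * σ := by linarith
  have hsum : N * (β - 4 * S + σ) + (β - 2 * S - N * σ) = (N + 1) * ε := by linarith
  have hE1' : N * (β - 4 * S + σ) ≤ (N + 1) * ε := by linarith
  have hE1'' : β - 4 * S + σ ≤ 2 * ε := by
    have : N * (β - 4 * S + σ) ≤ N * (2 * ε) := by nlinarith
    exact le_of_mul_le_mul_left this (by linarith)
  have hE2' : β - 2 * S - N * σ ≤ (N + 1) * ε := by nlinarith
  have hσeq : (N + 1) * σ = (β - 4 * S + σ) - (β - 2 * S - N * σ) + 2 * S := by ring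
  have hσ7 : 7 * N * ε < σ := by
    have : (N + 1) * (7 * N * ε) < (N + 1) * σ := by
      rw [hσeq]
      nlinarith [mul_nonneg hε0 (by linarith : (0 : ℝ) ≤ N)]
    exact lt_of_mul_lt_mul_left this (by linarith)
  refine ⟨hε0, hE1, hE1', hE1'', hE2', hE2, hσ7, fun m hm0 hmN => ?_⟩
  have h4 := h3 m hmN.le
  have hm0' : (1 : ℝ) ≤ m := by exact_mod_cast hm0
  have hmN' : (m : ℝ) + 1 ≤ N := by exact_mod_cast hmN
  have hch : σ ≤ N * chord a 0 N m := by
    have : N * chord a 0 N m = a 0 * (N - m) + a N * m := by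
      unfold chord; simp only [Nat.cast_zero, sub_zero]; field_simp; ring
    rw [this]
    nlinarith [ha 0 (Nat.zero_le _), ha N le_rfl]
  have : 7 * ε < chord a 0 N m := by
    have : N * (7 * ε) < N * chord a 0 N m := by linarith
    exact lt_of_mul_lt_mul_left this (by linarith)
  linarith

lemma PairBound.eq_id {N n : ℕ} {ι : ℕ → ℕ} {a : ℕ → ℝ} {β S ε : ℝ}
    (h : PairBound N ι a β) (hι : StrictMonoOn ι (Iic N)) (hN : 0 < N) (ha : ∀ i ≤ N, 0 ≤ a i)
    (hS : S = ∑ i ∈ Finset.range (N + 1), a i) (hS0 : 0 < S)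
    (hβ : (N + 1) * β = (4 * N + 2) * S + (N + 1) * ε) (hε : 4 * (N + 1) ^ 2 * ε ≤ S)
    (hι0 : ι 0 = 0) (hιN : ι N = n) (hn : 2 * n + 3 < 3 * (N + 1)) :
    ∀ i ≤ N, ι i = i := by
  obtain ⟨hε0, hE1, -, hE1', -, -, hσ, ham⟩ := h.estimates hι hN ha hS hS0 hβ hε
  have hgap : ∀ m, m + 2 ≤ N → ι m + ι (m + 2) = 2 * ι (m + 1) := by
    intro m hm
    by_contra hne
    have h1 := h.add_le_of_gap_ne hι hm hne
    rw [← hS] at h1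
    rcases Nat.eq_zero_or_pos m with rfl | hm0
    · rcases hm.lt_or_eq with hm' | hm'
      · have := ham (0 + 2) (by omega) hm'
        linarith [ha 0 (by omega)]
      · rw [hm'] at h1
        have hN2 : (2 : ℝ) ≤ N := by
          have : 2 ≤ N := by omega
          exact_mod_cast this
        nlinarith
    · have := ham m hm0 (by omega)
      linarith [ha (m + 2) hm]
  have hlin : ∀ i, i + 1 ≤ N → ι i = ι 1 * i ∧ ι (i + 1) = ι 1 * (i + 1) := by
    intro i
    induction i with
    | zero => intro _; simp [hι0]
    | succ i ih =>
      intro hi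
      obtain ⟨e1, e2⟩ := ih (by omega)
      have e3 := hgap i (by omega)
      refine ⟨e2, ?_⟩
      rw [e1, e2] at e3
      linarith
  obtain ⟨M, rfl⟩ : ∃ M, N = M + 1 := ⟨N - 1, by omega⟩
  have e1 := (hlin M le_rfl).2
  rw [hιN] at e1
  have hpos : ι 0 < ι 1 := hι (mem_Iic.2 (by omega)) (mem_Iic.2 (by omega)) one_pos
  have h1 : ι 1 = 1 := by
    by_contra hcon
    have : 2 * (M + 1) ≤ ι 1 * (M + 1) := Nat.mul_le_mul_right _ (by omega)
    omega
  intro i hi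
  rcases Nat.eq_zero_or_pos i with rfl | hi0
  · exact hι0
  · have := (hlin (i - 1) (by omega)).2
    rw [h1, show i - 1 + 1 = i by omega] at this
    omega

lemma chord_le_line {r : ℕ → ℝ} {a b i : ℕ} (hab : a < b) (hai : a ≤ i) (hib : i ≤ b) {c k : ℝ}
    (h1 : r a ≤ c + k * a) (h2 : r b ≤ c + k * b) : chord r a b i ≤ c + k * i := by
  have hab' : (0 : ℝ) < b - a := by
    have : (a : ℝ) < b := by exact_mod_cast hab
    linarith
  have hai' : (a : ℝ) ≤ i := by exact_mod_cast hai
  have hib' : (i : ℝ) ≤ b := by exact_mod_cast hib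
  have e : chord r a b i = (r a * (b - i) + r b * (i - a)) / (b - a) := by
    unfold chord; field_simp; ring
  rw [e, div_le_iff₀ hab']
  nlinarith [mul_le_mul_of_nonneg_right h1 (sub_nonneg.2 hib'),
    mul_le_mul_of_nonneg_right h2 (sub_nonneg.2 hai')]

lemma IsHullPath.chord_le {r rh : ℕ → ℝ} {a b x y i : ℕ} {P : ℕ → ℕ × ℕ}
    (h : IsHullPath r a b rh P) (hax : a ≤ x) (hxy : x < y) (hyb : y ≤ b) (hxi : x ≤ i)
    (hiy : i ≤ y) : chord r x y i ≤ rh i := by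
  obtain ⟨c, k, he, hmaj⟩ := h.exists_majorant i (by omega) (by omega)
  rw [he]
  exact chord_le_line hxy hxi hiy (hmaj x hax (by omega)) (hmaj y (by omega) hyb)

lemma IsHullPath.self_le {r rh : ℕ → ℝ} {a b i : ℕ} {P : ℕ → ℕ × ℕ}
    (h : IsHullPath r a b rh P) (hai : a ≤ i) (hib : i ≤ b) : r i ≤ rh i := by
  obtain ⟨c, k, he, hmaj⟩ := h.exists_majorant i hai hib
  rw [he]
  exact hmaj i hai hib

/-- A translate of the chord majorises `r`, and the translation is controlled by the area between
the concave majorant and the chord. -/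
lemma IsHullPath.exists_shift {r rh : ℕ → ℝ} {N : ℕ} {P : ℕ → ℕ × ℕ}
    (h : IsHullPath r 0 N rh P) (hN : 0 < N) : ∃ Δ : ℝ, 0 ≤ Δ ∧
      (∀ i ≤ N, r i ≤ chord r 0 N i + Δ) ∧
      N * Δ ≤ 2 * ∑ i ∈ Finset.Ico 0 N, (rh i - chord r 0 N i) := by
  obtain ⟨m, hm, hmax⟩ := (Finset.Icc 0 N).exists_max_image (fun i => r i - chord r 0 N i)
    ⟨0, Finset.mem_Icc.2 ⟨le_rfl, hN.le⟩⟩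
  rw [Finset.mem_Icc] at hm
  have hch0 : chord r 0 N (0 : ℕ) = r 0 := chord_left r 0 N
  have hchN : chord r 0 N N = r N := chord_right r hN
  have hge : ∀ i ∈ Finset.Ico 0 N, 0 ≤ rh i - chord r 0 N i := fun i hi =>
    sub_nonneg.2 (h.chord_le le_rfl hN le_rfl (Nat.zero_le _) (Finset.mem_Ico.1 hi).2.le)
  refine ⟨r m - chord r 0 N m, ?_, fun i hi => ?_, ?_⟩
  · have := hmax 0 (Finset.mem_Icc.2 ⟨le_rfl, hN.le⟩)
    rw [hch0, sub_self] at this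
    exact this
  · have := hmax i (Finset.mem_Icc.2 ⟨Nat.zero_le _, hi⟩)
    linarith
  · rcases Nat.eq_zero_or_pos m with rfl | hm0
    · rw [hch0, sub_self, mul_zero]
      exact mul_nonneg zero_le_two (Finset.sum_nonneg hge)
    rcases hm.2.lt_or_eq with hmN | rfl
    · have e1 := sum_chord r hm0
      have e2 := sum_chord r hmN
      have e3 := sum_chord r hN
      have s1 : ∑ i ∈ Finset.Ico 0 m, chord r 0 m i ≤ ∑ i ∈ Finset.Ico 0 m, rh i :=
        Finset.sum_le_sum fun i hi => by
          rw [Finset.mem_Ico] at hi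
          exact h.chord_le le_rfl hm0 hmN.le hi.1 hi.2.le
      have s2 : ∑ i ∈ Finset.Ico m N, chord r m N i ≤ ∑ i ∈ Finset.Ico m N, rh i :=
        Finset.sum_le_sum fun i hi => by
          rw [Finset.mem_Ico] at hi
          exact h.chord_le hm.1 hmN le_rfl hi.1 hi.2.le
      have s3 := Finset.sum_Ico_consecutive rh hm.1 hmN.le
      have e4 : N * chord r 0 N m = r 0 * (N - m) + r N * m := by
        have : (N : ℝ) ≠ 0 := by positivity
        unfold chord; simp only [Nat.cast_zero, sub_zero]; field_simp; ring
      rw [Finset.sum_sub_distrib, mul_sub, mul_sub, e4, e3]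
      simp only [Nat.cast_zero, sub_zero] at e1 e2 ⊢
      linarith
    · rw [hchN, sub_self, mul_zero]
      exact mul_nonneg zero_le_two (Finset.sum_nonneg hge)

lemma sum_range_half_add' (r : ℕ → ℝ) (N : ℕ) :
    ∑ s ∈ Finset.range (2 * N), (r (s / 2) + r ((s + 1) / 2)) =
      ∑ i ∈ Finset.range N, (3 * r i + r (i + 1)) := by
  induction N with
  | zero => simp
  | succ N ih =>
    rw [show 2 * (N + 1) = 2 * N + 1 + 1 by ring, Finset.sum_range_succ,
      Finset.sum_range_succ, ih, Finset.sum_range_succ _ N,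
      show (2 * N + 1) / 2 = N by omega, show (2 * N + 1 + 1) / 2 = N + 1 by omega,
      show 2 * N / 2 = N by omega]
    ring

/-- The endpoints of the rows are close to their concave majorant. -/
lemma exists_isHullPath_of_cost {N : ℕ} (hN : 0 < N) {r a d e : ℕ → ℝ} {E : ℝ}
    (he0 : ∀ s ≤ 2 * N, 0 ≤ e s) (heE : ∀ s ≤ 2 * N, e s ≤ E)
    (hesum : ∑ s ∈ Finset.range (2 * N), e s ≤ E) (hd : ∀ i ≤ N, 0 ≤ d i)
    (ha : ∀ i, 0 < i → i < N → E < a i) (ha' : E < a 0 ∨ E < a N)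
    (hc : ∀ i j, i ≤ N → j ≤ N →
      min (a j) (r i + r j - (r ((i + j) / 2) + r ((i + j + 1) / 2)) - d j) ≤ e (i + j)) :
    ∃ rh P, IsHullPath r 0 N rh P ∧ 2 * ∑ i ∈ Finset.Ico 0 N, (rh i - r i) ≤
      E + ∑ i ∈ Finset.Ico 0 N, (d i + d (i + 1)) := by
  set cost : ℕ → ℕ → ℝ := fun i j => if i ≤ N ∧ j ≤ N then
    r i + r j - (r ((i + j) / 2) + r ((i + j + 1) / 2)) - e (i + j) else 0 with hcost
  have hcost1 : ∀ i j, i ≤ N → j ≤ N → cost i j =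
    r i + r j - (r ((i + j) / 2) + r ((i + j + 1) / 2)) - e (i + j) :=
    fun i j hi hj => if_pos ⟨hi, hj⟩
  have hj : ∀ i j, i ≤ N → j ≤ N → E < a j → cost i j ≤ d j := by
    intro i j hi hj haj
    rw [hcost1 i j hi hj]
    have h1 := hc i j hi hj
    have h2 := heE (i + j) (by omega)
    rcases min_le_iff.1 h1 with h | h <;> linarith
  have hi : ∀ i j, i ≤ N → j ≤ N → E < a i → cost i j ≤ d i := by
    intro i j hi hj hai
    rw [hcost1 i j hi hj]
    have h1 := hc j i hj hi
    have h2 := heE (i + j) (by omega)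
    rw [add_comm j i] at h1
    rcases min_le_iff.1 h1 with h | h <;> linarith
  have key : ∃ rh P, IsHullPath r 0 N rh P ∧
      ∑ s ∈ Finset.Ico (2 * 0) (2 * N), cost (P s).1 (P s).2 ≤ ∑ i ∈ Finset.Ico 0 N, (d i + d (i + 1)) := by
    refine exists_isHullPath r (fun i => ?_) (fun i j hij hjN => ?_) (fun i j hij hjN => ?_)
      (fun i j h0 hij hjN => ?_) N 0 N (by omega) hN le_rfl
    · by_cases h : i ≤ N
      · rw [hcost1 i i h h, show (i + i) / 2 = i by omega, show (i + i + 1) / 2 = i by omega]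
        linarith [he0 (i + i) (by omega)]
      · rw [hcost]; simp [h]
    · have di := hd i (by omega)
      have dj := hd j hjN
      rcases Nat.eq_zero_or_pos i with rfl | hi0
      · rcases hjN.lt_or_eq with hjN' | rfl
        · linarith [hj 0 j (by omega) hjN (ha j hij hjN')]
        · rcases ha' with h | h
          · linarith [hi 0 j (by omega) hjN h]
          · linarith [hj 0 j (by omega) hjN h]
      · linarith [hi i j (by omega) hjN (ha i hi0 (by omega))]
    · exact hj i j (by omega) hjN.le (ha j (by omega) hjN)
    · exact hi i j (by omega) hjN (ha i h0 (by omega))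
  obtain ⟨rh, P, hP, hsum⟩ := key
  refine ⟨rh, P, hP, ?_⟩
  have e1 : ∑ s ∈ Finset.Ico (2 * 0) (2 * N), cost (P s).1 (P s).2 =
      ∑ s ∈ Finset.Ico (2 * 0) (2 * N), (r (P s).1 + r (P s).2) -
      ∑ s ∈ Finset.Ico (2 * 0) (2 * N), (r (s / 2) + r ((s + 1) / 2)) -
      ∑ s ∈ Finset.Ico (2 * 0) (2 * N), e s := by
    rw [← Finset.sum_sub_distrib, ← Finset.sum_sub_distrib]
    refine Finset.sum_congr rfl fun s hs => ?_
    have h1 := hP.add_eq s hs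
    have h2 := hP.bounds s hs
    rw [hcost1 _ _ h2.2.1 h2.2.2.2, h1]
  rw [e1, hP.sum_eq, mul_zero] at hsum
  simp only [← Finset.range_eq_Ico] at hsum ⊢
  rw [sum_range_half_add'] at hsum
  linarith

/-- The total defect of the rows is small. -/
lemma sum_defect_le {N : ℕ} (hN : 0 < N) {a d e : ℕ → ℝ} {E : ℝ}
    (he0 : ∀ s ≤ 2 * N, 0 ≤ e s)
    (hesum : ∑ s ∈ Finset.range (2 * N + 1), e s ≤ E)
    (ha : ∀ i, 0 < i → i < N → E < a i)
    (ha0 : a 0 ≤ E → a 0 + E < a 1) (haN : a N ≤ E → a N + E < a (N - 1))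
    (ha0' : ∀ i, 0 ≤ a i)
    (h2 : ∀ i ≤ N, min (d i) (a i) ≤ e (2 * i))
    (h4 : ∀ i j, i ≤ N → j ≤ N → (j = i + 1 ∨ i = j + 1) →
      min (a j - a i) (d i - d j) ≤ e (i + j)) :
    d 0 ≤ E ∧ d N ≤ E ∧ ∑ i ∈ Finset.range (N + 1), d i ≤ 3 * E := by
  have hsub : ∀ X : Finset ℕ, X ⊆ Finset.range (2 * N + 1) → ∑ s ∈ X, e s ≤ E := fun X hX =>
    (Finset.sum_le_sum_of_subset_of_nonneg hX fun s hs _ =>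
      he0 s (by rw [Finset.mem_range] at hs; omega)).trans hesum
  have heE : ∀ s ≤ 2 * N, e s ≤ E := fun s hs => by
    simpa using hsub {s} (by simpa using (by omega : s < 2 * N + 1))
  have hbig : ∀ i ≤ N, E < a i → d i ≤ e (2 * i) := by
    intro i hi hai
    have h := h2 i hi
    have := heE (2 * i) (by omega)
    rcases min_le_iff.1 h with h | h <;> linarith
  have hend : ∀ i j, i ≤ N → j ≤ N → (j = i + 1 ∨ i = j + 1) → (a i ≤ E → a i + E < a j) → d i ≤ E := by
    intro i j hi hj hij haij
    rcases le_or_gt (a i) E with h | h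
    · have h1 := haij h
      have h3 := hbig j hj (by linarith [ha0' i])
      have h5 := h4 i j hi hj hij
      have h6 := heE (i + j) (by omega)
      have h7 := hsub {i + j, 2 * j} (by
        intro x hx
        simp only [Finset.mem_insert, Finset.mem_singleton] at hx
        rw [Finset.mem_range]; omega)
      rw [Finset.sum_pair (by omega)] at h7
      rcases min_le_iff.1 h5 with h8 | h8 <;> linarith
    · exact (hbig i hi h).trans (heE _ (by omega))
  have hd0 := hend 0 1 (by omega) (by omega) (by omega) ha0
  have hdN := hend N (N - 1) le_rfl (by omega) (by omega) haN
  refine ⟨hd0, hdN, ?_⟩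
  have hIint : ∑ i ∈ Finset.Ico 1 N, d i ≤ E := by
    calc ∑ i ∈ Finset.Ico 1 N, d i ≤ ∑ i ∈ Finset.Ico 1 N, e (2 * i) :=
          Finset.sum_le_sum fun i hi => by
            rw [Finset.mem_Ico] at hi
            exact hbig i hi.2.le (ha i hi.1 hi.2)
      _ = ∑ s ∈ (Finset.Ico 1 N).image (fun i => 2 * i), e s := by
          rw [Finset.sum_image]
          intro x _ y _ hxy
          dsimp only at hxy
          omega
      _ ≤ E := hsub _ (by
          intro s hs
          rw [Finset.mem_image] at hs
          obtain ⟨i, hi, rfl⟩ := hs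
          rw [Finset.mem_Ico] at hi
          rw [Finset.mem_range]; omega)
  rw [Finset.sum_range_succ, Finset.range_eq_Ico, Finset.sum_eq_sum_Ico_succ_bot hN]
  linarith

/-- The measure of a set extending above `M` is at least that of its part below `M` plus what a
nearly full subset forces above `M`. -/
lemma volume_real_add_min_le_of_subset_Iic {Q Y Z : Set ℝ} {M l r : ℝ} (hZ : volume Z ≠ ⊤)
    (hQZ : Q ⊆ Z) (hQ : Q ⊆ Iic M) (hYZ : Y ⊆ Z) (hY : Y ⊆ Icc l r) :
    volume.real Q + min (volume.real Y) (r - M - (r - l - volume.real Y)) ≤ volume.real Z := by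
  have h1 := measureReal_inter_add_sdiff (s := Z) (measurableSet_Iic (a := M)) hZ
  have h2 := measureReal_inter_add_sdiff (s := Y) (measurableSet_Iic (a := M))
    (measure_ne_top_of_subset hYZ hZ)
  have h3 : volume.real Q ≤ volume.real (Z ∩ Iic M) :=
    measureReal_mono (subset_inter hQZ hQ) (measure_ne_top_of_subset inter_subset_left hZ)
  have h4 : volume.real (Y \ Iic M) ≤ volume.real (Z \ Iic M) :=
    measureReal_mono (sdiff_subset_sdiff_left hYZ) (measure_ne_top_of_subset sdiff_subset hZ)
  have h5 : volume.real (Y ∩ Iic M) ≤ max (M - l) 0 := by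
    have : volume.real (Y ∩ Iic M) ≤ volume.real (Icc l M) :=
      measureReal_mono (fun y hy => ⟨(hY hy.1).1, hy.2⟩) (by rw [Real.volume_Icc]; exact ofReal_ne_top)
    rw [Real.volume_real_Icc] at this
    exact this
  rcases le_total (M - l) 0 with h | h
  · rw [max_eq_right h] at h5
    linarith [min_le_left (volume.real Y) (r - M - (r - l - volume.real Y))]
  · rw [max_eq_left h] at h5
    linarith [min_le_right (volume.real Y) (r - M - (r - l - volume.real Y))]

lemma volume_real_add_min_le_of_subset_Ici {Q Y Z : Set ℝ} {M l r : ℝ} (hZ : volume Z ≠ ⊤)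
    (hQZ : Q ⊆ Z) (hQ : Q ⊆ Ici M) (hYZ : Y ⊆ Z) (hY : Y ⊆ Icc l r) :
    volume.real Q + min (volume.real Y) (M - l - (r - l - volume.real Y)) ≤ volume.real Z := by
  have hneg : ∀ X : Set ℝ, volume.real (-X) = volume.real X := fun X => by
    rw [measureReal_def, measureReal_def, Measure.measure_neg]
  have h := volume_real_add_min_le_of_subset_Iic (Q := -Q) (Y := -Y) (Z := -Z) (M := -M) (l := -r)
    (r := -l) (by rwa [Measure.measure_neg]) (neg_subset_neg.2 hQZ)
    (fun x hx => by have := hQ hx; simp only [mem_Ici, mem_Iic] at *; linarith)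
    (neg_subset_neg.2 hYZ)
    (fun x hx => by have := hY hx; simp only [mem_Icc] at *; constructor <;> linarith)
  simp only [hneg] at h
  have e : -l - -M - (-l - -r - volume.real Y) = M - l - (r - l - volume.real Y) := by ring
  rwa [e] at h

/-- The `i`-th row of `B`. -/
def stripRow (B : Set ℝ) (v p q : ℝ) (i : ℕ) : Set ℝ := B ∩ Icc (i * v + p) (i * v + q)

/-- The part of `B + B` near `s * v`. -/
def stripSum (B : Set ℝ) (v p q : ℝ) (s : ℕ) : Set ℝ :=
  (B + B) ∩ Icc (s * v + 2 * p) (s * v + 2 * q)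

/-- `B` splits into rows near the multiples of `v`. -/
structure IsStrip (B : Set ℝ) (n : ℕ) (v p q : ℝ) : Prop where
  measurable : MeasurableSet B
  finite : volume (B + B) ≠ ⊤
  least : IsLeast B 0
  greatest : IsGreatest B (n * v)
  n_pos : 0 < n
  p_nonpos : p ≤ 0
  q_nonneg : 0 ≤ q
  gap : 2 * (q - p) < v
  cover : ∀ b ∈ B, ∃ i ≤ n, b ∈ Icc (i * v + p) (i * v + q)
  ends : ∀ i, (stripRow B v p q i).Nonempty →
    (∃ l, IsLeast (stripRow B v p q i) l) ∧ ∃ r, IsGreatest (stripRow B v p q i) r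

section IsStrip

variable {B : Set ℝ} {n : ℕ} {v p q : ℝ}

lemma disjoint_Icc_mul {P Q : ℝ} (h : Q - P < v) {i j : ℕ} (hij : i ≠ j) :
    Disjoint (Icc (i * v + P) (i * v + Q)) (Icc (j * v + P) (j * v + Q)) := by
  have key : ∀ i j : ℕ, i < j → Disjoint (Icc (i * v + P) (i * v + Q))
      (Icc (j * v + P) (j * v + Q)) := by
    intro i j hij
    rw [Set.disjoint_left]
    rintro x ⟨h1, h2⟩ ⟨h3, h4⟩
    have hij' : (i : ℝ) + 1 ≤ j := by exact_mod_cast hij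
    have hv : 0 < v := by linarith
    have := mul_le_mul_of_nonneg_right hij' hv.le
    linarith
  rcases lt_or_gt_of_ne hij with h | h
  · exact key i j h
  · exact (key j i h).symm

lemma IsStrip.measurableSet_row (h : IsStrip B n v p q) (i : ℕ) :
    MeasurableSet (stripRow B v p q i) := h.measurable.inter measurableSet_Icc

lemma IsStrip.p_le_q (h : IsStrip B n v p q) : p ≤ q := h.p_nonpos.trans h.q_nonneg

lemma IsStrip.v_pos (h : IsStrip B n v p q) : 0 < v := by linarith [h.gap, h.p_le_q]

lemma IsStrip.sum_stripSum_le (h : IsStrip B n v p q) (T : Finset ℕ) :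
    ∑ s ∈ T, volume.real (stripSum B v p q s) ≤ volume.real (B + B) :=
  sum_volume_inter_le T h.finite (fun _ _ => measurableSet_Icc)
    (fun i _ j _ hij => disjoint_Icc_mul (by linarith [h.gap]) hij)

lemma stripRow_add_subset (i j : ℕ) :
    stripRow B v p q i + stripRow B v p q j ⊆ stripSum B v p q (i + j) := by
  rintro _ ⟨x, hx, y, hy, rfl⟩
  refine ⟨add_mem_add hx.1 hy.1, ?_⟩
  have h1 := hx.2
  have h2 := hy.2
  rw [mem_Icc] at *
  push_cast
  constructor <;> linarith

lemma IsStrip.stripSum_ne_top (h : IsStrip B n v p q) (s : ℕ) : volume (stripSum B v p q s) ≠ ⊤ :=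
  measure_ne_top_of_subset inter_subset_left h.finite

lemma IsStrip.zero_mem_row (h : IsStrip B n v p q) : IsLeast (stripRow B v p q 0) 0 :=
  ⟨⟨h.least.1, by simpa using ⟨h.p_nonpos, h.q_nonneg⟩⟩, fun x hx => h.least.2 hx.1⟩

lemma IsStrip.last_mem_row (h : IsStrip B n v p q) : IsGreatest (stripRow B v p q n) (n * v) :=
  ⟨⟨h.greatest.1, by simpa using ⟨h.p_nonpos, h.q_nonneg⟩⟩, fun x hx => h.greatest.2 hx.1⟩

lemma volume_real_vadd_set (x : ℝ) (X : Set ℝ) : volume.real (x +ᵥ X) = volume.real X := by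
  rw [measureReal_def, measureReal_def, measure_vadd]

lemma IsStrip.add_le (h : IsStrip B n v p q) {i j : ℕ} (hi : (stripRow B v p q i).Nonempty)
    (hj : (stripRow B v p q j).Nonempty) :
    volume.real (stripRow B v p q i) + volume.real (stripRow B v p q j) ≤
      volume.real (stripSum B v p q (i + j)) :=
  (volume_real_add_le (h.measurableSet_row i) (h.measurableSet_row j) hi hj
    (measure_ne_top_of_subset (stripRow_add_subset i j) (h.stripSum_ne_top _))).trans
    (measureReal_mono (stripRow_add_subset i j) (h.stripSum_ne_top _))

lemma IsStrip.self_add_le (h : IsStrip B n v p q) {i : ℕ} {l r : ℝ}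
    (hl : IsLeast (stripRow B v p q i) l) (hr : IsGreatest (stripRow B v p q i) r) :
    volume.real (stripRow B v p q i) + min (r - l) (2 * volume.real (stripRow B v p q i)) ≤
      volume.real (stripSum B v p q (2 * i)) := by
  rw [two_mul i]
  exact (volume_add_self_ge (h.measurableSet_row i) hl hr).trans
    (measureReal_mono (stripRow_add_subset i i) (h.stripSum_ne_top _))

/-- Placing a translate of row `j` by the right end of row `i` beyond a pair of rows. -/
lemma IsStrip.add_min_le_right (h : IsStrip B n v p q) {i j : ℕ} {l r r' M : ℝ} {Q : Set ℝ}
    (hr' : r' ∈ stripRow B v p q i)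
    (hl : IsLeast (stripRow B v p q j) l) (hr : IsGreatest (stripRow B v p q j) r)
    (hQ : Q ⊆ stripSum B v p q (i + j)) (hQM : Q ⊆ Iic M) :
    volume.real Q + min (volume.real (stripRow B v p q j))
      (r' + r - M - (r - l - volume.real (stripRow B v p q j))) ≤
      volume.real (stripSum B v p q (i + j)) := by
  have := volume_real_add_min_le_of_subset_Iic (Q := Q) (Y := r' +ᵥ stripRow B v p q j)
    (l := r' + l) (r := r' + r) (h.stripSum_ne_top (i + j)) hQ hQM
    ((by rintro _ ⟨x, hx, rfl⟩; exact ⟨r', hr', x, hx, rfl⟩ :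
      r' +ᵥ stripRow B v p q j ⊆ _).trans (stripRow_add_subset i j))
    (by
      rintro _ ⟨x, hx, rfl⟩
      have h1 := hl.2 hx
      have h2 := hr.2 hx
      rw [mem_Icc]
      constructor <;> dsimp only [vadd_eq_add] <;> linarith)
  rw [volume_real_vadd_set] at this
  have e : r' + r - (r' + l) = r - l := by ring
  rwa [e] at this

lemma IsStrip.add_min_le_left (h : IsStrip B n v p q) {i j : ℕ} {l r l' M : ℝ} {Q : Set ℝ}
    (hl' : l' ∈ stripRow B v p q i)
    (hl : IsLeast (stripRow B v p q j) l) (hr : IsGreatest (stripRow B v p q j) r)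
    (hQ : Q ⊆ stripSum B v p q (i + j)) (hQM : Q ⊆ Ici M) :
    volume.real Q + min (volume.real (stripRow B v p q j))
      (M - (l' + l) - (r - l - volume.real (stripRow B v p q j))) ≤
      volume.real (stripSum B v p q (i + j)) := by
  have := volume_real_add_min_le_of_subset_Ici (Q := Q) (Y := l' +ᵥ stripRow B v p q j)
    (l := l' + l) (r := l' + r) (h.stripSum_ne_top (i + j)) hQ hQM
    ((by rintro _ ⟨x, hx, rfl⟩; exact ⟨l', hl', x, hx, rfl⟩ :
      l' +ᵥ stripRow B v p q j ⊆ _).trans (stripRow_add_subset i j))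
    (by
      rintro _ ⟨x, hx, rfl⟩
      have h1 := hl.2 hx
      have h2 := hr.2 hx
      rw [mem_Icc]
      constructor <;> dsimp only [vadd_eq_add] <;> linarith)
  rw [volume_real_vadd_set] at this
  have e : l' + r - (l' + l) = r - l := by ring
  rwa [e] at this

lemma IsStrip.pairBound (h : IsStrip B n v p q) {N : ℕ} {ι : ℕ → ℕ}
    (hne : ∀ i ≤ N, (stripRow B v p q (ι i)).Nonempty) :
    PairBound N ι (fun i => volume.real (stripRow B v p q (ι i))) (volume.real (B + B)) := by
  intro X f g hX hinj
  calc ∑ x ∈ X, (volume.real (stripRow B v p q (ι (f x))) +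
        volume.real (stripRow B v p q (ι (g x))))
      ≤ ∑ x ∈ X, volume.real (stripSum B v p q (ι (f x) + ι (g x))) :=
        Finset.sum_le_sum fun x hx => h.add_le (hne _ (hX x hx).1) (hne _ (hX x hx).2)
    _ = ∑ s ∈ X.image (fun x => ι (f x) + ι (g x)), volume.real (stripSum B v p q s) := by
        rw [Finset.sum_image hinj]
    _ ≤ volume.real (B + B) := h.sum_stripSum_le _

end IsStrip

lemma exists_strictMonoOn_enum {I : Finset ℕ} {n : ℕ} (hn : 0 < n) (hI : I ⊆ Finset.range (n + 1))
    (h0 : 0 ∈ I) (hnI : n ∈ I) : ∃ (N : ℕ) (ι : ℕ → ℕ), 0 < N ∧ I.card = N + 1 ∧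
      StrictMonoOn ι (Iic N) ∧ ι 0 = 0 ∧ ι N = n ∧ ∀ i, i ∈ I ↔ ∃ j ≤ N, ι j = i := by
  have hc : 1 < I.card := Finset.one_lt_card.2 ⟨0, h0, n, hnI, hn.ne⟩
  obtain ⟨N, hN⟩ : ∃ N, I.card = N + 1 := ⟨I.card - 1, by omega⟩
  set ι : ℕ → ℕ := fun j => if hj : j < N + 1 then I.orderEmbOfFin hN ⟨j, hj⟩ else 0 with hι
  have hι1 : ∀ j (hj : j < N + 1), ι j = I.orderEmbOfFin hN ⟨j, hj⟩ := fun j hj => dif_pos hj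
  have hmono : StrictMonoOn ι (Iic N) := by
    intro x hx y hy hxy
    rw [mem_Iic] at hx hy
    rw [hι1 x (by omega), hι1 y (by omega)]
    exact (I.orderEmbOfFin hN).strictMono hxy
  have hmem : ∀ i, i ∈ I ↔ ∃ j ≤ N, ι j = i := by
    intro i
    have h1 := Finset.range_orderEmbOfFin I hN
    rw [← Finset.mem_coe, ← h1]
    constructor
    · rintro ⟨⟨j, hj⟩, rfl⟩
      exact ⟨j, by omega, hι1 j hj⟩
    · rintro ⟨j, hj, rfl⟩
      exact ⟨⟨j, by omega⟩, (hι1 j (by omega)).symm⟩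
  refine ⟨N, ι, by omega, hN, hmono, ?_, ?_, hmem⟩
  · obtain ⟨j, hj, h⟩ := (hmem 0).1 h0
    have := hmono.monotoneOn (mem_Iic.2 (Nat.zero_le N)) (mem_Iic.2 hj) (Nat.zero_le j)
    omega
  · obtain ⟨j, hj, h⟩ := (hmem n).1 hnI
    have h1 := hmono.monotoneOn (mem_Iic.2 hj) (mem_Iic.2 le_rfl) hj
    have h2 := Finset.mem_range.1 (hI ((hmem (ι N)).2 ⟨N, le_rfl, rfl⟩))
    omega

lemma sum_width_le {N : ℕ} (hN : 0 < N) {w : ℕ → ℝ} {p q : ℝ} (h0 : w 0 ≤ q) (hN' : w N ≤ -p)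
    (hw : ∀ i, 0 < i → i < N → w i ≤ q - p) :
    ∑ i ∈ Finset.range (N + 1), w i ≤ N * (q - p) := by
  obtain ⟨M, rfl⟩ : ∃ M, N = M + 1 := ⟨N - 1, by omega⟩
  rw [Finset.sum_range_succ, Finset.sum_range_succ']
  have : ∑ i ∈ Finset.range M, w (i + 1) ≤ ∑ _i ∈ Finset.range M, (q - p) :=
    Finset.sum_le_sum fun i hi => hw _ (by omega) (by rw [Finset.mem_range] at hi; omega)
  rw [Finset.sum_const, Finset.card_range, nsmul_eq_mul] at this
  push_cast
  linarith

lemma coveredByIntervals_of_real {B : Set ℝ} {N : ℕ} {f g : ℕ → ℝ}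
    (hfg : ∀ i ≤ N, f i ≤ g i) (hB : ∀ b ∈ B, ∃ i ≤ N, b ∈ Icc (f i) (g i))
    (hBf : volume B ≠ ⊤)
    (hsum : ∑ i ∈ Finset.range (N + 1), (g i - f i) < 2 * volume.real B) :
    CoveredByIntervals B (N + 1) := by
  refine ⟨fun i => f i, fun i => g i, fun b hb => ?_, ?_⟩
  · obtain ⟨i, hi, hbi⟩ := hB b hb
    exact mem_iUnion.2 ⟨⟨i, by omega⟩, hbi⟩
  · have e : (⋃ i : Fin (N + 1), Icc (f i) (g i)) = ⋃ i ∈ Finset.range (N + 1), Icc (f i) (g i) := by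
      ext x
      simp only [mem_iUnion, Finset.mem_range]
      exact ⟨fun ⟨i, hi⟩ => ⟨i, i.2, hi⟩, fun ⟨i, h, hi⟩ => ⟨⟨i, h⟩, hi⟩⟩
    rw [e]
    have h2 : 2 * volume B = ENNReal.ofReal (2 * volume.real B) := by
      rw [ENNReal.ofReal_mul zero_le_two, measureReal_def, ENNReal.ofReal_toReal hBf]
      simp
    rw [h2]
    refine (volume_biUnion_Icc_le N f g hfg).trans_lt ?_
    have hpos : 0 ≤ ∑ i ∈ Finset.range (N + 1), (g i - f i) :=
      Finset.sum_nonneg fun i hi => by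
        rw [Finset.mem_range] at hi
        linarith [hfg i (by omega)]
    rw [ENNReal.ofReal_lt_ofReal_iff (by linarith)]
    exact hsum

section IsStrip

variable {B : Set ℝ} {n : ℕ} {v p q : ℝ}

lemma IsStrip.volume_ne_top (h : IsStrip B n v p q) : volume B ≠ ⊤ :=
  measure_ne_top_of_subset (s := Icc 0 (n * v)) (fun x hx => ⟨h.least.2 hx, h.greatest.2 hx⟩)
    (by rw [Real.volume_Icc]; exact ofReal_ne_top)

/-- Bound for the difference of a covering set. -/
lemma volume_sdiff_le_of_subset {B P : Set ℝ} (hB : MeasurableSet B) (hBf : volume B ≠ ⊤)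
    (hBP : B ⊆ P) {x : ℝ} (hx : 0 ≤ x)
    (hP : volume P ≤ ENNReal.ofReal (volume.real B + x)) :
    volume (P \ B) ≤ ENNReal.ofReal x := by
  rw [measure_sdiff hBP hB.nullMeasurableSet hBf]
  rw [ENNReal.ofReal_add measureReal_nonneg hx, measureReal_def, ENNReal.ofReal_toReal hBf] at hP
  rwa [tsub_le_iff_left]

/-- The coarse progression containing a strip. -/
lemma IsStrip.exists_coarse (h : IsStrip B n v p q) (hn : n * (q - p) < 2 * volume.real B) :
    ∃ (K : Set (ℝ × ℝ)) (φ : (ℝ × ℝ) →ₗ[ℝ] ℝ), IsProperCP11 K φ ∧ B ⊆ cp11Set K φ 0 ∧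
      volume (cp11Set K φ 0 \ B) ≤ ENNReal.ofReal (volume.real B) := by
  set l : ℕ → ℝ := fun j => if j = 0 then 0 else p with hl
  set r : ℕ → ℝ := fun j => if j = n then 0 else q with hr
  have hpl : ∀ j, p ≤ l j ∧ l j ≤ 0 := by
    intro j; rw [hl]; dsimp only; split_ifs
    · exact ⟨h.p_nonpos, le_rfl⟩
    · exact ⟨le_rfl, h.p_nonpos⟩
  have hrq : ∀ j, r j ≤ q ∧ 0 ≤ r j := by
    intro j; rw [hr]; dsimp only; split_ifs
    · exact ⟨h.q_nonneg, le_rfl⟩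
    · exact ⟨le_rfl, h.q_nonneg⟩
  have hsub : B ⊆ cp11Set (hullRegion n l r) (skewMap v) 0 := by
    refine subset_cp11Set_hullRegion fun b hb => ?_
    obtain ⟨i, hi, h1, h2⟩ := h.cover b hb
    refine ⟨i, hi, ?_, ?_⟩
    · rw [hl]; dsimp only; split_ifs with h0
      · subst h0; simpa using h.least.2 hb
      · exact h1
    · rw [hr]; dsimp only; split_ifs with h0
      · subst h0; simpa using h.greatest.2 hb
      · exact h2
  refine ⟨hullRegion n l r, skewMap v, isProperCP11_skewMap (convex_hullRegion n l r)
    (by linarith [h.gap, h.p_le_q] : q - p < v)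
    (hullRegion_fst_mem (fun j _ => (hpl j).1) (fun j _ => (hrq j).1)), hsub, ?_⟩
  refine volume_sdiff_le_of_subset h.measurable h.volume_ne_top hsub measureReal_nonneg ?_
  have hn0 : (1 : ℝ) ≤ n := by exact_mod_cast h.n_pos
  refine (measure_mono (cp11Set_hullRegion_subset (L := l) (R := r) (fun i hi => ?_)
    (fun i hi => ?_))).trans ((volume_biUnion_Icc_le n _ _ (fun i _ => ?_)).trans
      (ENNReal.ofReal_le_ofReal ?_))
  · by_cases hin : i = n
    · refine ⟨n * q, -q, ?_, fun j hj => ?_⟩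
      · rw [hr, hin]; simp; linarith
      · rw [hr]; dsimp only; split_ifs with hjn
        · rw [hjn]; linarith
        · have : (j : ℝ) + 1 ≤ n := by
            have : j + 1 ≤ n := by omega
            exact_mod_cast this
          nlinarith [h.q_nonneg]
    · exact ⟨q, 0, by rw [hr]; simp [hin], fun j _ => by simpa using (hrq j).1⟩
  · by_cases hi0 : i = 0
    · refine ⟨0, p, ?_, fun j hj => ?_⟩
      · rw [hl, hi0]; simp
      · rw [hl]; dsimp only; split_ifs with hj0
        · rw [hj0]; simp
        · have : (1 : ℝ) ≤ j := by
            have : 1 ≤ j := by omega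
            exact_mod_cast this
          nlinarith [h.p_nonpos]
    · exact ⟨p, 0, by rw [hl]; simp [hi0], fun j _ => by simpa using (hpl j).1⟩
  · linarith [(hpl i).2, (hrq i).2]
  · have := sum_width_le h.n_pos (w := fun i => i * v + r i - (i * v + l i)) (p := p) (q := q)
      (by have : l 0 = 0 := if_pos rfl
          simp only [this]; linarith [(hrq 0).1])
      (by have : r n = 0 := if_pos rfl
          simp only [this]; linarith [(hpl n).1])
      (fun i _ _ => by linarith [(hrq i).1, (hpl i).1])
    linarith

lemma IsStrip.volume_eq_sum (h : IsStrip B n v p q) {N : ℕ} {ι : ℕ → ℕ}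
    (hι : StrictMonoOn ι (Iic N))
    (hmem : ∀ i ≤ n, (stripRow B v p q i).Nonempty → ∃ j ≤ N, ι j = i) :
    volume.real B = ∑ i ∈ Finset.range (N + 1), volume.real (stripRow B v p q (ι i)) := by
  have e : B = ⋃ i ∈ Finset.range (N + 1), stripRow B v p q (ι i) := by
    ext b
    simp only [mem_iUnion, Finset.mem_range]
    constructor
    · intro hb
      obtain ⟨i, hi, hbi⟩ := h.cover b hb
      obtain ⟨j, hj, rfl⟩ := hmem i hi ⟨b, hb, hbi⟩
      exact ⟨j, by omega, hb, hbi⟩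
    · rintro ⟨i, -, hb⟩
      exact hb.1
  conv_lhs => rw [e]
  refine measureReal_biUnion_finset (fun i hi j hj hij => ?_) (fun i _ => h.measurableSet_row _)
    (fun i _ => measure_ne_top_of_subset inter_subset_left h.volume_ne_top)
  have hne : ι i ≠ ι j := fun he => hij (hι.injOn
    (mem_Iic.2 (by have := Finset.mem_range.1 (Finset.mem_coe.1 hi); omega))
    (mem_Iic.2 (by have := Finset.mem_range.1 (Finset.mem_coe.1 hj); omega)) he)
  exact (disjoint_Icc_mul (by linarith [h.gap, h.p_le_q]) hne).mono inter_subset_right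
    inter_subset_right

end IsStrip

section IsStrip

variable {B : Set ℝ} {n : ℕ} {v p q : ℝ}

lemma IsStrip.exists_hulls (h : IsStrip B n v p q) {S ε E : ℝ} {a : ℕ → ℝ}
    (ha : ∀ i, a i = volume.real (stripRow B v p q i))
    (hne : ∀ i ≤ n, (stripRow B v p q i).Nonempty)
    (hS : S = ∑ i ∈ Finset.range (n + 1), a i)
    (hE : E = volume.real (B + B) - 4 * S + (a 0 + a n)) (hε0 : 0 ≤ ε)
    (hE2 : E ≤ 2 * ε) (hσ : 7 * n * ε < a 0 + a n) (ham : ∀ m, 0 < m → m < n → 6 * ε < a m) :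
    ∃ (l r rh kh : ℕ → ℝ) (P Q : ℕ → ℕ × ℕ),
      (∀ i ≤ n, IsLeast (stripRow B v p q i) (i * v + l i) ∧
        IsGreatest (stripRow B v p q i) (i * v + r i)) ∧
      IsHullPath r 0 n rh P ∧ IsHullPath (fun i => -l i) 0 n kh Q ∧
      2 * ∑ i ∈ Finset.Ico 0 n, (rh i - r i) ≤ 7 * E ∧
      2 * ∑ i ∈ Finset.Ico 0 n, (kh i - -l i) ≤ 7 * E ∧
      ∑ i ∈ Finset.range (n + 1), (r i - l i) ≤ S + 3 * E ∧
      r 0 - l 0 ≤ a 0 + E ∧ r n - l n ≤ a n + E ∧ a 0 ≤ r 0 - l 0 ∧ a n ≤ r n - l n := by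
  have hends : ∀ i, ∃ l r : ℝ, i ≤ n → IsLeast (stripRow B v p q i) l ∧
      IsGreatest (stripRow B v p q i) r := by
    intro i
    by_cases hi : i ≤ n
    · obtain ⟨⟨l, hl⟩, r, hr⟩ := h.ends i (hne i hi)
      exact ⟨l, r, fun _ => ⟨hl, hr⟩⟩
    · exact ⟨0, 0, fun h => absurd h hi⟩
  choose l' r' hlr using hends
  have hn1 : (1 : ℝ) ≤ n := by exact_mod_cast h.n_pos
  have ha0 : ∀ i, 0 ≤ a i := fun i => by rw [ha]; exact measureReal_nonneg
  set l : ℕ → ℝ := fun i => l' i - i * v with hl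
  set r : ℕ → ℝ := fun i => r' i - i * v with hr
  set d : ℕ → ℝ := fun i => r i - l i - a i with hd
  set e : ℕ → ℝ := fun s => volume.real (stripSum B v p q s) - (a (s / 2) + a ((s + 1) / 2))
    with he
  have hadd : ∀ i j, i ≤ n → j ≤ n → a i + a j ≤ volume.real (stripRow B v p q i +
      stripRow B v p q j) := by
    intro i j hi hj
    rw [ha, ha]
    exact volume_real_add_le (h.measurableSet_row i) (h.measurableSet_row j) (hne i hi) (hne j hj)
      (measure_ne_top_of_subset (stripRow_add_subset i j) (h.stripSum_ne_top _))
  have he0 : ∀ s ≤ 2 * n, 0 ≤ e s := by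
    intro s hs
    have h1 := hadd (s / 2) ((s + 1) / 2) (by omega) (by omega)
    have h2 := measureReal_mono (stripRow_add_subset (B := B) (v := v) (p := p) (q := q) (s / 2)
      ((s + 1) / 2)) (h.stripSum_ne_top _)
    rw [show s / 2 + (s + 1) / 2 = s by omega] at h2
    rw [he]; dsimp only; linarith
  have hesum : ∑ s ∈ Finset.range (2 * n + 1), e s ≤ E := by
    rw [he, Finset.sum_sub_distrib, sum_range_half_add, ← hS]
    linarith [h.sum_stripSum_le (Finset.range (2 * n + 1))]
  have hesum' : ∑ s ∈ Finset.range (2 * n), e s ≤ E := by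
    rw [Finset.sum_range_succ] at hesum
    linarith [he0 (2 * n) le_rfl]
  have heE : ∀ s ≤ 2 * n, e s ≤ E := fun s hs =>
    (Finset.single_le_sum (f := e) (fun i hi => he0 i (by rw [Finset.mem_range] at hi; omega))
      (Finset.mem_range.2 (by omega : s < 2 * n + 1))).trans hesum
  have hd0 : ∀ i ≤ n, 0 ≤ d i := by
    intro i hi
    obtain ⟨h1, h2⟩ := hlr i hi
    have h3 : volume.real (stripRow B v p q i) ≤ volume.real (Icc (l' i) (r' i)) :=
      measureReal_mono (fun x hx => ⟨h1.2 hx, h2.2 hx⟩) (by rw [Real.volume_Icc]; exact ofReal_ne_top)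
    rw [Real.volume_real_Icc_of_le (h1.2 h2.1), ← ha] at h3
    rw [hd]; dsimp only [l, r]; linarith
  have haE : ∀ i, 0 < i → i < n → E < a i := fun i h1 h2 => by linarith [ham i h1 h2]
  have hnε : ε ≤ n * ε := by nlinarith
  have hend : ∀ i j, (i = 0 ∧ j = 1 ∨ i = n ∧ j = n - 1) → a i ≤ E → a i + E < a j := by
    intro i j hij hai
    rcases Nat.lt_or_ge 1 n with hn | hn
    · have := ham j (by omega) (by omega)
      linarith
    · have hn' : n = 1 := by have := h.n_pos; omega
      have h2 : a 0 + a n = a i + a j := by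
        rcases hij with ⟨rfl, rfl⟩ | ⟨rfl, rfl⟩
        · rw [hn']
        · rw [hn']; simp [add_comm]
      linarith
  obtain ⟨hdE0, hdEn, hdsum⟩ := sum_defect_le h.n_pos (a := a) (d := d) he0 hesum haE
    (hend 0 1 (by omega)) (hend n (n - 1) (by omega)) ha0
    (by
      intro i hi
      obtain ⟨h1, h2⟩ := hlr i hi
      have h3 := h.self_add_le h1 h2
      rw [← ha] at h3
      rw [he, hd]
      dsimp only [l, r]
      rw [show 2 * i / 2 = i by omega, show (2 * i + 1) / 2 = i by omega]
      have h4 : min (r' i - i * v - (l' i - i * v) - a i) (a i) =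
          min (r' i - l' i) (2 * a i) - a i := by
        rw [← min_sub_sub_right]; congr 1 <;> ring
      rw [h4]; linarith)
    (by
      intro i j hi hj hij
      obtain ⟨h1, h2⟩ := hlr i hi
      obtain ⟨h3, h4⟩ := hlr j hj
      have h5 := h.add_min_le_right (Q := l' i +ᵥ stripRow B v p q j) (M := l' i + r' j) h2.1 h3 h4
        ((by rintro _ ⟨x, hx, rfl⟩; exact ⟨l' i, h1.1, x, hx, rfl⟩ :
          l' i +ᵥ stripRow B v p q j ⊆ _).trans (stripRow_add_subset i j))
        (by rintro _ ⟨x, hx, rfl⟩; exact add_le_add le_rfl (h4.2 hx))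
      rw [volume_real_vadd_set, ← ha] at h5
      have h6 : a ((i + j) / 2) + a ((i + j + 1) / 2) = a i + a j := by
        rcases hij with rfl | rfl
        · rw [show (i + (i + 1)) / 2 = i by omega, show (i + (i + 1) + 1) / 2 = i + 1 by omega]
        · rw [show (j + 1 + j) / 2 = j by omega, show (j + 1 + j + 1) / 2 = j + 1 by omega,
            add_comm]
      rw [he, hd]
      dsimp only [l, r]
      rw [h6]
      have h7 : min (a j - a i) (r' i - i * v - (l' i - i * v) - a i -
          (r' j - j * v - (l' j - j * v) - a j)) =
          min (a j) (r' i + r' j - (l' i + r' j) - (r' j - l' j - a j)) - a i := by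
        rw [← min_sub_sub_right]; congr 1; ring
      rw [h7]; linarith)
  have haor : E < a 0 ∨ E < a n := by
    by_contra hcon
    push Not at hcon
    linarith
  have hd2 : ∑ i ∈ Finset.Ico 0 n, (d i + d (i + 1)) ≤ 6 * E := by
    rw [Finset.sum_add_distrib, sum_Ico_telescope d (Nat.zero_le n), ← Finset.range_eq_Ico]
    rw [Finset.sum_range_succ] at hdsum
    linarith [hd0 0 (Nat.zero_le n), hd0 n le_rfl]
  obtain ⟨rh, P, hP, hPs⟩ := exists_isHullPath_of_cost h.n_pos (r := r) (a := a) (d := d) he0 heE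
    hesum' hd0 haE haor (by
      intro i j hi hj
      obtain ⟨h1, h2⟩ := hlr i hi
      obtain ⟨h3, h4⟩ := hlr j hj
      obtain ⟨-, h5⟩ := hlr ((i + j) / 2) (by omega)
      obtain ⟨-, h6⟩ := hlr ((i + j + 1) / 2) (by omega)
      have hfg : (i + j) / 2 + (i + j + 1) / 2 = i + j := by omega
      have hsub := stripRow_add_subset (B := B) (v := v) (p := p) (q := q) ((i + j) / 2)
        ((i + j + 1) / 2)
      rw [hfg] at hsub
      have h7 := h.add_min_le_right (M := r' ((i + j) / 2) + r' ((i + j + 1) / 2)) h2.1 h3 h4 hsub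
        (by rintro _ ⟨x, hx, y, hy, rfl⟩; exact add_le_add (h5.2 hx) (h6.2 hy))
      have h8 := hadd ((i + j) / 2) ((i + j + 1) / 2) (by omega) (by omega)
      rw [← ha] at h7
      have hfg' : (((i + j) / 2 : ℕ) : ℝ) + ((i + j + 1) / 2 : ℕ) = i + j := by exact_mod_cast hfg
      have h9 : r i + r j - (r ((i + j) / 2) + r ((i + j + 1) / 2)) - d j =
          r' i + r' j - (r' ((i + j) / 2) + r' ((i + j + 1) / 2)) - (r' j - l' j - a j) := by
        rw [hd, hr, hl]; dsimp only
        linear_combination v * hfg'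
      rw [h9, he]
      dsimp only
      linarith)
  obtain ⟨kh, Q, hQ, hQs⟩ := exists_isHullPath_of_cost h.n_pos (r := fun i => -l i) (a := a) (d := d)
    he0 heE hesum' hd0 haE haor (by
      intro i j hi hj
      obtain ⟨h1, h2⟩ := hlr i hi
      obtain ⟨h3, h4⟩ := hlr j hj
      obtain ⟨h5, -⟩ := hlr ((i + j) / 2) (by omega)
      obtain ⟨h6, -⟩ := hlr ((i + j + 1) / 2) (by omega)
      have hfg : (i + j) / 2 + (i + j + 1) / 2 = i + j := by omega
      have hsub := stripRow_add_subset (B := B) (v := v) (p := p) (q := q) ((i + j) / 2)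
        ((i + j + 1) / 2)
      rw [hfg] at hsub
      have h7 := h.add_min_le_left (M := l' ((i + j) / 2) + l' ((i + j + 1) / 2)) h1.1 h3 h4 hsub
        (by rintro _ ⟨x, hx, y, hy, rfl⟩; exact add_le_add (h5.2 hx) (h6.2 hy))
      have h8 := hadd ((i + j) / 2) ((i + j + 1) / 2) (by omega) (by omega)
      rw [← ha] at h7
      have hfg' : (((i + j) / 2 : ℕ) : ℝ) + ((i + j + 1) / 2 : ℕ) = i + j := by exact_mod_cast hfg
      have h9 : -l i + -l j - (-l ((i + j) / 2) + -l ((i + j + 1) / 2)) - d j =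
          l' ((i + j) / 2) + l' ((i + j + 1) / 2) - (l' i + l' j) - (r' j - l' j - a j) := by
        rw [hd, hr, hl]; dsimp only
        linear_combination -v * hfg'
      rw [h9, he]
      dsimp only
      linarith)
  refine ⟨l, r, rh, kh, P, Q, fun i hi => ?_, hP, hQ, by linarith, by linarith, ?_, ?_, ?_, ?_, ?_⟩
  · rw [hl, hr]; dsimp only
    rw [add_sub_cancel, add_sub_cancel]
    exact hlr i hi
  · have : ∑ i ∈ Finset.range (n + 1), (r i - l i) = ∑ i ∈ Finset.range (n + 1), d i + S := by
      rw [hS, ← Finset.sum_add_distrib]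
      exact Finset.sum_congr rfl fun i _ => by rw [hd]; ring
    linarith
  · rw [hd] at hdE0; dsimp only at hdE0; linarith
  · rw [hd] at hdEn; dsimp only at hdEn; linarith
  · have := hd0 0 (Nat.zero_le n)
    rw [hd] at this; dsimp only at this; linarith
  · have := hd0 n le_rfl
    rw [hd] at this; dsimp only at this; linarith

end IsStrip

lemma two_mul_sum_chord_range (r : ℕ → ℝ) {n : ℕ} (hn : 0 < n) :
    2 * ∑ i ∈ Finset.range (n + 1), chord r 0 n i = (n + 1) * (r 0 + r n) := by
  have h := sum_chord r hn
  rw [← Finset.range_eq_Ico] at h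
  rw [Finset.sum_range_succ, mul_add, h, chord_right r hn]
  push_cast
  ring

section IsStrip

variable {B : Set ℝ} {n : ℕ} {v p q : ℝ}

lemma IsStrip.exists_fine (h : IsStrip B n v p q) {ε E : ℝ} {a : ℕ → ℝ}
    (ha : ∀ i, a i = volume.real (stripRow B v p q i))
    (hne : ∀ i ≤ n, (stripRow B v p q i).Nonempty)
    (hS : volume.real B = ∑ i ∈ Finset.range (n + 1), a i)
    (hE : E = volume.real (B + B) - 4 * volume.real B + (a 0 + a n)) (hε0 : 0 ≤ ε) (hE0 : 0 ≤ E)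
    (hnE : n * E ≤ (n + 1) * ε) (hE2 : E ≤ 2 * ε)
    (hF : volume.real (B + B) - 2 * volume.real B - n * (a 0 + a n) ≤ (n + 1) * ε)
    (hσ : 7 * n * ε < a 0 + a n) (ham : ∀ m, 0 < m → m < n → 6 * ε < a m) :
    (∃ (K : Set (ℝ × ℝ)) (φ : (ℝ × ℝ) →ₗ[ℝ] ℝ), IsProperCP11 K φ ∧ B ⊆ cp11Set K φ 0 ∧
      volume (cp11Set K φ 0 \ B) ≤ ENNReal.ofReal (150 * ε)) ∧
    ∃ x w b c : ℝ, (∀ i : ℕ, i ≤ n → 0 ≤ b + i * c) ∧ B ⊆ apIntervals x w b c (n + 1) ∧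
      volume (apIntervals x w b c (n + 1) \ B) ≤ ENNReal.ofReal (500 * (n + 1) * ε) := by
  obtain ⟨l, r, rh, kh, P, Q, hlr, hP, hQ, hrs, hks, hw, hw0, hwn, haw0, hawn⟩ :=
    h.exists_hulls ha hne hS hE hε0 hE2 hσ ham
  have hn := h.n_pos
  have hn1 : (1 : ℝ) ≤ n := by exact_mod_cast hn
  have hcov : ∀ b ∈ B, ∃ i ≤ n, b ∈ Icc (i * v + l i) (i * v + r i) := by
    intro b hb
    obtain ⟨i, hi, hbi⟩ := h.cover b hb
    exact ⟨i, hi, (hlr i hi).1.2 ⟨hb, hbi⟩, (hlr i hi).2.2 ⟨hb, hbi⟩⟩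
  have hle : ∀ i ≤ n, l i ≤ r i := fun i hi => by
    have := (hlr i hi).1.2 (hlr i hi).2.1
    linarith
  rw [Finset.sum_sub_distrib] at hrs hks hw
  constructor
  · have hsub : cp11Set (hullRegion n l r) (skewMap v) 0 ⊆
        ⋃ i ∈ Finset.range (n + 1), Icc (i * v + -kh i) (i * v + rh i) := by
      refine cp11Set_hullRegion_subset (L := fun i => -kh i) (R := rh) (fun i hi => ?_)
        (fun i hi => ?_)
      · obtain ⟨c, m, h1, h2⟩ := hP.exists_majorant i (Nat.zero_le i) hi
        exact ⟨c, m, h1.ge, fun j hj => h2 j (Nat.zero_le j) hj⟩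
      · obtain ⟨c, m, h1, h2⟩ := hQ.exists_majorant i (Nat.zero_le i) hi
        refine ⟨-c, -m, by linarith, fun j hj => ?_⟩
        have := h2 j (Nat.zero_le j) hj
        linarith
    refine ⟨_, _, isProperCP11_skewMap (convex_hullRegion n l r) (p := p) (q := q) (v := v) ?_
      (hullRegion_fst_mem (fun j hj => ?_) fun j hj => ?_), subset_cp11Set_hullRegion hcov, ?_⟩
    · linarith [h.gap, h.p_le_q]
    · linarith [(hlr j hj).1.1.2.1]
    · linarith [(hlr j hj).2.1.2.2]
    · refine volume_sdiff_le_of_subset h.measurable h.volume_ne_top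
        (subset_cp11Set_hullRegion hcov) (by positivity) ((measure_mono hsub).trans ?_)
      refine (volume_biUnion_Icc_le n _ _ fun i hi => ?_).trans (ENNReal.ofReal_le_ofReal ?_)
      · have h1 := hP.self_le (Nat.zero_le i) hi
        have h2 := hQ.self_le (Nat.zero_le i) hi
        linarith [hle i hi]
      · have e : ∑ i ∈ Finset.range (n + 1), (i * v + rh i - (i * v + -kh i)) =
            ∑ i ∈ Finset.range n, rh i + ∑ i ∈ Finset.range n, kh i + (rh n + kh n) := by
          rw [Finset.sum_range_succ, ← Finset.sum_add_distrib]
          congr 1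
          · exact Finset.sum_congr rfl fun i _ => by ring
          · ring
        rw [e, hP.right, hQ.right]
        rw [← Finset.range_eq_Ico] at hrs hks
        rw [Finset.sum_range_succ, Finset.sum_range_succ] at hw
        rw [Finset.sum_neg_distrib] at hks
        linarith
  · obtain ⟨Δr, hΔr0, hΔr, hΔrs⟩ := hP.exists_shift hn
    obtain ⟨Δl, hΔl0, hΔl, hΔls⟩ := hQ.exists_shift hn
    rw [Finset.sum_sub_distrib, mul_sub, sum_chord _ hn] at hΔrs hΔls
    have hiv : ∀ i : ℕ, Icc (l 0 - Δl + i * (v + (l n - l 0) / n)) (l 0 - Δl +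
        i * (v + (l n - l 0) / n) + (r 0 + Δr - (l 0 - Δl)) +
          i * ((r n - r 0) / n - (l n - l 0) / n)) =
        Icc (i * v - (chord (fun i => -l i) 0 n i + Δl)) (i * v + (chord r 0 n i + Δr)) := by
      intro i
      unfold chord
      congr 1 <;> push_cast <;> ring
    have hwid : ∀ i : ℕ, r 0 + Δr - (l 0 - Δl) + i * ((r n - r 0) / n - (l n - l 0) / n) =
        (chord r 0 n i + Δr) + (chord (fun i => -l i) 0 n i + Δl) := by
      intro i
      unfold chord
      push_cast
      ring
    have hsub : B ⊆ apIntervals (l 0 - Δl) (v + (l n - l 0) / n) (r 0 + Δr - (l 0 - Δl))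
        ((r n - r 0) / n - (l n - l 0) / n) (n + 1) := by
      intro b hb
      obtain ⟨i, hi, h1, h2⟩ := hcov b hb
      simp only [apIntervals, hiv, mem_iUnion, Finset.mem_range]
      refine ⟨i, by omega, ?_, ?_⟩
      · linarith [hΔl i hi]
      · linarith [hΔr i hi]
    refine ⟨_, _, _, _, fun i hi => ?_, hsub, ?_⟩
    · rw [hwid]
      linarith [hΔl i hi, hΔr i hi, hle i hi]
    · refine volume_sdiff_le_of_subset h.measurable h.volume_ne_top hsub (by positivity) ?_
      simp only [apIntervals, hiv]
      refine (volume_biUnion_Icc_le n _ _ fun i hi => ?_).trans (ENNReal.ofReal_le_ofReal ?_)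
      · linarith [hΔl i hi, hΔr i hi, hle i hi]
      · have e : 2 * ∑ i ∈ Finset.range (n + 1), (i * v + (chord r 0 n i + Δr) -
            (i * v - (chord (fun i => -l i) 0 n i + Δl))) =
            (n + 1) * (r 0 + r n) + (n + 1) * (-l 0 + -l n) + 2 * ((n + 1) * (Δr + Δl)) := by
          rw [← two_mul_sum_chord_range r hn, ← two_mul_sum_chord_range (fun i => -l i) hn]
          have : (n + 1 : ℝ) * (Δr + Δl) = ∑ i ∈ Finset.range (n + 1), (Δr + Δl) := by simp; ring
          rw [this, ← mul_add, ← mul_add, ← Finset.sum_add_distrib, ← Finset.sum_add_distrib]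
          congr 1
          exact Finset.sum_congr rfl fun i _ => by ring
        rw [← Finset.range_eq_Ico] at hrs hks hΔrs hΔls
        rw [Finset.sum_range_succ, Finset.sum_range_succ] at hw
        rw [Finset.sum_neg_distrib] at hks
        push_cast at hΔrs hΔls
        have hΔ : (n + 1) * (Δr + Δl) ≤ 2 * (n * (Δr + Δl)) := by nlinarith
        have h1 : (n + 1) * (a 0 + a n) ≤ (n + 1) * (r 0 - l 0 + (r n - l n)) :=
          mul_le_mul_of_nonneg_left (by linarith) (by positivity)
        have h2 : (n + 1) * (r 0 - l 0 + (r n - l n)) ≤ (n + 1) * (a 0 + a n + 2 * E) :=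
          mul_le_mul_of_nonneg_left (by linarith) (by positivity)
        have h3 : (n + 1) * E ≤ 2 * (n * E) := by nlinarith
        have h4 : ε ≤ n * ε := by nlinarith
        have h5 : n * (Δr + Δl) ≤ 19 * E + (volume.real (B + B) - 2 * volume.real B -
            n * (a 0 + a n)) := by
          linarith
        have h6 : 500 * (n + 1) * ε = 500 * ((n + 1) * ε) := by ring
        rw [h6]
        linarith
end IsStrip

/-- `A` satisfies the conclusion of the structure theorem. -/
def HasStructure (A : Set ℝ) : Prop :=
  ∃ t : ℕ, CoveredByIntervals A t ∧ (∀ s : ℕ, CoveredByIntervals A s → t ≤ s) ∧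
    2 ≤ t ∧ 0 ≤ dblExcess A t ∧
    (∃ (K : Set (ℝ × ℝ)) (φ : (ℝ × ℝ) →ₗ[ℝ] ℝ) (x₀ : ℝ),
      IsProperCP11 K φ ∧ A ⊆ cp11Set K φ x₀ ∧
      volume (cp11Set K φ x₀ \ A) ≤ volume A) ∧
    (dblExcess A t ≤ ((2 * (t : ℝ)) ^ 2)⁻¹ →
      (∃ (K : Set (ℝ × ℝ)) (φ : (ℝ × ℝ) →ₗ[ℝ] ℝ) (x₀ : ℝ),
        IsProperCP11 K φ ∧ A ⊆ cp11Set K φ x₀ ∧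
        volume (cp11Set K φ x₀ \ A) ≤
          ENNReal.ofReal (150 * dblExcess A t) * volume A) ∧
      (∃ a v b c : ℝ, (∀ i : ℕ, i ≤ t - 1 → 0 ≤ b + i * c) ∧
        A ⊆ apIntervals a v b c t ∧
        volume (apIntervals a v b c t \ A) ≤
          ENNReal.ofReal (500 * t * dblExcess A t) * volume A))

lemma two_le_of_coveredByIntervals {B : Set ℝ} {D : ℝ} {t : ℕ} (hl : IsLeast B 0)
    (hr : IsGreatest B D) (hD : 2 * volume B ≤ ENNReal.ofReal D) (h : CoveredByIntervals B t) :
    2 ≤ t := by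
  obtain ⟨f, g, hB, hv⟩ := h
  by_contra hcon
  have ht : t = 0 ∨ t = 1 := by omega
  obtain ⟨i, hi⟩ := mem_iUnion.1 (hB hl.1)
  have hsub : Icc 0 D ⊆ ⋃ i, Icc (f i) (g i) := by
    obtain ⟨j, hj⟩ := mem_iUnion.1 (hB hr.1)
    have : i = j := by
      rcases ht with rfl | rfl
      · exact i.elim0
      · exact Subsingleton.elim _ _
    subst this
    exact (Icc_subset_Icc hi.1 hj.2).trans (subset_iUnion (fun i => Icc (f i) (g i)) i)
  have := measure_mono (μ := volume) hsub
  rw [Real.volume_Icc, sub_zero] at this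
  exact absurd (hD.trans this) (not_le.2 hv)

section IsStrip

variable {B : Set ℝ} {n : ℕ} {v p q : ℝ}

lemma IsStrip.coveredByIntervals (h : IsStrip B n v p q) (hn : n * (q - p) < 2 * volume.real B)
    {N : ℕ} {ι : ℕ → ℕ} (hN : 0 < N) (hNn : N ≤ n) (hι0 : ι 0 = 0) (hιN : ι N = n)
    (hmem : ∀ i ≤ n, (stripRow B v p q i).Nonempty → ∃ j ≤ N, ι j = i) :
    CoveredByIntervals B (N + 1) := by
  have hle : ∀ i, (if i = 0 then 0 else ι i * v + p) ≤ if i = N then n * v else ι i * v + q := by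
    intro i
    have hv := h.v_pos
    have hι : 0 ≤ ι i * v := by positivity
    have hnv : 0 ≤ n * v := by positivity
    split_ifs with h1 h2 h2
    · exact hnv
    · linarith [h.q_nonneg]
    · subst h2; rw [hιN]; linarith [h.p_nonpos]
    · linarith [h.p_le_q]
  refine coveredByIntervals_of_real (f := fun i => if i = 0 then 0 else ι i * v + p)
    (g := fun i => if i = N then n * v else ι i * v + q) (fun i _ => hle i) (fun b hb => ?_)
    h.volume_ne_top ?_
  · obtain ⟨i, hi, hbi⟩ := h.cover b hb
    obtain ⟨j, hj, rfl⟩ := hmem i hi ⟨b, hb, hbi⟩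
    refine ⟨j, hj, ?_, ?_⟩
    · split_ifs
      · exact h.least.2 hb
      · exact hbi.1
    · split_ifs
      · exact h.greatest.2 hb
      · exact hbi.2
  · have hNn' : (N : ℝ) ≤ n := by exact_mod_cast hNn
    have := sum_width_le hN (w := fun i => (if i = N then n * v else ι i * v + q) -
      if i = 0 then 0 else ι i * v + p) (p := p) (q := q) (by simp [hN.ne, hι0])
      (by simp [hN.ne', hιN]) (fun i h0 h1 => by simp [h0.ne', h1.ne])
    have h2 := mul_le_mul_of_nonneg_right hNn' (sub_nonneg.2 h.p_le_q)
    linarith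

lemma IsStrip.hasStructure (h : IsStrip B n v p q) (hpos : 0 < volume.real B)
    (hn : n * (q - p) < 2 * volume.real B) (hD : 2 * volume.real B ≤ n * v)
    {X : Finset ℕ} (hXn : X ⊆ Finset.range (n + 1)) (hX : 2 * n + 3 < 3 * X.card)
    (hXne : ∀ i ∈ X, (stripRow B v p q i).Nonempty) : HasStructure B := by
  classical
  set I := (Finset.range (n + 1)).filter fun i => (stripRow B v p q i).Nonempty with hI
  have hXI : X ⊆ I := fun i hi => Finset.mem_filter.2 ⟨hXn hi, hXne i hi⟩
  obtain ⟨N, ι, hN, hcard, hmono, hι0, hιN, hmem⟩ := exists_strictMonoOn_enum h.n_pos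
    (I := I) (Finset.filter_subset _ _)
    (Finset.mem_filter.2 ⟨by simp, 0, h.zero_mem_row.1⟩)
    (Finset.mem_filter.2 ⟨by simp, _, h.last_mem_row.1⟩)
  have hXN := Finset.card_le_card hXI
  have hNn : N ≤ n := by
    have := Finset.card_le_card (Finset.filter_subset
      (fun i => (stripRow B v p q i).Nonempty) (Finset.range (n + 1)))
    rw [Finset.card_range, ← hI] at this
    omega
  have hrow : ∀ j ≤ N, (stripRow B v p q (ι j)).Nonempty := fun j hj =>
    (Finset.mem_filter.1 ((hmem _).2 ⟨j, hj, rfl⟩)).2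
  have hmem' : ∀ i ≤ n, (stripRow B v p q i).Nonempty → ∃ j ≤ N, ι j = i := fun i hi hi' =>
    (hmem i).1 (Finset.mem_filter.2 ⟨Finset.mem_range.2 (by omega), hi'⟩)
  have hpb := h.pairBound hrow
  have hS := h.volume_eq_sum hmono hmem'
  have hBf := h.volume_ne_top
  have hSe : volume B = ENNReal.ofReal (volume.real B) := (ENNReal.ofReal_toReal hBf).symm
  have hle := hpb.le_mul hmono hN
  rw [← hS] at hle
  have hcov := h.coveredByIntervals hn hN hNn hι0 hιN hmem'
  obtain ⟨t, ht, htmin⟩ : ∃ t, CoveredByIntervals B t ∧ ∀ s, CoveredByIntervals B s → t ≤ s :=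
    ⟨Nat.find ⟨_, hcov⟩, Nat.find_spec ⟨_, hcov⟩, fun s hs => Nat.find_min' ⟨_, hcov⟩ hs⟩
  have ht2 : 2 ≤ t := two_le_of_coveredByIntervals h.least h.greatest (by
    rw [hSe, ← ENNReal.ofReal_ofNat 2, ← ENNReal.ofReal_mul zero_le_two]
    exact ENNReal.ofReal_le_ofReal hD) ht
  have htN : t ≤ N + 1 := htmin _ hcov
  have ht0 : (2 : ℝ) ≤ t := by exact_mod_cast ht2
  have hN0 : (0 : ℝ) < N + 1 := by positivity
  have hquot : 4 - 2 / ((N : ℝ) + 1) ≤ volume.real (B + B) / volume.real B := by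
    rw [le_div_iff₀ hpos, sub_mul, div_mul_eq_mul_div, sub_le_iff_le_add, ← sub_le_iff_le_add',
      le_div_iff₀ hN0]
    linarith
  have hdef : dblExcess B t = volume.real (B + B) / volume.real B - (4 - 2 / (t : ℝ)) := rfl
  have hlow : 2 / (t : ℝ) - 2 / ((N : ℝ) + 1) ≤ dblExcess B t := by rw [hdef]; linarith
  have hδ0 : 0 ≤ dblExcess B t := by
    have : 2 / ((N : ℝ) + 1) ≤ 2 / t := by
      gcongr
      exact_mod_cast htN
    linarith
  refine ⟨t, ht, htmin, ht2, hδ0, ?_, fun hδ => ?_⟩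
  · obtain ⟨K, φ, h1, h2, h3⟩ := h.exists_coarse hn
    exact ⟨K, φ, 0, h1, h2, by rwa [hSe]⟩
  have htk : t = N + 1 := by
    by_contra hne
    have h1 : (t : ℝ) + 1 ≤ N + 1 := by
      have : t + 1 ≤ N + 1 := by omega
      exact_mod_cast this
    have h2 : 2 / ((N : ℝ) + 1) ≤ 2 / (t + 1) := by gcongr
    have h3 : 2 / (t : ℝ) - 2 / (t + 1) ≤ ((2 * (t : ℝ)) ^ 2)⁻¹ := by linarith
    have h4 : 2 / (t : ℝ) - 2 / (t + 1) = 2 / (t * (t + 1)) := by field_simp; ring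
    rw [h4, inv_eq_one_div, div_le_div_iff₀ (by positivity) (by positivity)] at h3
    nlinarith
  have htk' : (t : ℝ) = N + 1 := by rw [htk]; push_cast; ring
  set ε := dblExcess B t * volume.real B with hε
  have hβ : ((N : ℝ) + 1) * volume.real (B + B) =
      (4 * N + 2) * volume.real B + (N + 1) * ε := by
    rw [hε, hdef, htk']
    field_simp
    ring
  have hεS : 4 * ((N : ℝ) + 1) ^ 2 * ε ≤ volume.real B := by
    have h1 : 4 * ((N : ℝ) + 1) ^ 2 * dblExcess B t ≤ 1 := by
      rw [htk', ← one_div, le_div_iff₀ (by positivity)] at hδ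
      linarith
    have := mul_le_mul_of_nonneg_right h1 hpos.le
    rw [hε]
    linarith
  have hid := hpb.eq_id hmono hN (fun i _ => measureReal_nonneg) hS hpos hβ hεS hι0 hιN (by omega)
  have hNn' : N = n := by rw [← hιN, hid N le_rfl]
  obtain ⟨hε0, hE0, hnE, hE2, hF, -, hσ, ham⟩ :=
    hpb.estimates hmono hN (fun i _ => measureReal_nonneg) hS hpos hβ hεS
  subst hNn'
  have hsumid : ∑ i ∈ Finset.range (N + 1), volume.real (stripRow B v p q (ι i)) =
      ∑ i ∈ Finset.range (N + 1), volume.real (stripRow B v p q i) :=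
    Finset.sum_congr rfl fun i hi => by
      rw [hid i (by rw [Finset.mem_range] at hi; omega)]
  rw [hι0, hιN] at hE0 hnE hE2 hF hσ
  obtain ⟨⟨K, φ, h1, h2, h3⟩, x, w, b, c, h4, h5, h6⟩ := h.exists_fine (ε := ε)
    (a := fun i => volume.real (stripRow B v p q i)) (fun i => rfl)
    (fun i hi => by rw [← hid i hi]; exact hrow i hi) (hS.trans hsumid) rfl hε0 hE0 hnE hE2 hF hσ
    (fun m h1 h2 => by have := ham m h1 h2; rwa [hid m h2.le] at this)
  refine ⟨⟨K, φ, 0, h1, h2, h3.trans_eq ?_⟩, x, w, b, c, ?_⟩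
  · rw [hSe, ← ENNReal.ofReal_mul (by positivity), hε]
    congr 1
    ring
  · rw [htk]
    refine ⟨fun i hi => h4 i (by omega), h5, h6.trans_eq ?_⟩
    rw [hSe, ← ENNReal.ofReal_mul (by rw [← htk]; positivity), hε, htk]
    congr 1
    push_cast
    ring
end IsStrip

/-- The structure theorem for sets with enough extreme points. -/
lemma exists_hasStructure_of_endClosed : ∃ C : ℝ, ∀ (B : Set ℝ) (D : ℝ), MeasurableSet B →
    IsLeast B 0 → IsGreatest B D → EndClosed B → 0 < volume.real B → volume (B + B) ≠ ⊤ →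
    volume.real (B + B) < 4 * volume.real B → C * volume.real B ≤ D → HasStructure B := by
  obtain ⟨C, hC⟩ := exists_strip
  refine ⟨max C 2, fun B D hB hl hr hend hpos hfin hdbl hbig => ?_⟩
  have h2B : 2 * volume.real B ≤ D :=
    le_trans (mul_le_mul_of_nonneg_right (le_max_right _ _) hpos.le) hbig
  have hCB : C * volume.real B ≤ D :=
    le_trans (mul_le_mul_of_nonneg_right (le_max_left _ _) hpos.le) hbig
  obtain ⟨n, p, q, hn, hp, hq, hpq, hnpq, hgap, hcov, hends, X, hXn, hX, hXne⟩ :=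
    hC B D hB hl hr hend hpos hdbl hCB
  have hnD : (n : ℝ) * (D / n) = D := by
    have : (n : ℝ) ≠ 0 := by exact_mod_cast hn.ne'
    field_simp
  have h : IsStrip B n (D / n) p q :=
    { measurable := hB
      finite := hfin
      least := hl
      greatest := by rwa [hnD]
      n_pos := hn
      p_nonpos := hp
      q_nonneg := hq
      gap := by linarith
      cover := hcov
      ends := hends }
  exact h.hasStructure hpos hnpq (by rwa [hnD]) hXn hX hXne

/-- Translates by limits of points of `A` are almost contained in any set containing `A + A`. -/
lemma volume_vadd_sdiff_eq_zero_of_mem_closure {A H : Set ℝ} (hA : MeasurableSet A)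
    (hAf : volume A ≠ ⊤) (hH : A + A ⊆ H) {e : ℝ} (he : e ∈ closure A) :
    volume ((e +ᵥ A) \ H) = 0 := by
  have key : Filter.Tendsto (fun s : ℝ =>
      volume (symmDiff ((fun x => x - s) ⁻¹' A) ((fun x => x - e) ⁻¹' A))) (nhds e) (nhds 0) := by
    let F : ℝ → C(ℝ, ℝ) := fun s => ⟨fun x => x - s, by fun_prop⟩
    have hF : Continuous F := ContinuousMap.continuous_of_continuous_uncurry _ (by
      simp only [Function.uncurry_def, F, ContinuousMap.coe_mk]; fun_prop)
    have hF' : ∀ s, MeasurePreserving (F s) volume volume :=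
      fun s => measurePreserving_sub_right volume s
    exact tendsto_measure_symmDiff_preimage_nhds_zero (f := F) (g := F e) (μ := volume)
      (ν := volume) (hF.tendsto e) (Filter.Eventually.of_forall hF') (hF' e)
      hA.nullMeasurableSet hAf
  have : (nhdsWithin e A).NeBot := mem_closure_iff_nhdsWithin_neBot.1 he
  refine le_antisymm (ge_of_tendsto (key.mono_left (nhdsWithin_le_nhds (s := A))) ?_) (bot_le)
  filter_upwards [self_mem_nhdsWithin] with a ha
  refine measure_mono ?_
  rintro _ ⟨⟨x, hx, rfl⟩, hxH⟩
  refine Or.inr ⟨by simpa using hx, fun h => hxH (hH ⟨a, ha, _, h, ?_⟩)⟩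
  simp

lemma volume_add_self_union_countable {A E : Set ℝ} (hA : MeasurableSet A) (hAf : volume A ≠ ⊤)
    (hE : E.Countable) (hEA : E ⊆ closure A) :
    volume ((A ∪ E) + (A ∪ E)) = volume (A + A) := by
  refine le_antisymm ?_ (measure_mono (add_subset_add subset_union_left subset_union_left))
  set H := toMeasurable volume (A + A) with hH
  have h1 : volume (⋃ e ∈ E, ((e +ᵥ A) \ H)) = 0 := (measure_biUnion_null_iff hE).2 fun e he =>
    volume_vadd_sdiff_eq_zero_of_mem_closure hA hAf (subset_toMeasurable _ _) (hEA he)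
  have h2 : volume (E + E) = 0 := (hE.image2 hE _).measure_zero _
  have hsub : (A ∪ E) + (A ∪ E) ⊆ H ∪ ((⋃ e ∈ E, ((e +ᵥ A) \ H)) ∪ (E + E)) := by
    have hmix : ∀ e ∈ E, ∀ a ∈ A, e + a ∈ H ∪ ((⋃ e ∈ E, ((e +ᵥ A) \ H)) ∪ (E + E)) := by
      intro e he a ha
      by_cases h : e + a ∈ H
      · exact Or.inl h
      · exact Or.inr (Or.inl (mem_iUnion₂.2 ⟨e, he, ⟨a, ha, rfl⟩, h⟩))
    rintro _ ⟨x, hx | hx, y, hy | hy, rfl⟩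
    · exact Or.inl (subset_toMeasurable _ _ ⟨x, hx, y, hy, rfl⟩)
    · have := hmix y hy x hx
      rw [add_comm y x] at this
      exact this
    · exact hmix x hx y hy
    · exact Or.inr (Or.inr ⟨x, hx, y, hy, rfl⟩)
  calc volume ((A ∪ E) + (A ∪ E)) ≤ volume H + volume ((⋃ e ∈ E, ((e +ᵥ A) \ H)) ∪ (E + E)) :=
        (measure_mono hsub).trans (measure_union_le _ _)
    _ = volume (A + A) := by rw [measure_union_null h1 h2, add_zero, measure_toMeasurable]

lemma exists_isLeast_union_inter_Icc {A E : Set ℝ} (hEA : E ⊆ closure A) {a b : ℝ}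
    (hE : (A ∩ Icc a b).Nonempty → sInf (A ∩ Icc a b) ∈ E) (hne : ((A ∪ E) ∩ Icc a b).Nonempty) :
    ∃ l, IsLeast ((A ∪ E) ∩ Icc a b) l := by
  have hcl : A ∪ E ⊆ closure A := union_subset subset_closure hEA
  have hIoo : ∀ x ∈ A ∪ E, x ∈ Ioo a b → x ∈ closure (A ∩ Icc a b) := fun x hx hxab =>
    have hsub : Ioo a b ∩ A ⊆ A ∩ Icc a b := fun y hy => ⟨hy.2, Ioo_subset_Icc_self hy.1⟩
    closure_mono hsub (isOpen_Ioo.inter_closure ⟨hxab, hcl hx⟩)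
  obtain ⟨z, hz, hzab⟩ := hne
  by_cases ha : a ∈ A ∪ E
  · exact ⟨a, ⟨ha, le_rfl, hzab.1.trans hzab.2⟩, fun x hx => hx.2.1⟩
  have hlt : ∀ x ∈ A ∪ E, x ∈ Icc a b → x ≠ b → x ∈ Ioo a b := fun x hx hxab hxb =>
    ⟨lt_of_le_of_ne hxab.1 fun h => ha (h ▸ hx), lt_of_le_of_ne hxab.2 hxb⟩
  by_cases hs : (A ∩ Icc a b).Nonempty
  · have hbdd : BddBelow (A ∩ Icc a b) := ⟨a, fun x hx => hx.2.1⟩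
    have hmem : sInf (A ∩ Icc a b) ∈ Icc a b :=
      isClosed_Icc.closure_subset_iff.2 inter_subset_right (csInf_mem_closure hs hbdd)
    refine ⟨_, ⟨Or.inr (hE hs), hmem⟩, fun x hx => ?_⟩
    by_cases hxb : x = b
    · rw [hxb]; exact hmem.2
    · exact isClosed_Ici.closure_subset_iff.2 (fun y hy => csInf_le hbdd hy)
        (hIoo x hx.1 (hlt x hx.1 hx.2 hxb))
  · have hb : ∀ x ∈ (A ∪ E) ∩ Icc a b, x = b := fun x hx => by
      by_contra hxb
      exact hs (closure_nonempty_iff.1 ⟨x, hIoo x hx.1 (hlt x hx.1 hx.2 hxb)⟩)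
    exact ⟨z, ⟨hz, hzab⟩, fun x hx => by rw [hb x hx, hb z ⟨hz, hzab⟩]⟩

lemma exists_isGreatest_union_inter_Icc {A E : Set ℝ} (hEA : E ⊆ closure A) {a b : ℝ}
    (hE : (A ∩ Icc a b).Nonempty → sSup (A ∩ Icc a b) ∈ E) (hne : ((A ∪ E) ∩ Icc a b).Nonempty) :
    ∃ r, IsGreatest ((A ∪ E) ∩ Icc a b) r := by
  have hcl : -E ⊆ closure (-A) := by rw [← neg_closure]; exact neg_subset_neg.2 hEA
  have hI : ∀ X : Set ℝ, -(X ∩ Icc a b) = -X ∩ Icc (-b) (-a) := fun X => by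
    rw [inter_neg, neg_Icc]
  obtain ⟨l, hl⟩ := exists_isLeast_union_inter_Icc (A := -A) (E := -E) (a := -b) (b := -a) hcl
    (fun h => by
      rw [← hI] at h ⊢
      rw [Real.sInf_neg, neg_mem_neg]
      exact hE (nonempty_neg.1 h))
    (by rw [← union_neg, ← hI]; exact nonempty_neg.2 hne)
  rw [← union_neg, ← hI] at hl
  exact ⟨-l, hl.1, fun x hx => by have := hl.2 (neg_mem_neg.2 hx); linarith⟩

lemma exists_endClosed_union {A : Set ℝ} {D : ℝ} (hne : A.Nonempty) (h0 : IsGLB A 0)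
    (hD : IsLUB A D) : ∃ E : Set ℝ, E.Countable ∧ E ⊆ closure A ∧ EndClosed (A ∪ E) ∧
      IsLeast (A ∪ E) 0 ∧ IsGreatest (A ∪ E) D := by
  set E : Set ℝ := {0, D} ∪ ((⋃ (z : ℚ × ℚ) (_ : (A ∩ Icc (z.1 : ℝ) z.2).Nonempty),
    {sInf (A ∩ Icc (z.1 : ℝ) z.2), sSup (A ∩ Icc (z.1 : ℝ) z.2)}) : Set ℝ) with hE
  have hEA : E ⊆ closure A := by
    rintro x ((rfl | rfl) | hx)
    · exact h0.mem_closure hne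
    · exact hD.mem_closure hne
    · obtain ⟨z, hz, rfl | rfl⟩ := mem_iUnion₂.1 hx
      · exact closure_mono inter_subset_left (csInf_mem_closure hz ⟨z.1, fun x hx => hx.2.1⟩)
      · exact closure_mono inter_subset_left (csSup_mem_closure hz ⟨z.2, fun x hx => hx.2.2⟩)
  have hcl : A ∪ E ⊆ closure A := union_subset subset_closure hEA
  refine ⟨E, ?_, hEA, fun a b hab => ⟨?_, ?_⟩, ⟨?_, fun x hx => ?_⟩, ?_, fun x hx => ?_⟩
  · refine Countable.union (by simp) (countable_iUnion fun z => countable_iUnion fun _ => by simp)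
  · exact exists_isLeast_union_inter_Icc hEA
      (fun h => Or.inr (mem_iUnion₂.2 ⟨(a, b), h, Or.inl rfl⟩)) hab
  · exact exists_isGreatest_union_inter_Icc hEA
      (fun h => Or.inr (mem_iUnion₂.2 ⟨(a, b), h, Or.inr rfl⟩)) hab
  · exact Or.inr (Or.inl (Or.inl rfl))
  · exact isClosed_Ici.closure_subset_iff.2 h0.1 (hcl hx)
  · exact Or.inr (Or.inl (Or.inr rfl))
  · exact isClosed_Iic.closure_subset_iff.2 hD.1 (hcl hx)

/-- Removing countably many limit points preserves the conclusion of the structure theorem. -/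
lemma HasStructure.of_union_countable {A E : Set ℝ} (hE : E.Countable) (hEA : E ⊆ closure A)
    (hadd : volume ((A ∪ E) + (A ∪ E)) = volume (A + A)) (h : HasStructure (A ∪ E)) :
    HasStructure A := by
  have hE0 : volume E = 0 := hE.measure_zero _
  have hvol : volume (A ∪ E) = volume A := by
    refine le_antisymm ?_ (measure_mono subset_union_left)
    simpa [hE0] using measure_union_le (μ := volume) A E
  have hcov : ∀ s, CoveredByIntervals (A ∪ E) s ↔ CoveredByIntervals A s := by
    intro s
    simp only [CoveredByIntervals, hvol]
    refine exists₂_congr fun f g => and_congr_left fun _ => ⟨subset_union_left.trans, fun h => ?_⟩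
    have hcl : IsClosed (⋃ i, Icc (f i) (g i)) := isClosed_iUnion_of_finite fun i => isClosed_Icc
    exact union_subset h (hEA.trans (hcl.closure_subset_iff.2 h))
  have hdbl : ∀ t, dblExcess (A ∪ E) t = dblExcess A t := fun t => by
    rw [dblExcess, dblExcess, hadd, hvol]
  have hsdiff : ∀ P : Set ℝ, volume (P \ A) ≤ volume (P \ (A ∪ E)) := by
    intro P
    have : P \ A ⊆ P \ (A ∪ E) ∪ E := by
      rintro x ⟨hx, hxA⟩
      by_cases hxE : x ∈ E
      · exact Or.inr hxE
      · exact Or.inl ⟨hx, fun h => h.elim hxA hxE⟩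
    simpa [hE0] using (measure_mono this).trans (measure_union_le (μ := volume) _ E)
  obtain ⟨t, h1, h2, h3, h4, ⟨K, φ, x, h5, h6, h7⟩, h8⟩ := h
  simp only [hcov, hdbl, hvol] at *
  refine ⟨t, h1, h2, h3, h4, ⟨K, φ, x, h5, subset_union_left.trans h6, (hsdiff _).trans h7⟩,
    fun hδ => ?_⟩
  obtain ⟨⟨K, φ, x, h5, h6, h7⟩, a, v, b, c, h9, h10, h11⟩ := h8 hδ
  exact ⟨⟨K, φ, x, h5, subset_union_left.trans h6, (hsdiff _).trans h7⟩, a, v, b, c, h9,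
    subset_union_left.trans h10, (hsdiff _).trans h11⟩

lemma vadd_cp11Set (K : Set (ℝ × ℝ)) (φ : (ℝ × ℝ) →ₗ[ℝ] ℝ) (x y : ℝ) :
    y +ᵥ cp11Set K φ x = cp11Set K φ (y + x) := by
  ext w
  simp only [cp11Set, mem_vadd_set, mem_image, vadd_eq_add]
  constructor
  · rintro ⟨_, ⟨z, hz, rfl⟩, rfl⟩
    exact ⟨z, hz, by ring⟩
  · rintro ⟨z, hz, rfl⟩
    exact ⟨_, ⟨z, hz, rfl⟩, by ring⟩

lemma vadd_Icc_real (y a b : ℝ) : y +ᵥ Icc a b = Icc (y + a) (y + b) := by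
  rw [← image_vadd]
  simp [add_comm]

lemma vadd_apIntervals (a v b c : ℝ) (t : ℕ) (y : ℝ) :
    y +ᵥ apIntervals a v b c t = apIntervals (y + a) v b c t := by
  simp only [apIntervals, vadd_set_iUnion, vadd_Icc_real]
  simp only [add_assoc]

lemma CoveredByIntervals.vadd {A : Set ℝ} {t : ℕ} (h : CoveredByIntervals A t) (y : ℝ) :
    CoveredByIntervals (y +ᵥ A) t := by
  obtain ⟨f, g, h1, h2⟩ := h
  refine ⟨fun i => y + f i, fun i => y + g i, ?_, ?_⟩
  · simp only [← vadd_Icc_real, ← vadd_set_iUnion]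
    exact vadd_set_mono h1
  · simp only [← vadd_Icc_real, ← vadd_set_iUnion, measure_vadd]
    exact h2

lemma volume_vadd_add_vadd (y : ℝ) (A : Set ℝ) :
    volume ((y +ᵥ A) + (y +ᵥ A)) = volume (A + A) := by
  rw [← measure_vadd volume (y + y) (A + A)]
  congr 1
  ext w
  simp only [mem_add, mem_vadd_set, vadd_eq_add]
  constructor
  · rintro ⟨_, ⟨a, ha, rfl⟩, _, ⟨b, hb, rfl⟩, rfl⟩
    exact ⟨a + b, ⟨a, ha, b, hb, rfl⟩, by ring⟩
  · rintro ⟨_, ⟨a, ha, b, hb, rfl⟩, rfl⟩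
    exact ⟨_, ⟨a, ha, rfl⟩, _, ⟨b, hb, rfl⟩, by ring⟩

lemma HasStructure.vadd {A : Set ℝ} (h : HasStructure A) (y : ℝ) : HasStructure (y +ᵥ A) := by
  have hdbl : ∀ t, dblExcess (y +ᵥ A) t = dblExcess A t := fun t => by
    rw [dblExcess, dblExcess, volume_vadd_add_vadd, measure_vadd]
  obtain ⟨t, h1, h2, h3, h4, ⟨K, φ, x, h5, h6, h7⟩, h8⟩ := h
  refine ⟨t, h1.vadd y, fun s hs => h2 s ?_, h3, by rwa [hdbl],
    ⟨K, φ, y + x, h5, ?_, ?_⟩, fun hδ => ?_⟩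
  · simpa using hs.vadd (-y)
  · rw [← vadd_cp11Set]; exact vadd_set_mono h6
  · rwa [← vadd_cp11Set, ← vadd_set_sdiff, measure_vadd, measure_vadd]
  · rw [hdbl] at hδ ⊢
    obtain ⟨⟨K, φ, x, h5, h6, h7⟩, a, v, b, c, h9, h10, h11⟩ := h8 hδ
    refine ⟨⟨K, φ, y + x, h5, ?_, ?_⟩, y + a, v, b, c, h9, ?_, ?_⟩
    · rw [← vadd_cp11Set]; exact vadd_set_mono h6
    · rwa [← vadd_cp11Set, ← vadd_set_sdiff, measure_vadd, measure_vadd]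
    · rw [← vadd_apIntervals]; exact vadd_set_mono h10
    · rwa [← vadd_apIntervals, ← vadd_set_sdiff, measure_vadd, measure_vadd]

lemma exists_hasStructure : ∃ C : ℝ, 0 < C ∧
    ∀ A : Set ℝ, MeasurableSet A → Bornology.IsBounded A → 0 < volume A →
      ENNReal.ofReal C * volume A ≤ volume (convexHull ℝ A) →
      volume (A + A) < 4 * volume A → HasStructure A := by
  obtain ⟨C, hC⟩ := exists_hasStructure_of_endClosed
  refine ⟨max C 1, by positivity, fun A hA hb hpos hco hdbl => ?_⟩
  have hne : A.Nonempty := nonempty_of_measure_ne_zero hpos.ne'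
  have hAf : volume A ≠ ⊤ := hb.measure_lt_top.ne
  have hm := isGLB_csInf hne hb.bddBelow
  have hM := isLUB_csSup hne hb.bddAbove
  set m := sInf A
  set M := sSup A
  have hcoM : volume (convexHull ℝ A) ≤ ENNReal.ofReal (M - m) := by
    rw [← Real.volume_Icc]
    exact measure_mono (convexHull_min (fun x hx => ⟨hm.1 hx, hM.1 hx⟩) (convex_Icc m M))
  have hmM : m ≤ M := by
    obtain ⟨x, hx⟩ := hne
    exact (hm.1 hx).trans (hM.1 hx)
  set A' := -m +ᵥ A with hA'
  have hvol' : volume A' = volume A := measure_vadd _ _ _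
  have hadd' : volume (A' + A') = volume (A + A) := volume_vadd_add_vadd _ _
  have hA'm : MeasurableSet A' := hA.const_vadd _
  have hmA : m +ᵥ A' = A := by rw [hA']; simp
  have h0 : IsGLB A' 0 := by
    refine ⟨?_, fun w hw => ?_⟩
    · rintro _ ⟨x, hx, rfl⟩
      have := hm.1 hx
      simp only [vadd_eq_add]; linarith
    · have := hm.2 (fun x hx => by
        have := hw ⟨x, hx, rfl⟩
        simp only [vadd_eq_add] at this
        linarith : w + m ∈ lowerBounds A)
      linarith
  have hD : IsLUB A' (M - m) := by
    refine ⟨?_, fun w hw => ?_⟩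
    · rintro _ ⟨x, hx, rfl⟩
      have := hM.1 hx
      simp only [vadd_eq_add]; linarith
    · have := hM.2 (fun x hx => by
        have := hw ⟨x, hx, rfl⟩
        simp only [vadd_eq_add] at this
        linarith : w + m ∈ upperBounds A)
      linarith
  obtain ⟨E, hE, hEA, hend, hl, hr⟩ := exists_endClosed_union (hne.vadd_set) h0 hD
  have haddE := volume_add_self_union_countable hA'm (by rwa [hvol']) hE hEA
  have hvolE : volume (A' ∪ E) = volume A := by
    refine le_antisymm ?_ (by rw [← hvol']; exact measure_mono subset_union_left)
    simpa [hE.measure_zero, hvol'] using measure_union_le (μ := volume) A' E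
  have hS : 0 < volume.real A := ENNReal.toReal_pos hpos.ne' hAf
  have hSe : volume A = ENNReal.ofReal (volume.real A) := (ENNReal.ofReal_toReal hAf).symm
  have haddf : volume (A + A) ≠ ⊤ := hdbl.ne_top
  have hrS : volume.real (A' ∪ E) = volume.real A := by rw [measureReal_def, hvolE]; rfl
  have hrβ : volume.real ((A' ∪ E) + (A' ∪ E)) = volume.real (A + A) := by
    rw [measureReal_def, haddE, hadd']; rfl
  rw [← hmA]
  refine (HasStructure.of_union_countable hE hEA haddE ?_).vadd m
  refine hC _ _ (hA'm.union hE.measurableSet) hl hr hend (by rwa [hrS])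
    (by rwa [haddE, hadd']) ?_ ?_
  · rw [hrS, hrβ]
    have := (ENNReal.toReal_lt_toReal haddf (mul_ne_top (by simp) hAf)).2 hdbl
    rw [ENNReal.toReal_mul] at this
    simpa [measureReal_def] using this
  · rw [hrS]
    have h1 := hco.trans hcoM
    rw [hSe, ← ENNReal.ofReal_mul (by positivity),
      ENNReal.ofReal_le_ofReal_iff (sub_nonneg.2 hmM)] at h1
    exact (mul_le_mul_of_nonneg_right (le_max_left C 1) hS.le).trans h1

theorem stmt_8 :
    ∃ C : ℝ, 0 < C ∧
      ∀ A : Set ℝ, MeasurableSet A → Bornology.IsBounded A → 0 < volume A →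
        ENNReal.ofReal C * volume A ≤ volume (convexHull ℝ A) →
        volume (A + A) < 4 * volume A →
        ∃ t : ℕ, CoveredByIntervals A t ∧ (∀ s : ℕ, CoveredByIntervals A s → t ≤ s) ∧
          2 ≤ t ∧ 0 ≤ dblExcess A t ∧
          (∃ (K : Set (ℝ × ℝ)) (φ : (ℝ × ℝ) →ₗ[ℝ] ℝ) (x₀ : ℝ),
            IsProperCP11 K φ ∧ A ⊆ cp11Set K φ x₀ ∧
            volume (cp11Set K φ x₀ \ A) ≤ volume A) ∧
          (dblExcess A t ≤ ((2 * (t : ℝ)) ^ 2)⁻¹ →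
            (∃ (K : Set (ℝ × ℝ)) (φ : (ℝ × ℝ) →ₗ[ℝ] ℝ) (x₀ : ℝ),
              IsProperCP11 K φ ∧ A ⊆ cp11Set K φ x₀ ∧
              volume (cp11Set K φ x₀ \ A) ≤
                ENNReal.ofReal (150 * dblExcess A t) * volume A) ∧
            (∃ a v b c : ℝ, (∀ i : ℕ, i ≤ t - 1 → 0 ≤ b + i * c) ∧
              A ⊆ apIntervals a v b c t ∧
              volume (apIntervals a v b c t \ A) ≤
                ENNReal.ofReal (500 * t * dblExcess A t) * volume A)) := by
  exact exists_hasStructure
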